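/- (Concentration of the overlap) Let M_u, M_v > 0. For n large enough, there exists a constant M such that for all (a,b) ∈ (0,M_u)² with a < min{1,b}, all δ ∈ (0,a), all R_v ∈ [0,M_v] and all t ∈ [0,1]: ∫_a^b E⟨ (Q_v − E⟨Q_v⟩_{t,(R_u,R_v)})² ⟩_{t,(R_u,R_v)} dR_u ≤ M ( 1/(δ² n) − ln(a)/n + δ/(a−δ) ). -/

import Mathlib

open MeasureTheory Real Filter Set

noncomputable section

/-- i.i.d. standard Gaussian measure on `Fin n → ℝ`. -/
def stdGaussian (n : ℕ) : Measure (Fin n → ℝ) :=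
  Measure.pi fun _ : Fin n => ProbabilityTheory.gaussianReal 0 1

/-- i.i.d. standard Gaussian measure on matrices `Fin p → Fin q → ℝ`. -/
def stdGaussianMat (p q : ℕ) : Measure (Fin p → Fin q → ℝ) :=
  Measure.pi fun _ : Fin p => stdGaussian q

/-- `P` is the uniform (rotation-invariant) probability measure on the sphere of
radius `r` centered at the origin in `ℝⁿ`. -/
def IsUniformSphere (n : ℕ) (r : ℝ) (P : Measure (Fin n → ℝ)) : Prop :=
  IsProbabilityMeasure P ∧
  (∀ᵐ x ∂P, ∑ i, (x i) ^ 2 = r ^ 2) ∧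
  ∀ O : Matrix (Fin n) (Fin n) ℝ, O ∈ Matrix.orthogonalGroup (Fin n) ℝ →
    P.map (fun x => O.mulVec x) = P

/-- The interpolating Hamiltonian `H_{t,R}(u,v)`, with the observations
`Y^{(t)} = √((1−t)/n) U Vᵀ + Z`, `Ỹ = √(α_v R_v) U + Z̃`, `Ȳ = √(α_u R_u) V + Z̄`
substituted. -/
def interpH (n nu nv : ℕ) (au av t Ru Rv : ℝ)
    (U : Fin nu → ℝ) (V : Fin nv → ℝ) (Z : Fin nu → Fin nv → ℝ)
    (Zt : Fin nu → ℝ) (Zb : Fin nv → ℝ)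
    (u : Fin nu → ℝ) (v : Fin nv → ℝ) : ℝ :=
  (∑ i, ∑ j, ((1 - t) / (2 * n) * (u i) ^ 2 * (v j) ^ 2
      - Real.sqrt ((1 - t) / n) * u i * v j
          * (Real.sqrt ((1 - t) / n) * U i * V j + Z i j)))
  + (∑ i, (av * Rv / 2 * (u i) ^ 2
      - Real.sqrt (av * Rv) * u i * (Real.sqrt (av * Rv) * U i + Zt i)))
  + (∑ j, (au * Ru / 2 * (v j) ^ 2
      - Real.sqrt (au * Ru) * v j * (Real.sqrt (au * Ru) * V j + Zb j)))

/-- The partition function `Z_{t,R} = ∫∫ e^{−H_{t,R}(u,v)} dP_u(u) dP_v(v)`. -/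
def partFun (n nu nv : ℕ) (au av t Ru Rv : ℝ)
    (Pu : Measure (Fin nu → ℝ)) (Pv : Measure (Fin nv → ℝ))
    (U : Fin nu → ℝ) (V : Fin nv → ℝ) (Z : Fin nu → Fin nv → ℝ)
    (Zt : Fin nu → ℝ) (Zb : Fin nv → ℝ) : ℝ :=
  ∫ u, (∫ v, Real.exp (-(interpH n nu nv au av t Ru Rv U V Z Zt Zb u v)) ∂Pv) ∂Pu

/-- The Gibbs bracket `⟨f⟩_{t,R}`, i.e. the expectation of `f(u,v)` under the
posterior measure proportional to `e^{−H_{t,R}(u,v)} dP_u(u) dP_v(v)`. -/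
def gibbs (n nu nv : ℕ) (au av t Ru Rv : ℝ)
    (Pu : Measure (Fin nu → ℝ)) (Pv : Measure (Fin nv → ℝ))
    (U : Fin nu → ℝ) (V : Fin nv → ℝ) (Z : Fin nu → Fin nv → ℝ)
    (Zt : Fin nu → ℝ) (Zb : Fin nv → ℝ)
    (f : (Fin nu → ℝ) → (Fin nv → ℝ) → ℝ) : ℝ :=
  (∫ u, (∫ v, f u v * Real.exp (-(interpH n nu nv au av t Ru Rv U V Z Zt Zb u v)) ∂Pv) ∂Pu)
    / partFun n nu nv au av t Ru Rv Pu Pv U V Z Zt Zb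

/-- Expectation `E` over all the randomness `U ~ P_u`, `V ~ P_v` and the independent
standard Gaussian noises `Z, Z̃, Z̄`. -/
def Efull (nu nv : ℕ)
    (Pu : Measure (Fin nu → ℝ)) (Pv : Measure (Fin nv → ℝ))
    (g : (Fin nu → ℝ) → (Fin nv → ℝ) → (Fin nu → Fin nv → ℝ) →
      (Fin nu → ℝ) → (Fin nv → ℝ) → ℝ) : ℝ :=
  ∫ U, (∫ V, (∫ Z, (∫ Zt, (∫ Zb, g U V Z Zt Zb
    ∂(stdGaussian nv)) ∂(stdGaussian nu)) ∂(stdGaussianMat nu nv)) ∂Pv) ∂Pu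

/-- The average interpolating free entropy `fₙ(t,R) = (1/n) E ln Z_{t,R}`. -/
def interpFreeEntropy (n nu nv : ℕ) (au av t Ru Rv : ℝ)
    (Pu : Measure (Fin nu → ℝ)) (Pv : Measure (Fin nv → ℝ)) : ℝ :=
  (1 / (n : ℝ)) * Efull nu nv Pu Pv (fun U V Z Zt Zb =>
    Real.log (partFun n nu nv au av t Ru Rv Pu Pv U V Z Zt Zb))

/-- The overlap `Q_u = (1/n_u) Σ_i u_i U_i`. -/
def overlapU (nu : ℕ) (u U : Fin nu → ℝ) : ℝ := (1 / (nu : ℝ)) * ∑ i, u i * U i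

/-- The overlap `Q_v = (1/n_v) Σ_j v_j V_j`. -/
def overlapV (nv : ℕ) (v V : Fin nv → ℝ) : ℝ := (1 / (nv : ℝ)) * ∑ j, v j * V j

/-- `E⟨Q_v⟩_{t,R}`. -/
def eQv (n nu nv : ℕ) (au av t Ru Rv : ℝ)
    (Pu : Measure (Fin nu → ℝ)) (Pv : Measure (Fin nv → ℝ)) : ℝ :=
  Efull nu nv Pu Pv (fun U V Z Zt Zb =>
    gibbs n nu nv au av t Ru Rv Pu Pv U V Z Zt Zb (fun _ v => overlapV nv v V))

/-- `E⟨Q_u⟩_{t,R}`. -/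
def eQu (n nu nv : ℕ) (au av t Ru Rv : ℝ)
    (Pu : Measure (Fin nu → ℝ)) (Pv : Measure (Fin nv → ℝ)) : ℝ :=
  Efull nu nv Pu Pv (fun U V Z Zt Zb =>
    gibbs n nu nv au av t Ru Rv Pu Pv U V Z Zt Zb (fun u _ => overlapU nu u U))

/-- The quantity `𝓛 = (1/n) Σ_j [(α_u/2)v_j² − α_u v_j V_j − (1/2)√(α_u/R_u) v_j Z̄_j]`. -/
def calL (n nv : ℕ) (au Ru : ℝ) (v V Zb : Fin nv → ℝ) : ℝ :=
  (1 / (n : ℝ)) * ∑ j, (au / 2 * (v j) ^ 2 - au * v j * V j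
    - 1 / 2 * Real.sqrt (au / Ru) * v j * Zb j)

/-- `E⟨𝓛⟩_{t,R}`. -/
def eL (n nu nv : ℕ) (au av t Ru Rv : ℝ)
    (Pu : Measure (Fin nu → ℝ)) (Pv : Measure (Fin nv → ℝ)) : ℝ :=
  Efull nu nv Pu Pv (fun U V Z Zt Zb =>
    gibbs n nu nv au av t Ru Rv Pu Pv U V Z Zt Zb (fun _ v => calL n nv au Ru v V Zb))

/-- `φ₀(m) = (m − ln(1+m))/2`. -/
def phi0 (m : ℝ) : ℝ := (m - Real.log (1 + m)) / 2


/-- `E⟨(Q_v − E⟨Q_v⟩)²⟩_{t,R}`. -/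
def overlapVarV (n nu nv : ℕ) (au av t Ru Rv : ℝ)
    (Pu : Measure (Fin nu → ℝ)) (Pv : Measure (Fin nv → ℝ)) : ℝ :=
  Efull nu nv Pu Pv (fun U V Z Zt Zb =>
    gibbs n nu nv au av t Ru Rv Pu Pv U V Z Zt Zb
      (fun _ v => (overlapV nv v V - eQv n nu nv au av t Ru Rv Pu Pv) ^ 2))

section GaussianTools
open scoped RealInnerProductSpace ENNReal
variable {E : Type*} [NormedAddCommGroup E] [InnerProductSpace ℝ E] [FiniteDimensional ℝ E]
  [MeasurableSpace E] [BorelSpace E]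

/-- The Cameron–Martin density of the standard Gaussian measure translated by `x`. -/
def cmDensity (x y : E) : ℝ := Real.exp (⟪x, y⟫ - ‖x‖ ^ 2 / 2)

lemma cmDensity_pos (x y : E) : 0 < cmDensity x y := Real.exp_pos _

lemma measurable_cmDensity (x : E) : Measurable (cmDensity x) := by
  unfold cmDensity; fun_prop

lemma integral_cexp_inner_stdGaussian (x t : E) :
    ∫ y, Complex.exp ((⟪x, y⟫ : ℝ) + (⟪y, t⟫ : ℝ) * Complex.I)
        ∂(ProbabilityTheory.stdGaussian E)
      = Complex.exp (((‖x‖ ^ 2 / 2 : ℝ) : ℂ) - ((‖t‖ ^ 2 / 2 : ℝ) : ℂ)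
          + (⟪x, t⟫ : ℝ) * Complex.I) := by
  let b := stdOrthonormalBasis ℝ E
  rw [ProbabilityTheory.stdGaussian_eq_map_pi_orthonormalBasis b,
    integral_map (by fun_prop : Measurable _).aemeasurable (by fun_prop)]
  have h1 : ∀ z : Fin (Module.finrank ℝ E) → ℝ,
      Complex.exp ((⟪x, ∑ i, z i • b i⟫ : ℝ) + (⟪∑ i, z i • b i, t⟫ : ℝ) * Complex.I)
        = ∏ i, Complex.exp (((⟪x, b i⟫ : ℝ) + (⟪b i, t⟫ : ℝ) * Complex.I) * (z i : ℂ)) := by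
    intro z
    rw [← Complex.exp_sum]
    congr 1
    simp only [inner_sum, sum_inner, inner_smul_left, inner_smul_right]
    push_cast
    rw [Finset.sum_mul, ← Finset.sum_add_distrib]
    refine Finset.sum_congr rfl fun i _ => ?_
    simp
    ring
  simp_rw [h1]
  rw [integral_fintype_prod_eq_prod
    (f := fun i (s : ℝ) => Complex.exp (((⟪x, b i⟫ : ℝ) + (⟪b i, t⟫ : ℝ) * Complex.I) * (s : ℂ)))]
  have h2 : ∀ i, ∫ s : ℝ, Complex.exp (((⟪x, b i⟫ : ℝ) + (⟪b i, t⟫ : ℝ) * Complex.I) * (s : ℂ))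
      ∂(ProbabilityTheory.gaussianReal 0 1)
      = Complex.exp (((⟪x, b i⟫ : ℝ) + (⟪b i, t⟫ : ℝ) * Complex.I) ^ 2 / 2) := by
    intro i
    have := ProbabilityTheory.complexMGF_id_gaussianReal (μ := 0) (v := 1)
      ((⟪x, b i⟫ : ℝ) + (⟪b i, t⟫ : ℝ) * Complex.I)
    simpa [ProbabilityTheory.complexMGF] using this
  simp_rw [h2]
  rw [← Complex.exp_sum]
  congr 1
  have hx : ‖x‖ ^ 2 = ∑ i, ⟪x, b i⟫ ^ 2 := by
    rw [← b.sum_sq_norm_inner_left x]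
    simp
  have ht : ‖t‖ ^ 2 = ∑ i, ⟪b i, t⟫ ^ 2 := by
    rw [← b.sum_sq_norm_inner_right t]
    simp
  have hxt : ⟪x, t⟫ = ∑ i, ⟪x, b i⟫ * ⟪b i, t⟫ := (b.sum_inner_mul_inner x t).symm
  rw [hx, ht, hxt]
  push_cast
  rw [Finset.sum_div, Finset.sum_div, Finset.sum_mul, ← Finset.sum_sub_distrib,
    ← Finset.sum_add_distrib]
  refine Finset.sum_congr rfl fun i _ => ?_
  ring_nf
  rw [Complex.I_sq]
  ring

lemma integral_exp_inner_stdGaussian (x : E) :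
    ∫ y, Real.exp ⟪x, y⟫ ∂(ProbabilityTheory.stdGaussian E) = Real.exp (‖x‖ ^ 2 / 2) := by
  have := integral_cexp_inner_stdGaussian x 0
  simp only [inner_zero_right, Complex.ofReal_zero, zero_mul, add_zero, norm_zero] at this
  have h : ∀ y : E, Complex.exp ((⟪x, y⟫ : ℝ)) = ((Real.exp ⟪x, y⟫ : ℝ) : ℂ) := fun y => by
    rw [Complex.ofReal_exp]
  simp_rw [h] at this
  rw [integral_complex_ofReal] at this
  apply Complex.ofReal_injective
  rw [this, Complex.ofReal_exp]
  simp

lemma integrable_exp_inner_stdGaussian (x : E) :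
    Integrable (fun y => Real.exp ⟪x, y⟫) (ProbabilityTheory.stdGaussian E) := by
  by_contra h
  have := integral_exp_inner_stdGaussian x
  rw [integral_undef h] at this
  exact (Real.exp_pos _).ne this

lemma integral_cmDensity (x : E) :
    ∫ y, cmDensity x y ∂(ProbabilityTheory.stdGaussian E) = 1 := by
  unfold cmDensity
  simp_rw [Real.exp_sub]
  rw [integral_div, integral_exp_inner_stdGaussian, div_self (Real.exp_pos _).ne']

lemma integrable_cmDensity (x : E) :
    Integrable (cmDensity x) (ProbabilityTheory.stdGaussian E) := by
  unfold cmDensity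
  simp_rw [Real.exp_sub]
  exact (integrable_exp_inner_stdGaussian x).div_const _

/-- The Cameron–Martin formula for the standard Gaussian measure. -/
lemma stdGaussian_map_add (x : E) :
    (ProbabilityTheory.stdGaussian E).map (fun y => y + x)
      = (ProbabilityTheory.stdGaussian E).withDensity
          (fun y => ENNReal.ofReal (cmDensity x y)) := by
  have hd : IsFiniteMeasure ((ProbabilityTheory.stdGaussian E).withDensity
      (fun y => ENNReal.ofReal (cmDensity x y))) :=
    isFiniteMeasure_withDensity_ofReal (integrable_cmDensity x).2
  have hm : IsFiniteMeasure ((ProbabilityTheory.stdGaussian E).map (fun y => y + x)) := inferInstance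
  apply Measure.ext_of_charFun
  ext t
  rw [charFun_map_add_const, ProbabilityTheory.charFun_stdGaussian, charFun_apply,
    integral_withDensity_eq_integral_toReal_smul
      (measurable_cmDensity x).ennreal_ofReal (by simp)]
  have h : ∀ y : E, (ENNReal.ofReal (cmDensity x y)).toReal • Complex.exp ((⟪y, t⟫ : ℝ) * Complex.I)
      = Complex.exp (-((‖x‖ ^ 2 / 2 : ℝ) : ℂ)) *
        Complex.exp ((⟪x, y⟫ : ℝ) + (⟪y, t⟫ : ℝ) * Complex.I) := by
    intro y
    rw [ENNReal.toReal_ofReal (cmDensity_pos x y).le, cmDensity, Complex.real_smul,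
      Complex.ofReal_exp, ← Complex.exp_add, ← Complex.exp_add]
    congr 1
    push_cast
    ring
  simp_rw [h]
  rw [integral_const_mul, integral_cexp_inner_stdGaussian, ← Complex.exp_add, ← Complex.exp_add]
  congr 1
  push_cast
  ring

lemma measurableEmbedding_add_const (x : E) : MeasurableEmbedding (fun y : E => y + x) :=
  (Homeomorph.addRight x).measurableEmbedding

lemma integral_add_stdGaussian (x : E) (F : E → ℝ) :
    ∫ y, F (y + x) ∂(ProbabilityTheory.stdGaussian E)
      = ∫ y, cmDensity x y * F y ∂(ProbabilityTheory.stdGaussian E) := by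
  rw [← (measurableEmbedding_add_const x).integral_map F, stdGaussian_map_add,
    integral_withDensity_eq_integral_toReal_smul
      (measurable_cmDensity x).ennreal_ofReal (by simp)]
  simp_rw [ENNReal.toReal_ofReal (cmDensity_pos x _).le, smul_eq_mul]

lemma integrable_add_stdGaussian_iff (x : E) (F : E → ℝ) :
    Integrable (fun y => F (y + x)) (ProbabilityTheory.stdGaussian E)
      ↔ Integrable (fun y => cmDensity x y * F y) (ProbabilityTheory.stdGaussian E) := by
  have h := (measurableEmbedding_add_const x).integrable_map_iff
    (μ := ProbabilityTheory.stdGaussian E) (g := F)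
  rw [stdGaussian_map_add, integrable_withDensity_iff_integrable_smul'
    (measurable_cmDensity x).ennreal_ofReal (by simp)] at h
  simp_rw [ENNReal.toReal_ofReal (cmDensity_pos x _).le, smul_eq_mul] at h
  exact h.symm

lemma integral_inner_stdGaussian (w : E) :
    ∫ y, ⟪w, y⟫ ∂(ProbabilityTheory.stdGaussian E) = 0 :=
  ProbabilityTheory.integral_strongDual_stdGaussian (innerSL ℝ w)

lemma integrable_norm_pow_stdGaussian (k : ℕ) :
    Integrable (fun y : E => ‖y‖ ^ k) (ProbabilityTheory.stdGaussian E) := by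
  have := (ProbabilityTheory.IsGaussian.memLp_id (ProbabilityTheory.stdGaussian E) k
    (by simp)).integrable_norm_pow'
  simpa using this

lemma integrable_inner_stdGaussian (w : E) :
    Integrable (fun y => ⟪w, y⟫) (ProbabilityTheory.stdGaussian E) :=
  ProbabilityTheory.IsGaussian.integrable_dual (ProbabilityTheory.stdGaussian E) (innerSL ℝ w)

lemma integrable_inner_sq_stdGaussian (w : E) :
    Integrable (fun y => ⟪w, y⟫ ^ 2) (ProbabilityTheory.stdGaussian E) :=
  (ProbabilityTheory.IsGaussian.memLp_dual (ProbabilityTheory.stdGaussian E)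
    (innerSL ℝ w) 2 (by simp)).integrable_sq

lemma integral_inner_sq_stdGaussian (w : E) :
    ∫ y, ⟪w, y⟫ ^ 2 ∂(ProbabilityTheory.stdGaussian E) = ‖w‖ ^ 2 := by
  have h := ProbabilityTheory.variance_dual_stdGaussian (innerSL ℝ w)
  rw [ProbabilityTheory.variance_of_integral_eq_zero (by fun_prop)
    (ProbabilityTheory.integral_strongDual_stdGaussian _), innerSL_apply_norm] at h
  simpa using h

end GaussianTools

section Channel
open scoped RealInnerProductSpace ENNReal
variable {Ω E : Type*} [MeasurableSpace Ω]
  [NormedAddCommGroup E] [InnerProductSpace ℝ E] [FiniteDimensional ℝ E]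
  [MeasurableSpace E] [BorelSpace E]

/-- Log-likelihood of the observation `y` of the signal `V` through a Gaussian channel with
amplitude `r`, relative to pure noise. -/
def chLog (V : Ω → E) (r : ℝ) (y : E) (ω : Ω) : ℝ := ⟪r • V ω, y⟫ - ‖r • V ω‖ ^ 2 / 2

/-- The evidence of the observation `y` under the prior `ν`. -/
def chZ (ν : Measure Ω) (V : Ω → E) (r : ℝ) (y : E) : ℝ := ∫ ω, Real.exp (chLog V r y ω) ∂ν

/-- The posterior distribution given the observation `y`. -/
def chPost (ν : Measure Ω) (V : Ω → E) (r : ℝ) (y : E) : Measure Ω := ν.tilted (chLog V r y)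

/-- The posterior mean of the signal. -/
def chMean (ν : Measure Ω) (V : Ω → E) (r : ℝ) (y : E) : E := ∫ ω, V ω ∂(chPost ν V r y)

variable {ν : Measure Ω} [IsProbabilityMeasure ν] {V : Ω → E} {κ r : ℝ}

lemma exp_chLog (V : Ω → E) (r : ℝ) (y : E) (ω : Ω) :
    Real.exp (chLog V r y ω) = cmDensity (r • V ω) y := rfl

lemma measurable_chLog_uncurry (hV : Measurable V) (r : ℝ) :
    Measurable (fun p : Ω × E => chLog V r p.2 p.1) := by
  unfold chLog; fun_prop

lemma measurable_chLog (hV : Measurable V) (r : ℝ) (y : E) : Measurable (chLog V r y) := by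
  unfold chLog; fun_prop

lemma abs_chLog_le (hκ : ∀ ω, ‖V ω‖ = κ) (hr : 0 ≤ r) (y : E) (ω : Ω) :
    |chLog V r y ω| ≤ r * κ * ‖y‖ + r ^ 2 * κ ^ 2 / 2 := by
  unfold chLog
  have h1 := abs_real_inner_le_norm (r • V ω) y
  have h2 : ‖r • V ω‖ = r * κ := by rw [norm_smul, hκ, Real.norm_of_nonneg hr]
  rw [h2] at h1 ⊢
  refine (abs_sub _ _).trans ?_
  rw [abs_of_nonneg (by positivity : 0 ≤ (r * κ) ^ 2 / 2)]
  nlinarith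

lemma integrable_exp_chLog (ν : Measure Ω) [IsProbabilityMeasure ν]
    (hV : Measurable V) (hκ : ∀ ω, ‖V ω‖ = κ) (hr : 0 ≤ r) (y : E) :
    Integrable (fun ω => Real.exp (chLog V r y ω)) ν := by
  refine Integrable.of_bound (measurable_chLog hV r y).exp.aestronglyMeasurable
    (Real.exp (r * κ * ‖y‖ + r ^ 2 * κ ^ 2 / 2)) (ae_of_all _ fun ω => ?_)
  rw [Real.norm_of_nonneg (Real.exp_pos _).le]
  exact Real.exp_le_exp.2 ((le_abs_self _).trans (abs_chLog_le hκ hr y ω))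

lemma isProbabilityMeasure_chPost (ν : Measure Ω) [IsProbabilityMeasure ν]
    (hV : Measurable V) (hκ : ∀ ω, ‖V ω‖ = κ) (hr : 0 ≤ r) (y : E) :
    IsProbabilityMeasure (chPost ν V r y) :=
  isProbabilityMeasure_tilted (integrable_exp_chLog ν hV hκ hr y)

lemma exp_neg_le_chZ (ν : Measure Ω) [IsProbabilityMeasure ν]
    (hV : Measurable V) (hκ : ∀ ω, ‖V ω‖ = κ) (hr : 0 ≤ r) (y : E) :
    Real.exp (-(r * κ * ‖y‖ + r ^ 2 * κ ^ 2 / 2)) ≤ chZ ν V r y := by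
  have h := integral_mono (μ := ν) (integrable_const (Real.exp (-(r * κ * ‖y‖ + r ^ 2 * κ ^ 2 / 2))))
    (integrable_exp_chLog ν hV hκ hr y)
    (fun ω => Real.exp_le_exp.2 (abs_le.1 (abs_chLog_le hκ hr y ω)).1)
  simpa [chZ] using h

lemma chZ_le_exp (ν : Measure Ω) [IsProbabilityMeasure ν]
    (hV : Measurable V) (hκ : ∀ ω, ‖V ω‖ = κ) (hr : 0 ≤ r) (y : E) :
    chZ ν V r y ≤ Real.exp (r * κ * ‖y‖ + r ^ 2 * κ ^ 2 / 2) := by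
  have h := integral_mono (μ := ν) (integrable_exp_chLog ν hV hκ hr y)
    (integrable_const (Real.exp (r * κ * ‖y‖ + r ^ 2 * κ ^ 2 / 2)))
    (fun ω => Real.exp_le_exp.2 (abs_le.1 (abs_chLog_le hκ hr y ω)).2)
  simpa [chZ] using h

lemma chZ_pos (ν : Measure Ω) [IsProbabilityMeasure ν]
    (hV : Measurable V) (hκ : ∀ ω, ‖V ω‖ = κ) (hr : 0 ≤ r) (y : E) : 0 < chZ ν V r y :=
  (Real.exp_pos _).trans_le (exp_neg_le_chZ ν hV hκ hr y)

lemma abs_log_chZ_le (ν : Measure Ω) [IsProbabilityMeasure ν]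
    (hV : Measurable V) (hκ : ∀ ω, ‖V ω‖ = κ) (hr : 0 ≤ r) (y : E) :
    |Real.log (chZ ν V r y)| ≤ r * κ * ‖y‖ + r ^ 2 * κ ^ 2 / 2 := by
  have h0 := chZ_pos ν hV hκ hr y
  rw [abs_le]
  exact ⟨(Real.le_log_iff_exp_le h0).2 (exp_neg_le_chZ ν hV hκ hr y),
    (Real.log_le_iff_le_exp h0).2 (chZ_le_exp ν hV hκ hr y)⟩

lemma measurable_chZ (ν : Measure Ω) [IsProbabilityMeasure ν] (hV : Measurable V) (r : ℝ) :
    Measurable (chZ ν V r) := by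
  have : StronglyMeasurable (fun p : E × Ω => Real.exp (chLog V r p.1 p.2)) :=
    ((measurable_chLog_uncurry hV r).comp measurable_swap).exp.stronglyMeasurable
  exact this.integral_prod_right.measurable

lemma chZ_mul_integral_chPost (ν : Measure Ω) [IsProbabilityMeasure ν]
    (hV : Measurable V) (hκ : ∀ ω, ‖V ω‖ = κ) (hr : 0 ≤ r) (y : E) (g : Ω → ℝ) :
    chZ ν V r y * ∫ ω, g ω ∂(chPost ν V r y) = ∫ ω, Real.exp (chLog V r y ω) * g ω ∂ν := by
  rw [chPost, integral_tilted, ← integral_const_mul]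
  congr 1 with ω
  have := (chZ_pos ν hV hκ hr y).ne'
  change chZ ν V r y * ((Real.exp (chLog V r y ω) / chZ ν V r y) • g ω) = _
  rw [smul_eq_mul]
  field_simp

lemma integrable_of_le_add_norm_sq (ν : Measure Ω) [IsProbabilityMeasure ν]
    {F : Ω × E → ℝ} (hF : Measurable F) {A B : ℝ} (hFb : ∀ p, |F p| ≤ A + B * ‖p.2‖ ^ 2) :
    Integrable F (ν.prod (ProbabilityTheory.stdGaussian E)) := by
  refine Integrable.mono' (g := fun p => A + B * ‖p.2‖ ^ 2) ?_ hF.aestronglyMeasurable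
    (ae_of_all _ hFb)
  exact (integrable_const A).add
    (((integrable_norm_pow_stdGaussian 2).const_mul B).comp_snd ν)

/-- Averaging over the posterior and then over the observation is averaging over the joint law
of signal and observation. -/
lemma channel_average (ν : Measure Ω) [IsProbabilityMeasure ν]
    (hV : Measurable V) (hκ : ∀ ω, ‖V ω‖ = κ) (hr : 0 ≤ r)
    {F : Ω → E → ℝ} (hF : Measurable (Function.uncurry F)) {A B : ℝ}
    (hFb : ∀ ω y, |F ω y| ≤ A + B * ‖y‖ ^ 2) :
    Integrable (fun y => chZ ν V r y * ∫ ω, F ω y ∂(chPost ν V r y))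
        (ProbabilityTheory.stdGaussian E) ∧
      ∫ y, chZ ν V r y * ∫ ω, F ω y ∂(chPost ν V r y) ∂(ProbabilityTheory.stdGaussian E)
        = ∫ ω, ∫ y, F ω (y + r • V ω) ∂(ProbabilityTheory.stdGaussian E) ∂ν := by
  have hshift : Measurable (fun p : Ω × E => F p.1 (p.2 + r • V p.1)) :=
    hF.comp (measurable_fst.prodMk (measurable_snd.add ((hV.comp measurable_fst).const_smul r)))
  have hB : ∀ y : E, ‖y‖ ^ 2 * B ≤ ‖y‖ ^ 2 * |B| := fun y =>
    mul_le_mul_of_nonneg_left (le_abs_self B) (by positivity)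
  have hb : ∀ p : Ω × E, |F p.1 (p.2 + r • V p.1)|
      ≤ (A + 2 * |B| * (r * κ) ^ 2) + 2 * |B| * ‖p.2‖ ^ 2 := by
    intro p
    refine (hFb _ _).trans ?_
    have h1 : ‖p.2 + r • V p.1‖ ≤ ‖p.2‖ + r * κ := by
      refine (norm_add_le _ _).trans ?_
      rw [norm_smul, hκ, Real.norm_of_nonneg hr]
    have h2 : ‖p.2 + r • V p.1‖ ^ 2 ≤ 2 * ‖p.2‖ ^ 2 + 2 * (r * κ) ^ 2 := by
      have := pow_le_pow_left₀ (norm_nonneg _) h1 2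
      nlinarith [sq_nonneg (‖p.2‖ - r * κ)]
    have h3 := hB (p.2 + r • V p.1)
    have h4 := mul_le_mul_of_nonneg_right h2 (abs_nonneg B)
    nlinarith
  have hI := integrable_of_le_add_norm_sq ν hshift hb
  have hI2 : Integrable (fun p : Ω × E => Real.exp (chLog V r p.2 p.1) * F p.1 p.2)
      (ν.prod (ProbabilityTheory.stdGaussian E)) := by
    have hm : Measurable (fun p : Ω × E => Real.exp (chLog V r p.2 p.1) * F p.1 p.2) :=
      (measurable_chLog_uncurry hV r).exp.mul hF
    rw [integrable_prod_iff hm.aestronglyMeasurable]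
    rw [integrable_prod_iff hshift.aestronglyMeasurable] at hI
    refine ⟨?_, ?_⟩
    · filter_upwards [hI.1] with ω h
      simp_rw [exp_chLog]
      exact (integrable_add_stdGaussian_iff (r • V ω) (F ω)).1 h
    · refine hI.2.congr (ae_of_all _ fun ω => ?_)
      change ∫ y, ‖F ω (y + r • V ω)‖ ∂_ = ∫ y, ‖Real.exp (chLog V r y ω) * F ω y‖ ∂_
      rw [integral_add_stdGaussian (r • V ω) (fun y => ‖F ω y‖)]
      simp_rw [exp_chLog, norm_mul, Real.norm_of_nonneg (cmDensity_pos _ _).le]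
  simp_rw [chZ_mul_integral_chPost ν hV hκ hr]
  refine ⟨hI2.integral_prod_right, ?_⟩
  rw [← integral_integral_swap (f := fun ω y => Real.exp (chLog V r y ω) * F ω y) hI2]
  congr 1 with ω
  rw [integral_add_stdGaussian (r • V ω) (F ω)]
  simp_rw [exp_chLog]

end Channel

section SinglePrior
open scoped RealInnerProductSpace ENNReal
variable {Ω E : Type*} [MeasurableSpace Ω]
  [NormedAddCommGroup E] [InnerProductSpace ℝ E] [FiniteDimensional ℝ E]
  [MeasurableSpace E] [BorelSpace E]
variable {ν : Measure Ω} [IsProbabilityMeasure ν] {V : Ω → E} {κ r : ℝ}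

lemma integral_sub_add {α : Type*} [MeasurableSpace α] {μ : Measure α} {f g h : α → ℝ}
    (hf : Integrable f μ) (hg : Integrable g μ) (hh : Integrable h μ) :
    ∫ x, (f x - g x + h x) ∂μ = ∫ x, f x ∂μ - ∫ x, g x ∂μ + ∫ x, h x ∂μ := by
  rw [← integral_sub hf hg]
  exact integral_add (hf.sub hg) hh

/-- The second moment of the posterior mean, averaged over the observation. -/
def chQ (ν : Measure Ω) (V : Ω → E) (r : ℝ) : ℝ :=
  ∫ y, chZ ν V r y * ‖chMean ν V r y‖ ^ 2 ∂(ProbabilityTheory.stdGaussian E)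

/-- The average log-evidence. -/
def chF (ν : Measure Ω) (V : Ω → E) (r : ℝ) : ℝ :=
  ∫ y, chZ ν V r y * Real.log (chZ ν V r y) ∂(ProbabilityTheory.stdGaussian E)

/-- The mean square deviation of the log-evidence from `c`. -/
def chW (ν : Measure Ω) (V : Ω → E) (r c : ℝ) : ℝ :=
  ∫ y, chZ ν V r y * (Real.log (chZ ν V r y) - c) ^ 2 ∂(ProbabilityTheory.stdGaussian E)

lemma channel_average_const (ν : Measure Ω) [IsProbabilityMeasure ν]
    (hV : Measurable V) (hκ : ∀ ω, ‖V ω‖ = κ) (hr : 0 ≤ r)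
    {g : E → ℝ} (hg : Measurable g) {A B : ℝ} (hgb : ∀ y, |g y| ≤ A + B * ‖y‖ ^ 2) :
    Integrable (fun y => chZ ν V r y * g y) (ProbabilityTheory.stdGaussian E) ∧
      ∫ y, chZ ν V r y * g y ∂(ProbabilityTheory.stdGaussian E)
        = ∫ ω, ∫ y, g (y + r • V ω) ∂(ProbabilityTheory.stdGaussian E) ∂ν := by
  have h := channel_average ν hV hκ hr (F := fun _ y => g y)
    (hg.comp measurable_snd) (fun _ y => hgb y)
  have h2 : ∀ y, ∫ _ω, g y ∂(chPost ν V r y) = g y := fun y => by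
    have := isProbabilityMeasure_chPost ν hV hκ hr y
    simp
  simpa only [h2] using h

lemma integrable_chZ (ν : Measure Ω) [IsProbabilityMeasure ν]
    (hV : Measurable V) (hκ : ∀ ω, ‖V ω‖ = κ) (hr : 0 ≤ r) :
    Integrable (chZ ν V r) (ProbabilityTheory.stdGaussian E) := by
  simpa using (channel_average_const ν hV hκ hr (g := fun _ => 1) measurable_const
    (A := 1) (B := 0) (by simp)).1

lemma integral_chZ (ν : Measure Ω) [IsProbabilityMeasure ν]
    (hV : Measurable V) (hκ : ∀ ω, ‖V ω‖ = κ) (hr : 0 ≤ r) :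
    ∫ y, chZ ν V r y ∂(ProbabilityTheory.stdGaussian E) = 1 := by
  simpa using (channel_average_const ν hV hκ hr (g := fun _ => 1) measurable_const
    (A := 1) (B := 0) (by simp)).2

lemma integrable_of_norm_eq {P : Measure Ω} [IsProbabilityMeasure P]
    (hV : Measurable V) (hκ : ∀ ω, ‖V ω‖ = κ) : Integrable V P :=
  Integrable.of_bound hV.aestronglyMeasurable κ (ae_of_all _ fun ω => (hκ ω).le)

lemma norm_mean_le {P : Measure Ω} [IsProbabilityMeasure P] (hκ : ∀ ω, ‖V ω‖ = κ) :
    ‖∫ ω, V ω ∂P‖ ≤ κ := by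
  simpa using norm_integral_le_of_norm_le_const (μ := P) (ae_of_all _ fun ω => (hκ ω).le)

lemma norm_chMean_le (ν : Measure Ω) [IsProbabilityMeasure ν]
    (hV : Measurable V) (hκ : ∀ ω, ‖V ω‖ = κ) (hr : 0 ≤ r) (y : E) :
    ‖chMean ν V r y‖ ≤ κ := by
  have := isProbabilityMeasure_chPost ν hV hκ hr y
  exact norm_mean_le hκ

lemma inner_chMean (ν : Measure Ω) [IsProbabilityMeasure ν]
    (hV : Measurable V) (hκ : ∀ ω, ‖V ω‖ = κ) (hr : 0 ≤ r) (w y : E) :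
    ⟪w, chMean ν V r y⟫ = ∫ ω, ⟪w, V ω⟫ ∂(chPost ν V r y) := by
  have := isProbabilityMeasure_chPost ν hV hκ hr y
  exact (integral_inner (integrable_of_norm_eq hV hκ) w).symm

lemma measurable_chMean (ν : Measure Ω) [IsProbabilityMeasure ν]
    (hV : Measurable V) (r : ℝ) : Measurable (chMean ν V r) := by
  unfold chMean chPost
  simp_rw [integral_tilted]
  have : StronglyMeasurable (fun p : E × Ω => (Real.exp (chLog V r p.1 p.2) /
      chZ ν V r p.1) • V p.2) := by
    refine Measurable.stronglyMeasurable ?_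
    exact (((measurable_chLog_uncurry hV r).comp measurable_swap).exp.div
      ((measurable_chZ ν hV r).comp measurable_fst)).smul (hV.comp measurable_snd)
  exact this.integral_prod_right.measurable

lemma kappa_nonneg (ν : Measure Ω) [IsProbabilityMeasure ν] (hκ : ∀ ω, ‖V ω‖ = κ) : 0 ≤ κ := by
  obtain ⟨ω⟩ := nonempty_of_isProbabilityMeasure ν
  exact (hκ ω) ▸ norm_nonneg _

lemma chZ_mul_inner_chMean (ν : Measure Ω) [IsProbabilityMeasure ν]
    (hV : Measurable V) (hκ : ∀ ω, ‖V ω‖ = κ) (hr : 0 ≤ r) (w : E) :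
    Integrable (fun y => chZ ν V r y * ⟪w, chMean ν V r y⟫) (ProbabilityTheory.stdGaussian E) ∧
    ∫ y, chZ ν V r y * ⟪w, chMean ν V r y⟫ ∂(ProbabilityTheory.stdGaussian E)
      = ⟪w, ∫ ω, V ω ∂ν⟫ := by
  have h := channel_average ν hV hκ hr (F := fun ω _ => ⟪w, V ω⟫) (A := ‖w‖ * κ) (B := 0)
    (by unfold Function.uncurry; fun_prop) (fun ω y => by
      rw [← hκ ω]; simpa using abs_real_inner_le_norm w (V ω))
  simp_rw [inner_chMean ν hV hκ hr]
  refine ⟨h.1, h.2.trans ?_⟩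
  rw [← integral_inner (integrable_of_norm_eq hV hκ)]
  simp

lemma integrable_chZ_mul_norm_sq (ν : Measure Ω) [IsProbabilityMeasure ν]
    (hV : Measurable V) (hκ : ∀ ω, ‖V ω‖ = κ) (hr : 0 ≤ r) :
    Integrable (fun y => chZ ν V r y * ‖chMean ν V r y‖ ^ 2)
      (ProbabilityTheory.stdGaussian E) := by
  refine (channel_average_const ν hV hκ hr (A := κ ^ 2) (B := 0)
    ((measurable_chMean ν hV r).norm.pow_const 2) fun y => ?_).1
  rw [abs_of_nonneg (by positivity), zero_mul, add_zero]
  exact pow_le_pow_left₀ (norm_nonneg _) (norm_chMean_le ν hV hκ hr y) 2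

lemma chQ_nonneg (ν : Measure Ω) [IsProbabilityMeasure ν]
    (hV : Measurable V) (hκ : ∀ ω, ‖V ω‖ = κ) (hr : 0 ≤ r) : 0 ≤ chQ ν V r :=
  integral_nonneg fun y => mul_nonneg (chZ_pos ν hV hκ hr y).le (by positivity)

lemma chQ_le (ν : Measure Ω) [IsProbabilityMeasure ν]
    (hV : Measurable V) (hκ : ∀ ω, ‖V ω‖ = κ) (hr : 0 ≤ r) : chQ ν V r ≤ κ ^ 2 := by
  have h := integral_mono (integrable_chZ_mul_norm_sq ν hV hκ hr)
    ((integrable_chZ ν hV hκ hr).mul_const (κ ^ 2)) (fun y => mul_le_mul_of_nonneg_left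
      (pow_le_pow_left₀ (norm_nonneg _) (norm_chMean_le ν hV hκ hr y) 2)
      (chZ_pos ν hV hκ hr y).le)
  rw [integral_mul_const, integral_chZ ν hV hκ hr, one_mul] at h
  exact h

lemma integral_norm_chMean_sub_sq (ν : Measure Ω) [IsProbabilityMeasure ν]
    (hV : Measurable V) (hκ : ∀ ω, ‖V ω‖ = κ) (hr : 0 ≤ r) :
    Integrable (fun y => chZ ν V r y * ‖chMean ν V r y - ∫ ω, V ω ∂ν‖ ^ 2)
      (ProbabilityTheory.stdGaussian E) ∧
    ∫ y, chZ ν V r y * ‖chMean ν V r y - ∫ ω, V ω ∂ν‖ ^ 2 ∂(ProbabilityTheory.stdGaussian E)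
      = chQ ν V r - ‖∫ ω, V ω ∂ν‖ ^ 2 := by
  set m := ∫ ω, V ω ∂ν with hm
  have h1 := integrable_chZ_mul_norm_sq ν hV hκ hr
  have h2 := chZ_mul_inner_chMean ν hV hκ hr m
  have h3 := integrable_chZ ν hV hκ hr
  have he : ∀ y, chZ ν V r y * ‖chMean ν V r y - m‖ ^ 2
      = chZ ν V r y * ‖chMean ν V r y‖ ^ 2 - 2 * (chZ ν V r y * ⟪m, chMean ν V r y⟫)
        + chZ ν V r y * ‖m‖ ^ 2 := fun y => by
    rw [norm_sub_sq_real, real_inner_comm]; ring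
  simp_rw [he]
  refine ⟨(h1.sub (h2.1.const_mul 2)).add (h3.mul_const _), ?_⟩
  rw [integral_sub_add h1 (h2.1.const_mul 2) (h3.mul_const _), integral_const_mul, h2.2, integral_mul_const,
    integral_chZ ν hV hκ hr, real_inner_self_eq_norm_sq, chQ]
  ring

lemma norm_mean_sq_le_chQ (ν : Measure Ω) [IsProbabilityMeasure ν]
    (hV : Measurable V) (hκ : ∀ ω, ‖V ω‖ = κ) (hr : 0 ≤ r) :
    ‖∫ ω, V ω ∂ν‖ ^ 2 ≤ chQ ν V r := by
  have h := (integral_norm_chMean_sub_sq ν hV hκ hr).2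
  have h2 : 0 ≤ ∫ y, chZ ν V r y * ‖chMean ν V r y - ∫ ω, V ω ∂ν‖ ^ 2
      ∂(ProbabilityTheory.stdGaussian E) :=
    integral_nonneg fun y => mul_nonneg (chZ_pos ν hV hκ hr y).le (by positivity)
  linarith

lemma integral_sub_const_sq {P : Measure Ω} [IsProbabilityMeasure P] {X : Ω → ℝ}
    (hX : Integrable X P) (hX2 : Integrable (fun ω => X ω ^ 2) P) (b : ℝ) :
    ∫ ω, (X ω - b) ^ 2 ∂P = ∫ ω, (X ω) ^ 2 ∂P - 2 * b * ∫ ω, X ω ∂P + b ^ 2 := by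
  have he : ∀ ω, (X ω - b) ^ 2 = X ω ^ 2 - 2 * b * X ω + b ^ 2 := fun ω => by ring
  simp_rw [he]
  rw [integral_sub_add hX2 (hX.const_mul _) (integrable_const _), integral_const_mul]
  simp

lemma integral_inner_sub_mean_sq_le (ν : Measure Ω) [IsProbabilityMeasure ν]
    (hV : Measurable V) (hκ : ∀ ω, ‖V ω‖ = κ) (hr : 0 < r) (w : E) :
    ∫ ω, (⟪w, V ω⟫ - ⟪w, ∫ ω, V ω ∂ν⟫) ^ 2 ∂ν
      ≤ ‖w‖ ^ 2 * (1 / r ^ 2 + (chQ ν V r - ‖∫ ω, V ω ∂ν‖ ^ 2)) := by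
  have hκ0 := kappa_nonneg ν hκ
  set m := ∫ ω, V ω ∂ν with hm
  have hmκ : ‖m‖ ≤ κ := norm_mean_le hκ
  have hw : ∀ ω, |⟪w, V ω⟫| ≤ ‖w‖ * κ := fun ω => by
    rw [← hκ ω]; exact abs_real_inner_le_norm w (V ω)
  have hwm : |⟪w, m⟫| ≤ ‖w‖ * κ :=
    (abs_real_inner_le_norm w m).trans (mul_le_mul_of_nonneg_left hmκ (norm_nonneg _))
  have hsq : ∀ x y : ℝ, |(x - y) ^ 2| ≤ 2 * |x| ^ 2 + 2 * |y| ^ 2 := fun x y => by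
    rw [abs_of_nonneg (sq_nonneg _), sq_abs, sq_abs]
    nlinarith [sq_nonneg (x + y)]
  have h1 := channel_average ν hV hκ hr.le (F := fun ω _ => (⟪w, V ω⟫ - ⟪w, m⟫) ^ 2)
    (A := 4 * (‖w‖ * κ) ^ 2) (B := 0) (by unfold Function.uncurry; fun_prop) (fun ω y => by
      refine (hsq _ _).trans ?_
      have := pow_le_pow_left₀ (abs_nonneg _) (hw ω) 2
      have := pow_le_pow_left₀ (abs_nonneg _) hwm 2
      linarith)
  have h2 := channel_average ν hV hκ hr.le (F := fun ω y => (⟪w, V ω⟫ - ⟪w, y⟫ / r) ^ 2)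
    (A := 2 * (‖w‖ * κ) ^ 2) (B := 2 * ‖w‖ ^ 2 / r ^ 2) (by unfold Function.uncurry; fun_prop)
    (fun ω y => by
      refine (hsq _ _).trans ?_
      have h3 := pow_le_pow_left₀ (abs_nonneg _) (hw ω) 2
      have h4 := pow_le_pow_left₀ (abs_nonneg _) (abs_real_inner_le_norm w y) 2
      have h5 : |⟪w, y⟫ / r| ^ 2 ≤ ‖w‖ ^ 2 / r ^ 2 * ‖y‖ ^ 2 := by
        rw [abs_div, div_pow, sq_abs r, div_mul_eq_mul_div, ← mul_pow]
        gcongr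
      calc _ ≤ 2 * (‖w‖ * κ) ^ 2 + 2 * (‖w‖ ^ 2 / r ^ 2 * ‖y‖ ^ 2) := by linarith
        _ = _ := by ring)
  have h3 := integral_norm_chMean_sub_sq ν hV hκ hr.le
  have hL : ∫ ω, (⟪w, V ω⟫ - ⟪w, m⟫) ^ 2 ∂ν
      = ∫ ω, ∫ y, (⟪w, V ω⟫ - ⟪w, m⟫) ^ 2 ∂(ProbabilityTheory.stdGaussian E) ∂ν := by simp
  have hR : ∫ ω, ∫ y, (⟪w, V ω⟫ - ⟪w, y + r • V ω⟫ / r) ^ 2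
      ∂(ProbabilityTheory.stdGaussian E) ∂ν = ‖w‖ ^ 2 / r ^ 2 := by
    have : ∀ (ω : Ω) (y : E), (⟪w, V ω⟫ - ⟪w, y + r • V ω⟫ / r) ^ 2 = ⟪w, y⟫ ^ 2 / r ^ 2 := by
      intro ω y
      rw [inner_add_right, inner_smul_right]
      field_simp
      ring
    simp_rw [this, integral_div, integral_inner_sq_stdGaussian]
    simp
  rw [hL, ← h1.2, show ‖w‖ ^ 2 * (1 / r ^ 2 + (chQ ν V r - ‖m‖ ^ 2))
    = ‖w‖ ^ 2 / r ^ 2 + ‖w‖ ^ 2 * (chQ ν V r - ‖m‖ ^ 2) by ring, ← hR, ← h2.2, ← h3.2,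
    ← integral_const_mul, ← integral_add h2.1 (h3.1.const_mul _)]
  refine integral_mono h1.1 (h2.1.add (h3.1.const_mul _)) fun y => ?_
  have hP := isProbabilityMeasure_chPost ν hV hκ hr.le y
  have hX : Integrable (fun ω => ⟪w, V ω⟫) (chPost ν V r y) :=
    (integrable_of_norm_eq hV hκ).const_inner w
  have hX2 : Integrable (fun ω => ⟪w, V ω⟫ ^ 2) (chPost ν V r y) :=
    Integrable.of_bound (by fun_prop) ((‖w‖ * κ) ^ 2) (ae_of_all _ fun ω => by
      rw [norm_pow, Real.norm_eq_abs]
      exact pow_le_pow_left₀ (abs_nonneg _) (hw ω) 2)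
  change chZ ν V r y * _ ≤ chZ ν V r y * _ + _
  rw [integral_sub_const_sq hX hX2, integral_sub_const_sq hX hX2,
    ← inner_chMean ν hV hκ hr.le]
  have hZ := (chZ_pos ν hV hκ hr.le y).le
  have hin : ⟪w, chMean ν V r y - m⟫ ^ 2 ≤ ‖w‖ ^ 2 * ‖chMean ν V r y - m‖ ^ 2 := by
    rw [← mul_pow, ← sq_abs]
    exact pow_le_pow_left₀ (abs_nonneg _) (abs_real_inner_le_norm _ _) 2
  rw [inner_sub_right] at hin
  have := mul_le_mul_of_nonneg_left hin hZ
  nlinarith [mul_nonneg hZ (sq_nonneg (⟪w, chMean ν V r y⟫ - ⟪w, y⟫ / r))]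

end SinglePrior

section SinglePriorBound
open scoped RealInnerProductSpace ENNReal
variable {Ω E : Type*} [MeasurableSpace Ω]
  [NormedAddCommGroup E] [InnerProductSpace ℝ E] [FiniteDimensional ℝ E]
  [MeasurableSpace E] [BorelSpace E]
variable {ν : Measure Ω} [IsProbabilityMeasure ν] {V : Ω → E} {κ r : ℝ}

lemma integral_inner_add_sub_stdGaussian (w : E) (a b : ℝ) :
    ∫ y, (⟪w, y⟫ + a - b) ∂(ProbabilityTheory.stdGaussian E) = a - b := by
  simp_rw [add_sub_assoc]
  rw [integral_add (integrable_inner_stdGaussian w) (integrable_const _),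
    integral_inner_stdGaussian]
  simp

lemma measurable_log_chZ (ν : Measure Ω) [IsProbabilityMeasure ν] (hV : Measurable V) (r : ℝ) :
    Measurable (fun y => Real.log (chZ ν V r y)) := (measurable_chZ ν hV r).log

lemma abs_log_chZ_le_sq (ν : Measure Ω) [IsProbabilityMeasure ν]
    (hV : Measurable V) (hκ : ∀ ω, ‖V ω‖ = κ) (hr : 0 ≤ r) (y : E) :
    |Real.log (chZ ν V r y)| ≤ (r * κ + r ^ 2 * κ ^ 2) + r * κ * ‖y‖ ^ 2 := by
  have hκ0 := kappa_nonneg ν hκ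
  have h := abs_log_chZ_le ν hV hκ hr y
  have h2 : ‖y‖ ≤ 1 + ‖y‖ ^ 2 := by nlinarith [sq_nonneg (‖y‖ - 1)]
  have h3 := mul_le_mul_of_nonneg_left h2 (mul_nonneg hr hκ0)
  nlinarith [mul_nonneg (sq_nonneg r) (sq_nonneg κ)]

lemma log_chZ_sub_sq_le (ν : Measure Ω) [IsProbabilityMeasure ν]
    (hV : Measurable V) (hκ : ∀ ω, ‖V ω‖ = κ) (hr : 0 ≤ r) (c : ℝ) (y : E) :
    |(Real.log (chZ ν V r y) - c) ^ 2|
      ≤ (3 * (r ^ 2 * κ ^ 2 / 2) ^ 2 + 3 * c ^ 2) + 3 * (r * κ) ^ 2 * ‖y‖ ^ 2 := by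
  have hκ0 := kappa_nonneg ν hκ
  have h := pow_le_pow_left₀ (abs_nonneg _) (abs_log_chZ_le ν hV hκ hr y) 2
  rw [sq_abs] at h
  rw [abs_of_nonneg (sq_nonneg _)]
  generalize Real.log (chZ ν V r y) = L at *
  generalize r ^ 2 * κ ^ 2 / 2 = q at *
  have : (r * κ * ‖y‖) ^ 2 = (r * κ) ^ 2 * ‖y‖ ^ 2 := by ring
  generalize r * κ * ‖y‖ = p at *
  rw [mul_assoc, ← this]
  nlinarith [sq_nonneg (L + c / 2), sq_nonneg (L - c), sq_nonneg (L + 2 * c), sq_nonneg (p - q),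
    sq_nonneg (p - 2 * q), sq_nonneg (2 * p - q), sq_nonneg (L+c)]

lemma integrable_chZ_mul_log (ν : Measure Ω) [IsProbabilityMeasure ν]
    (hV : Measurable V) (hκ : ∀ ω, ‖V ω‖ = κ) (hr : 0 ≤ r) :
    Integrable (fun y => chZ ν V r y * Real.log (chZ ν V r y))
      (ProbabilityTheory.stdGaussian E) :=
  (channel_average_const ν hV hκ hr (measurable_log_chZ ν hV r)
    (abs_log_chZ_le_sq ν hV hκ hr)).1

lemma integrable_chZ_mul_log_sub_sq (ν : Measure Ω) [IsProbabilityMeasure ν]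
    (hV : Measurable V) (hκ : ∀ ω, ‖V ω‖ = κ) (hr : 0 ≤ r) (c : ℝ) :
    Integrable (fun y => chZ ν V r y * (Real.log (chZ ν V r y) - c) ^ 2)
      (ProbabilityTheory.stdGaussian E) :=
  (channel_average_const ν hV hκ hr (((measurable_log_chZ ν hV r).sub_const c).pow_const 2)
    (log_chZ_sub_sq_le ν hV hκ hr c)).1

/-- `x - y ≤ x log x - x log y`. -/
lemma sub_le_mul_log_sub {x y : ℝ} (hx : 0 < x) (hy : 0 < y) :
    x - y ≤ x * Real.log x - x * Real.log y := by
  have h := Real.log_le_sub_one_of_pos (div_pos hy hx)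
  rw [Real.log_div hy.ne' hx.ne'] at h
  have h2 := mul_le_mul_of_nonneg_left h hx.le
  have h3 : x * (y / x - 1) = y - x := by field_simp
  linarith

lemma norm_mean_sq_le_chF (ν : Measure Ω) [IsProbabilityMeasure ν]
    (hV : Measurable V) (hκ : ∀ ω, ‖V ω‖ = κ) (hr : 0 ≤ r) :
    r ^ 2 * ‖∫ ω, V ω ∂ν‖ ^ 2 / 2 ≤ chF ν V r := by
  set m := ∫ ω, V ω ∂ν with hm
  have hg : Measurable (fun y : E => ⟪r • m, y⟫ - ‖r • m‖ ^ 2 / 2) := by fun_prop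
  have hgb : ∀ y : E, |⟪r • m, y⟫ - ‖r • m‖ ^ 2 / 2|
      ≤ (‖r • m‖ + ‖r • m‖ ^ 2) + ‖r • m‖ * ‖y‖ ^ 2 := by
    intro y
    have h1 := abs_real_inner_le_norm (r • m) y
    have h2 := abs_sub (⟪r • m, y⟫) (‖r • m‖ ^ 2 / 2)
    rw [abs_of_nonneg (by positivity : (0:ℝ) ≤ ‖r • m‖ ^ 2 / 2)] at h2
    have h3 : ‖y‖ ≤ 1 + ‖y‖ ^ 2 := by nlinarith [sq_nonneg (‖y‖ - 1)]
    have h4 := mul_le_mul_of_nonneg_left h3 (norm_nonneg (r • m))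
    nlinarith [sq_nonneg ‖r • m‖]
  have h1 := channel_average_const ν hV hκ hr hg hgb
  have hval : ∫ ω, ∫ y, (⟪r • m, y + r • V ω⟫ - ‖r • m‖ ^ 2 / 2)
      ∂(ProbabilityTheory.stdGaussian E) ∂ν = r ^ 2 * ‖m‖ ^ 2 / 2 := by
    have : ∀ ω, ∫ y, (⟪r • m, y + r • V ω⟫ - ‖r • m‖ ^ 2 / 2)
        ∂(ProbabilityTheory.stdGaussian E) = ⟪r • m, r • V ω⟫ - ‖r • m‖ ^ 2 / 2 := by
      intro ω
      simp_rw [inner_add_right]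
      rw [integral_inner_add_sub_stdGaussian]
    simp_rw [this]
    have hVi : Integrable V ν := integrable_of_norm_eq hV hκ
    simp_rw [inner_smul_left, inner_smul_right]
    rw [integral_sub (((hVi.const_inner _).const_mul _).const_mul _) (integrable_const _),
      integral_const_mul, integral_const_mul, integral_inner hVi, ← hm,
      real_inner_self_eq_norm_sq, norm_smul, Real.norm_of_nonneg hr]
    simp
    ring
  have hZ := integrable_chZ ν hV hκ hr
  have hF := integrable_chZ_mul_log ν hV hκ hr
  have hcm := integrable_cmDensity (r • m)
  have hmono := integral_mono (hZ.sub hcm) (hF.sub h1.1) (fun y => by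
    have := sub_le_mul_log_sub (chZ_pos ν hV hκ hr y) (cmDensity_pos (r • m) y)
    rwa [cmDensity, Real.log_exp] at this)
  simp only [Pi.sub_apply] at hmono
  rw [integral_sub hZ hcm, integral_sub hF h1.1, h1.2, hval, integral_chZ ν hV hκ hr,
    integral_cmDensity] at hmono
  change _ ≤ ∫ y, _ ∂_
  linarith

lemma chF_le (ν : Measure Ω) [IsProbabilityMeasure ν]
    (hV : Measurable V) (hκ : ∀ ω, ‖V ω‖ = κ) (hr : 0 ≤ r) :
    chF ν V r ≤ r ^ 2 * κ ^ 2 / 2 := by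
  have hκ0 := kappa_nonneg ν hκ
  have h := channel_average ν hV hκ hr (F := fun ω y => chLog V r y ω)
    (A := r * κ + r ^ 2 * κ ^ 2) (B := r * κ) (measurable_chLog_uncurry hV r) (fun ω y => by
      have h := abs_chLog_le hκ hr y ω
      have h2 : ‖y‖ ≤ 1 + ‖y‖ ^ 2 := by nlinarith [sq_nonneg (‖y‖ - 1)]
      have h3 := mul_le_mul_of_nonneg_left h2 (mul_nonneg hr hκ0)
      nlinarith [mul_nonneg (sq_nonneg r) (sq_nonneg κ)])
  have hval : ∫ ω, ∫ y, chLog V r (y + r • V ω) ω ∂(ProbabilityTheory.stdGaussian E) ∂ν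
      = r ^ 2 * κ ^ 2 / 2 := by
    have : ∀ ω, ∫ y, chLog V r (y + r • V ω) ω ∂(ProbabilityTheory.stdGaussian E)
        = r ^ 2 * κ ^ 2 / 2 := by
      intro ω
      unfold chLog
      simp_rw [inner_add_right]
      rw [integral_inner_add_sub_stdGaussian, real_inner_self_eq_norm_sq, norm_smul, hκ,
        Real.norm_of_nonneg hr]
      ring
    simp_rw [this]
    simp
  rw [← hval, ← h.2]
  refine integral_mono (integrable_chZ_mul_log ν hV hκ hr) h.1 fun y => ?_
  change chZ ν V r y * _ ≤ _
  rw [chZ_mul_integral_chPost ν hV hκ hr]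
  have hi := integrable_exp_chLog ν hV hκ hr y
  have hi2 : Integrable (fun ω => Real.exp (chLog V r y ω) * chLog V r y ω) ν := by
    refine hi.mul_bdd (c := r * κ * ‖y‖ + r ^ 2 * κ ^ 2 / 2)
      (measurable_chLog hV r y).aestronglyMeasurable
      (ae_of_all _ fun ω => abs_chLog_le hκ hr y ω)
  have hm := integral_mono (hi.sub (integrable_const (chZ ν V r y)))
    (hi2.sub (hi.mul_const (Real.log (chZ ν V r y)))) (fun ω => by
      have := sub_le_mul_log_sub (Real.exp_pos (chLog V r y ω)) (chZ_pos ν hV hκ hr y)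
      rwa [Real.log_exp] at this)
  simp only [Pi.sub_apply] at hm
  rw [integral_sub hi (integrable_const _), integral_sub hi2 (hi.mul_const _),
    integral_mul_const] at hm
  simp only [integral_const, probReal_univ, one_smul] at hm
  change chZ ν V r y - chZ ν V r y ≤ _ - chZ ν V r y * _ at hm
  linarith

lemma scaled_chF_sub_sq_le (ν : Measure Ω) [IsProbabilityMeasure ν]
    (hV : Measurable V) (hκ : ∀ ω, ‖V ω‖ = κ) (hr : 0 ≤ r) (c : ℝ) :
    (chF ν V r - c) ^ 2 ≤ chW ν V r c := by
  have hZ := integrable_chZ ν hV hκ hr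
  have hF := integrable_chZ_mul_log ν hV hκ hr
  have hW := integrable_chZ_mul_log_sub_sq ν hV hκ hr c
  set D := chF ν V r with hD
  have hm := integral_mono (hF.const_mul (2 * (D - c))) (hW.add (hZ.mul_const
    (2 * (D - c) * c + (D - c) ^ 2))) (fun y => by
      have hZy := (chZ_pos ν hV hκ hr y).le
      simp only [Pi.add_apply]
      nlinarith [mul_nonneg hZy (sq_nonneg (Real.log (chZ ν V r y) - D))])
  simp only [Pi.add_apply] at hm
  rw [integral_add hW (hZ.mul_const _), integral_const_mul, integral_mul_const,
    integral_chZ ν hV hκ hr] at hm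
  change 2 * (D - c) * D ≤ chW ν V r c + _ at hm
  nlinarith

lemma overlap_variance_le_single (ν : Measure Ω) [IsProbabilityMeasure ν]
    (hV : Measurable V) (hκ : ∀ ω, ‖V ω‖ = κ) (hr : 0 < r) (c : ℝ) :
    ∫ ω', ∫ ω, (⟪V ω', V ω⟫ - 2 / r ^ 2 * c) ^ 2 ∂ν ∂ν
      ≤ 6 * κ ^ 2 * (1 / r ^ 2 + (chQ ν V r - ‖∫ ω, V ω ∂ν‖ ^ 2))
        + 6 * κ ^ 2 * (2 / r ^ 2 * chF ν V r - ‖∫ ω, V ω ∂ν‖ ^ 2)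
        + 24 / r ^ 4 * chW ν V r c := by
  have hκ0 := kappa_nonneg ν hκ
  set m := ∫ ω, V ω ∂ν with hm
  have hmκ : ‖m‖ ≤ κ := norm_mean_le hκ
  set d := 2 / r ^ 2 * c with hd
  set D := 2 / r ^ 2 * chF ν V r with hDdef
  have hr2 : 0 < r ^ 2 := by positivity
  have hDm : ‖m‖ ^ 2 ≤ D := by
    have := norm_mean_sq_le_chF ν hV hκ hr.le
    rw [hDdef, div_mul_eq_mul_div, le_div_iff₀ hr2]; linarith
  have hDκ : D ≤ κ ^ 2 := by
    have := chF_le ν hV hκ hr.le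
    rw [hDdef, div_mul_eq_mul_div, div_le_iff₀ hr2]; linarith
  have hDd : (D - d) ^ 2 ≤ 4 / r ^ 4 * chW ν V r c := by
    have := scaled_chF_sub_sq_le ν hV hκ hr.le c
    have e : (D - d) ^ 2 = 4 / r ^ 4 * (chF ν V r - c) ^ 2 := by rw [hDdef, hd]; field_simp; ring
    rw [e]; gcongr
  set B := 1 / r ^ 2 + (chQ ν V r - ‖m‖ ^ 2) with hB
  have hVi : Integrable V ν := integrable_of_norm_eq hV hκ
  have hvar : ∀ w : E, ∫ ω, (⟪w, V ω⟫ - ⟪w, m⟫) ^ 2 ∂ν ≤ ‖w‖ ^ 2 * B :=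
    fun w => integral_inner_sub_mean_sq_le ν hV hκ hr w
  have hint : ∀ w : E, Integrable (fun ω => (⟪w, V ω⟫ - ⟪w, m⟫) ^ 2) ν := fun w => by
    refine Integrable.of_bound (by fun_prop) ((2 * (‖w‖ * κ)) ^ 2) (ae_of_all _ fun ω => ?_)
    rw [norm_pow, Real.norm_eq_abs]
    refine pow_le_pow_left₀ (abs_nonneg _) ?_ 2
    have h1 := abs_real_inner_le_norm w (V ω)
    have h2 := (abs_real_inner_le_norm w m).trans
      (mul_le_mul_of_nonneg_left hmκ (norm_nonneg w))
    rw [hκ] at h1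
    have := abs_sub (⟪w, V ω⟫) (⟪w, m⟫)
    linarith
  have hinner : ∀ ω', ∫ ω, (⟪V ω', V ω⟫ - d) ^ 2 ∂ν
      ≤ 3 * (κ ^ 2 * B) + 3 * (⟪m, V ω'⟫ - ⟪m, m⟫) ^ 2 + 3 * (‖m‖ ^ 2 - d) ^ 2 := by
    intro ω'
    have h1 := integral_mono_of_nonneg (μ := ν) (f := fun ω => (⟪V ω', V ω⟫ - d) ^ 2)
      (g := fun ω => 3 * (⟪V ω', V ω⟫ - ⟪V ω', m⟫) ^ 2
        + (3 * (⟪m, V ω'⟫ - ⟪m, m⟫) ^ 2 + 3 * (‖m‖ ^ 2 - d) ^ 2))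
      (ae_of_all _ fun ω => sq_nonneg _)
      (((hint (V ω')).const_mul 3).add (integrable_const _)) (ae_of_all _ fun ω => by
        beta_reduce
        rw [real_inner_comm (V ω') m, real_inner_self_eq_norm_sq]
        generalize ⟪V ω', V ω⟫ = x
        generalize ⟪V ω', m⟫ = y
        generalize ‖m‖ ^ 2 = z
        nlinarith [sq_nonneg ((x - y) - (y - z)), sq_nonneg ((x - y) - (z - d)),
          sq_nonneg ((y - z) - (z - d))])
    rw [integral_add ((hint (V ω')).const_mul 3) (integrable_const _), integral_const_mul] at h1
    simp only [integral_const, probReal_univ, one_smul] at h1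
    have h2 := hvar (V ω')
    rw [hκ] at h2
    linarith
  have h1 := integral_mono_of_nonneg (μ := ν) (f := fun ω' => ∫ ω, (⟪V ω', V ω⟫ - d) ^ 2 ∂ν)
    (g := fun ω' => 3 * (⟪m, V ω'⟫ - ⟪m, m⟫) ^ 2 + (3 * (κ ^ 2 * B) + 3 * (‖m‖ ^ 2 - d) ^ 2))
    (ae_of_all _ fun ω' => integral_nonneg fun ω => sq_nonneg _)
    (((hint m).const_mul 3).add (integrable_const _)) (ae_of_all _ fun ω' => by
      have := hinner ω'
      change ∫ ω, (⟪V ω', V ω⟫ - d) ^ 2 ∂ν ≤ _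
      linarith)
  rw [integral_add ((hint m).const_mul 3) (integrable_const _), integral_const_mul] at h1
  simp only [integral_const, probReal_univ, one_smul] at h1
  have h2 := hvar m
  have hB0 : 0 ≤ B := by
    have := norm_mean_sq_le_chQ ν hV hκ hr.le
    have : 0 ≤ 1 / r ^ 2 := by positivity
    rw [hB]; linarith
  have h3 : ‖m‖ ^ 2 * B ≤ κ ^ 2 * B := by gcongr
  have h4 : (‖m‖ ^ 2 - d) ^ 2 ≤ 2 * κ ^ 2 * (D - ‖m‖ ^ 2) + 2 * (D - d) ^ 2 := by
    have h5 : (D - ‖m‖ ^ 2) ^ 2 ≤ κ ^ 2 * (D - ‖m‖ ^ 2) := by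
      rw [sq]
      refine mul_le_mul_of_nonneg_right ?_ (by linarith)
      have := sq_nonneg ‖m‖
      linarith
    nlinarith [sq_nonneg ((D - ‖m‖ ^ 2) + (D - d))]
  have h24 : 24 / r ^ 4 * chW ν V r c = 6 * (4 / r ^ 4 * chW ν V r c) := by ring
  rw [h24]
  linarith

end SinglePriorBound

section TwoStep
open scoped RealInnerProductSpace ENNReal
variable {Ω E : Type*} [MeasurableSpace Ω]
  [NormedAddCommGroup E] [InnerProductSpace ℝ E] [FiniteDimensional ℝ E]
  [MeasurableSpace E] [BorelSpace E]
variable {ν : Measure Ω} [IsProbabilityMeasure ν] {V : Ω → E} {κ r₁ r₂ r : ℝ}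

lemma measurePreserving_combination_stdGaussian {a b : ℝ} (hb : 0 ≤ b) (hab : a ^ 2 + b ^ 2 = 1) :
    MeasurePreserving (fun p : E × E => a • p.1 + b • p.2)
      ((ProbabilityTheory.stdGaussian E).prod (ProbabilityTheory.stdGaussian E))
      (ProbabilityTheory.stdGaussian E) := by
  have ha : a ∈ Icc (-1) 1 := by constructor <;> nlinarith
  have hc : Real.cos (Real.arccos a) = a := Real.cos_arccos ha.1 ha.2
  have hs : Real.sin (Real.arccos a) = b := by
    rw [Real.sin_arccos, show 1 - a ^ 2 = b ^ 2 by linarith, Real.sqrt_sq hb]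
  have h := ProbabilityTheory.IsGaussian.map_rotation_eq_self
    (μ := ProbabilityTheory.stdGaussian E) (by simp [ProbabilityTheory.integral_id_stdGaussian])
    (Real.arccos a)
  have hm : Measurable (fun p : E × E => a • p.1 + b • p.2) := by fun_prop
  refine ⟨hm, ?_⟩
  have e : (fun p : E × E => a • p.1 + b • p.2)
      = Prod.fst ∘ (ContinuousLinearMap.rotation (Real.arccos a) : E × E →L[ℝ] E × E) := by
    ext p
    simp [ContinuousLinearMap.rotation_apply, hc, hs]
  rw [e, ← Measure.map_map measurable_fst (by fun_prop), h]
  exact (measurePreserving_fst).map_eq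

lemma average_combination_stdGaussian {a b : ℝ} (hb : 0 ≤ b) (hab : a ^ 2 + b ^ 2 = 1)
    {G : E → ℝ} (hG : Integrable G (ProbabilityTheory.stdGaussian E)) :
    Integrable (fun y₁ => ∫ y₂, G (a • y₁ + b • y₂) ∂(ProbabilityTheory.stdGaussian E))
        (ProbabilityTheory.stdGaussian E) ∧
      ∫ y₁, ∫ y₂, G (a • y₁ + b • y₂) ∂(ProbabilityTheory.stdGaussian E)
        ∂(ProbabilityTheory.stdGaussian E) = ∫ y, G y ∂(ProbabilityTheory.stdGaussian E) := by
  have h := measurePreserving_combination_stdGaussian (E := E) hb hab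
  have hi : Integrable (fun p : E × E => G (a • p.1 + b • p.2))
      ((ProbabilityTheory.stdGaussian E).prod (ProbabilityTheory.stdGaussian E)) :=
    h.integrable_comp_of_integrable hG
  refine ⟨hi.integral_prod_left, ?_⟩
  rw [integral_integral hi]
  have h2 := integral_map h.measurable.aemeasurable (f := G) (by rw [h.map_eq]; exact hG.1)
  rw [h.map_eq] at h2
  exact h2.symm

lemma chLog_add_chLog (V : Ω → E) (hr : 0 < r) (h : r ^ 2 = r₁ ^ 2 + r₂ ^ 2) (y₁ y₂ : E) :
    chLog V r₁ y₁ + chLog V r₂ y₂ = chLog V r ((r₁ / r) • y₁ + (r₂ / r) • y₂) := by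
  ext ω
  simp only [chLog, Pi.add_apply, inner_smul_left, inner_smul_right, inner_add_right, norm_smul,
    mul_pow, Real.norm_eq_abs, sq_abs, h]
  simp
  field_simp
  ring

lemma chPost_chPost (ν : Measure Ω) [IsProbabilityMeasure ν]
    (hV : Measurable V) (hκ : ∀ ω, ‖V ω‖ = κ) (hr₁ : 0 ≤ r₁) (hr : 0 < r)
    (h : r ^ 2 = r₁ ^ 2 + r₂ ^ 2) (y₁ y₂ : E) :
    chPost (chPost ν V r₁ y₁) V r₂ y₂ = chPost ν V r ((r₁ / r) • y₁ + (r₂ / r) • y₂) := by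
  rw [chPost, chPost, tilted_tilted (integrable_exp_chLog ν hV hκ hr₁ y₁),
    chLog_add_chLog V hr h, chPost]

lemma chZ_mul_chZ (ν : Measure Ω) [IsProbabilityMeasure ν]
    (hV : Measurable V) (hκ : ∀ ω, ‖V ω‖ = κ) (hr₁ : 0 ≤ r₁) (hr : 0 < r)
    (h : r ^ 2 = r₁ ^ 2 + r₂ ^ 2) (y₁ y₂ : E) :
    chZ ν V r₁ y₁ * chZ (chPost ν V r₁ y₁) V r₂ y₂
      = chZ ν V r ((r₁ / r) • y₁ + (r₂ / r) • y₂) := by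
  change chZ ν V r₁ y₁ * ∫ ω, Real.exp (chLog V r₂ y₂ ω) ∂(chPost ν V r₁ y₁) = _
  rw [chZ_mul_integral_chPost ν hV hκ hr₁, chZ]
  congr 1 with ω
  rw [← Real.exp_add, ← chLog_add_chLog V hr h, Pi.add_apply]

lemma ratio_sq_add (hr : 0 < r) (h : r ^ 2 = r₁ ^ 2 + r₂ ^ 2) :
    (r₁ / r) ^ 2 + (r₂ / r) ^ 2 = 1 := by
  rw [div_pow, div_pow, ← add_div, ← h, div_self (by positivity)]

lemma average_chQ_chPost (ν : Measure Ω) [IsProbabilityMeasure ν]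
    (hV : Measurable V) (hκ : ∀ ω, ‖V ω‖ = κ) (hr₁ : 0 ≤ r₁) (hr₂ : 0 ≤ r₂) (hr : 0 < r)
    (h : r ^ 2 = r₁ ^ 2 + r₂ ^ 2) :
    Integrable (fun y₁ => chZ ν V r₁ y₁ * chQ (chPost ν V r₁ y₁) V r₂)
        (ProbabilityTheory.stdGaussian E) ∧
      ∫ y₁, chZ ν V r₁ y₁ * chQ (chPost ν V r₁ y₁) V r₂ ∂(ProbabilityTheory.stdGaussian E)
        = chQ ν V r := by
  have key : ∀ y₁, chZ ν V r₁ y₁ * chQ (chPost ν V r₁ y₁) V r₂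
      = ∫ y₂, (fun y => chZ ν V r y * ‖chMean ν V r y‖ ^ 2) ((r₁ / r) • y₁ + (r₂ / r) • y₂)
        ∂(ProbabilityTheory.stdGaussian E) := by
    intro y₁
    rw [chQ, ← integral_const_mul]
    congr 1 with y₂
    have e : chMean (chPost ν V r₁ y₁) V r₂ y₂
        = chMean ν V r ((r₁ / r) • y₁ + (r₂ / r) • y₂) := by
      unfold chMean
      rw [chPost_chPost ν hV hκ hr₁ hr h]
    rw [← mul_assoc, chZ_mul_chZ ν hV hκ hr₁ hr h, e]
  simp_rw [key]
  exact average_combination_stdGaussian (by positivity) (ratio_sq_add hr h)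
    (integrable_chZ_mul_norm_sq ν hV hκ hr.le)

lemma chQ_mono (ν : Measure Ω) [IsProbabilityMeasure ν]
    (hV : Measurable V) (hκ : ∀ ω, ‖V ω‖ = κ) (hr₁ : 0 ≤ r₁) (h : r₁ ≤ r) :
    chQ ν V r₁ ≤ chQ ν V r := by
  rcases (hr₁.trans h).eq_or_lt with h0 | hr
  · rw [show r₁ = r by linarith]
  have hs : r ^ 2 = r₁ ^ 2 + (Real.sqrt (r ^ 2 - r₁ ^ 2)) ^ 2 := by
    rw [Real.sq_sqrt (by nlinarith)]; ring
  have hav := average_chQ_chPost ν hV hκ hr₁ (Real.sqrt_nonneg _) hr hs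
  rw [← hav.2]
  refine integral_mono (integrable_chZ_mul_norm_sq ν hV hκ hr₁) hav.1 fun y => ?_
  have := isProbabilityMeasure_chPost ν hV hκ hr₁ y
  exact mul_le_mul_of_nonneg_left
    (norm_mean_sq_le_chQ (chPost ν V r₁ y) hV hκ (Real.sqrt_nonneg _)) (chZ_pos ν hV hκ hr₁ y).le

lemma average_chF_chPost (ν : Measure Ω) [IsProbabilityMeasure ν]
    (hV : Measurable V) (hκ : ∀ ω, ‖V ω‖ = κ) (hr₁ : 0 ≤ r₁) (hr₂ : 0 ≤ r₂) (hr : 0 < r)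
    (h : r ^ 2 = r₁ ^ 2 + r₂ ^ 2) :
    Integrable (fun y₁ => chZ ν V r₁ y₁ * chF (chPost ν V r₁ y₁) V r₂)
        (ProbabilityTheory.stdGaussian E) ∧
      ∫ y₁, chZ ν V r₁ y₁ * chF (chPost ν V r₁ y₁) V r₂ ∂(ProbabilityTheory.stdGaussian E)
        = chF ν V r - chF ν V r₁ := by
  have key : ∀ y₁, chZ ν V r₁ y₁ * chF (chPost ν V r₁ y₁) V r₂
      = ∫ y₂, (fun y => chZ ν V r y * Real.log (chZ ν V r y)) ((r₁ / r) • y₁ + (r₂ / r) • y₂)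
        ∂(ProbabilityTheory.stdGaussian E) - chZ ν V r₁ y₁ * Real.log (chZ ν V r₁ y₁) := by
    intro y₁
    have hP := isProbabilityMeasure_chPost ν hV hκ hr₁ y₁
    have hpt : ∀ y₂, (fun y => chZ ν V r y * Real.log (chZ ν V r y))
        ((r₁ / r) • y₁ + (r₂ / r) • y₂)
        = chZ ν V r₁ y₁ * (chZ (chPost ν V r₁ y₁) V r₂ y₂
            * Real.log (chZ (chPost ν V r₁ y₁) V r₂ y₂))
          + chZ ν V r₁ y₁ * Real.log (chZ ν V r₁ y₁) * chZ (chPost ν V r₁ y₁) V r₂ y₂ := by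
      intro y₂
      beta_reduce
      rw [← chZ_mul_chZ ν hV hκ hr₁ hr h, Real.log_mul (chZ_pos ν hV hκ hr₁ y₁).ne'
        (chZ_pos _ hV hκ hr₂ y₂).ne']
      ring
    simp_rw [hpt]
    rw [integral_add ((integrable_chZ_mul_log _ hV hκ hr₂).const_mul _)
      ((integrable_chZ _ hV hκ hr₂).const_mul _), integral_const_mul, integral_const_mul,
      integral_chZ _ hV hκ hr₂, chF]
    ring
  simp_rw [key]
  have h1 := average_combination_stdGaussian (by positivity) (ratio_sq_add hr h)
    (integrable_chZ_mul_log ν hV hκ hr.le)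
  have h2 := integrable_chZ_mul_log ν hV hκ hr₁
  refine ⟨h1.1.sub h2, ?_⟩
  rw [integral_sub h1.1 h2, h1.2]
  rfl

lemma average_chW_chPost (ν : Measure Ω) [IsProbabilityMeasure ν]
    (hV : Measurable V) (hκ : ∀ ω, ‖V ω‖ = κ) (hr₁ : 0 ≤ r₁) (hr₂ : 0 ≤ r₂) (hr : 0 < r)
    (h : r ^ 2 = r₁ ^ 2 + r₂ ^ 2) (c₁ c : ℝ) :
    ∃ G : E → ℝ, Integrable G (ProbabilityTheory.stdGaussian E) ∧
      (∀ y₁, chZ ν V r₁ y₁ * chW (chPost ν V r₁ y₁) V r₂ (c - c₁) ≤ G y₁) ∧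
      ∫ y₁, G y₁ ∂(ProbabilityTheory.stdGaussian E) = 2 * chW ν V r c + 2 * chW ν V r₁ c₁ := by
  have h1 := average_combination_stdGaussian (by positivity) (ratio_sq_add hr h)
    (integrable_chZ_mul_log_sub_sq ν hV hκ hr.le c)
  have h2 := integrable_chZ_mul_log_sub_sq ν hV hκ hr₁ c₁
  refine ⟨_, (h1.1.const_mul 2).add (h2.const_mul 2), fun y₁ => ?_, ?_⟩
  · have hP := isProbabilityMeasure_chPost ν hV hκ hr₁ y₁
    have hpt : ∀ y₂, (fun y => chZ ν V r y * (Real.log (chZ ν V r y) - c) ^ 2)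
        ((r₁ / r) • y₁ + (r₂ / r) • y₂)
        = chZ ν V r₁ y₁ * (chZ (chPost ν V r₁ y₁) V r₂ y₂
            * (Real.log (chZ (chPost ν V r₁ y₁) V r₂ y₂)
              - (c - Real.log (chZ ν V r₁ y₁))) ^ 2) := by
      intro y₂
      beta_reduce
      rw [← chZ_mul_chZ ν hV hκ hr₁ hr h, Real.log_mul (chZ_pos ν hV hκ hr₁ y₁).ne'
        (chZ_pos _ hV hκ hr₂ y₂).ne']
      ring
    have h3 := integrable_chZ_mul_log_sub_sq (chPost ν V r₁ y₁) hV hκ hr₂ (c - c₁)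
    have h4 := integrable_chZ_mul_log_sub_sq (chPost ν V r₁ y₁) hV hκ hr₂
      (c - Real.log (chZ ν V r₁ y₁))
    have h5 := integrable_chZ (chPost ν V r₁ y₁) hV hκ hr₂
    simp only [Pi.add_apply]
    simp_rw [hpt]
    rw [integral_const_mul]
    have hm := integral_mono h3 ((h4.const_mul 2).add
      (h5.mul_const (2 * (Real.log (chZ ν V r₁ y₁) - c₁) ^ 2))) (fun y₂ => by
        simp only [Pi.add_apply]
        have hZ := (chZ_pos (chPost ν V r₁ y₁) hV hκ hr₂ y₂).le
        generalize Real.log (chZ (chPost ν V r₁ y₁) V r₂ y₂) = L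
        generalize Real.log (chZ ν V r₁ y₁) = L₁
        nlinarith [mul_nonneg hZ (sq_nonneg ((L - (c - L₁)) + (L₁ - c₁)))])
    simp only [Pi.add_apply] at hm
    rw [integral_add (h4.const_mul 2) (h5.mul_const _), integral_const_mul, integral_mul_const,
      integral_chZ _ hV hκ hr₂, one_mul] at hm
    have hm2 := mul_le_mul_of_nonneg_left hm (chZ_pos ν hV hκ hr₁ y₁).le
    refine hm2.trans (le_of_eq ?_)
    ring
  · simp only [Pi.add_apply]
    rw [integral_add (h1.1.const_mul 2) (h2.const_mul 2), integral_const_mul, integral_const_mul,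
      h1.2]
    rfl

end TwoStep

section FixedPrior
open scoped RealInnerProductSpace ENNReal
variable {Ω E : Type*} [MeasurableSpace Ω]
  [NormedAddCommGroup E] [InnerProductSpace ℝ E] [FiniteDimensional ℝ E]
  [MeasurableSpace E] [BorelSpace E]
variable {ν : Measure Ω} [IsProbabilityMeasure ν] {V : Ω → E} {κ r₁ r₂ r : ℝ}

lemma integral_le_log_integral_exp {P : Measure Ω} [IsProbabilityMeasure P] {g : Ω → ℝ}
    (hg : Integrable g P) (he : Integrable (fun ω => Real.exp (g ω)) P) :
    ∫ ω, g ω ∂P ≤ Real.log (∫ ω, Real.exp (g ω) ∂P) := by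
  set b := ∫ ω, g ω ∂P with hb
  have h := integral_mono (((integrable_const (1 - b)).add hg).const_mul (Real.exp b)) he
    (fun ω => by
      have h1 := Real.add_one_le_exp (g ω - b)
      have h2 := mul_le_mul_of_nonneg_left h1 (Real.exp_pos b).le
      rw [← Real.exp_add] at h2
      simp only [Pi.add_apply]
      calc _ = Real.exp b * (g ω - b + 1) := by ring
        _ ≤ _ := h2
        _ = _ := by congr 1; ring)
  simp only [Pi.add_apply] at h
  rw [integral_const_mul, integral_add (integrable_const _) hg, ← hb] at h
  simp only [integral_const, probReal_univ, one_smul, sub_add_cancel, mul_one] at h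
  exact (Real.le_log_iff_exp_le ((Real.exp_pos b).trans_le h)).2 h

lemma chZ_mul_inner_chMean_self (ν : Measure Ω) [IsProbabilityMeasure ν]
    (hV : Measurable V) (hκ : ∀ ω, ‖V ω‖ = κ) (hr : 0 ≤ r) :
    Integrable (fun y => chZ ν V r y * ⟪y, chMean ν V r y⟫) (ProbabilityTheory.stdGaussian E) ∧
    ∫ y, chZ ν V r y * ⟪y, chMean ν V r y⟫ ∂(ProbabilityTheory.stdGaussian E) = r * κ ^ 2 := by
  have hκ0 := kappa_nonneg ν hκ
  have h := channel_average ν hV hκ hr (F := fun ω y => ⟪y, V ω⟫) (A := κ) (B := κ)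
    (by unfold Function.uncurry; fun_prop) (fun ω y => by
      have h1 := abs_real_inner_le_norm y (V ω)
      rw [hκ] at h1
      have h3 : ‖y‖ ≤ 1 + ‖y‖ ^ 2 := by nlinarith [sq_nonneg (‖y‖ - 1)]
      have h4 := mul_le_mul_of_nonneg_right h3 hκ0
      linarith)
  simp_rw [inner_chMean ν hV hκ hr]
  refine ⟨h.1, h.2.trans ?_⟩
  have : ∀ ω, ∫ y, ⟪y + r • V ω, V ω⟫ ∂(ProbabilityTheory.stdGaussian E) = r * κ ^ 2 := by
    intro ω
    have h5 := integral_inner_add_sub_stdGaussian (V ω) (r * κ ^ 2) 0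
    simp only [sub_zero] at h5
    rw [← h5]
    congr 1 with y
    rw [inner_add_left, inner_smul_left, real_inner_self_eq_norm_sq, hκ, real_inner_comm]
    simp
  simp_rw [this]
  simp

lemma log_chZ_shift_ge (ν : Measure Ω) [IsProbabilityMeasure ν]
    (hV : Measurable V) (hκ : ∀ ω, ‖V ω‖ = κ) (hr₁ : 0 ≤ r₁) (hr : 0 ≤ r) (y x : E) :
    Real.log (chZ ν V r y) - (r - r₁) * ⟪y, chMean ν V r y⟫
        - r₁ * ⟪x, chMean ν V r y⟫ + (r ^ 2 - r₁ ^ 2) * κ ^ 2 / 2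
      ≤ Real.log (chZ ν V r₁ (y - x)) := by
  have hP := isProbabilityMeasure_chPost ν hV hκ hr y
  have hZ := chZ_pos ν hV hκ hr y
  set g := fun ω => chLog V r₁ (y - x) ω - chLog V r y ω with hg
  have hgm : Measurable g := (measurable_chLog hV r₁ (y - x)).sub (measurable_chLog hV r y)
  set C := (r₁ * κ * ‖y - x‖ + r₁ ^ 2 * κ ^ 2 / 2) + (r * κ * ‖y‖ + r ^ 2 * κ ^ 2 / 2) with hC
  have hgb : ∀ ω, |g ω| ≤ C := fun ω =>
    (abs_sub _ _).trans (add_le_add (abs_chLog_le hκ hr₁ _ ω) (abs_chLog_le hκ hr y ω))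
  have hgi : Integrable g (chPost ν V r y) :=
    Integrable.of_bound hgm.aestronglyMeasurable C (ae_of_all _ hgb)
  have hge : Integrable (fun ω => Real.exp (g ω)) (chPost ν V r y) :=
    Integrable.of_bound hgm.exp.aestronglyMeasurable (Real.exp C) (ae_of_all _ fun ω => by
      rw [Real.norm_of_nonneg (Real.exp_pos _).le]
      exact Real.exp_le_exp.2 ((le_abs_self _).trans (hgb ω)))
  have hJ := integral_le_log_integral_exp hgi hge
  have hfac : chZ ν V r₁ (y - x) = chZ ν V r y * ∫ ω, Real.exp (g ω) ∂(chPost ν V r y) := by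
    rw [chZ_mul_integral_chPost ν hV hκ hr]
    change ∫ ω, _ ∂ν = _
    congr 1 with ω
    rw [← Real.exp_add]
    congr 1
    simp [hg]
  have hpos : 0 < ∫ ω, Real.exp (g ω) ∂(chPost ν V r y) := by
    have := chZ_pos ν hV hκ hr₁ (y - x)
    rw [hfac] at this
    exact (mul_pos_iff_of_pos_left hZ).1 this
  rw [hfac, Real.log_mul hZ.ne' hpos.ne']
  have hVi : Integrable V (chPost ν V r y) := integrable_of_norm_eq hV hκ
  have hgval : ∫ ω, g ω ∂(chPost ν V r y) = -((r - r₁) * ⟪y, chMean ν V r y⟫)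
      - r₁ * ⟪x, chMean ν V r y⟫ + (r ^ 2 - r₁ ^ 2) * κ ^ 2 / 2 := by
    have e : ∀ ω, g ω = (-(r - r₁)) * ⟪y, V ω⟫ - r₁ * ⟪x, V ω⟫
        + (r ^ 2 - r₁ ^ 2) * κ ^ 2 / 2 := by
      intro ω
      simp only [hg, chLog, inner_smul_left, inner_sub_right, norm_smul, hκ, mul_pow,
        Real.norm_eq_abs, sq_abs]
      rw [real_inner_comm y, real_inner_comm x]
      simp
      ring
    simp_rw [e]
    rw [integral_sub_add ((hVi.const_inner y).const_mul _) ((hVi.const_inner x).const_mul _)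
      (integrable_const _), integral_const_mul, integral_const_mul, inner_chMean ν hV hκ hr,
      inner_chMean ν hV hκ hr]
    simp only [integral_const, probReal_univ, one_smul]
    ring
  linarith

lemma chF_sub_le (ν : Measure Ω) [IsProbabilityMeasure ν]
    (hV : Measurable V) (hκ : ∀ ω, ‖V ω‖ = κ) (hr₁ : 0 ≤ r₁) (hr : r₁ ≤ r) :
    chF ν V r - chF ν V r₁ ≤ (r - r₁) ^ 2 * κ ^ 2 / 2 + r₁ * (r - r₁) * chQ ν V r := by
  have hr0 := hr₁.trans hr
  have hκ0 := kappa_nonneg ν hκ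
  set η := r - r₁ with hη
  set A := r₁ * κ + r₁ ^ 2 * κ ^ 2
  set B := r₁ * κ with hB
  have hB0 : 0 ≤ B := mul_nonneg hr₁ hκ0
  have h1 := channel_average ν hV hκ hr0 (F := fun ω y => Real.log (chZ ν V r₁ (y - η • V ω)))
    (A := A + B * (2 * (η * κ) ^ 2)) (B := 2 * B)
    ((measurable_log_chZ ν hV r₁).comp
      (measurable_snd.sub ((hV.comp measurable_fst).const_smul η))) (fun ω y => by
      refine (abs_log_chZ_le_sq ν hV hκ hr₁ _).trans ?_
      have h2 : ‖y - η • V ω‖ ≤ ‖y‖ + η * κ := by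
        refine (norm_sub_le _ _).trans ?_
        rw [norm_smul, hκ, Real.norm_of_nonneg (by linarith)]
      have h3 : ‖y - η • V ω‖ ^ 2 ≤ 2 * ‖y‖ ^ 2 + 2 * (η * κ) ^ 2 := by
        have := pow_le_pow_left₀ (norm_nonneg _) h2 2
        nlinarith [sq_nonneg (‖y‖ - η * κ)]
      have := mul_le_mul_of_nonneg_left h3 hB0
      change A + B * _ ≤ _
      linarith)
  have h2 := channel_average_const ν hV hκ hr₁ (measurable_log_chZ ν hV r₁)
    (abs_log_chZ_le_sq ν hV hκ hr₁)
  have h3 : ∫ y, chZ ν V r y * ∫ ω, Real.log (chZ ν V r₁ (y - η • V ω)) ∂(chPost ν V r y)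
      ∂(ProbabilityTheory.stdGaussian E) = chF ν V r₁ := by
    rw [h1.2, chF, h2.2]
    congr 1 with ω
    congr 1 with y
    congr 3
    rw [hη, sub_smul]
    abel
  have hin := chZ_mul_inner_chMean_self ν hV hκ hr0
  have hF := integrable_chZ_mul_log ν hV hκ hr0
  have hQ := integrable_chZ_mul_norm_sq ν hV hκ hr0
  have hZ := integrable_chZ ν hV hκ hr0
  set k := (r ^ 2 - r₁ ^ 2) * κ ^ 2 / 2 with hk
  have hm := integral_mono (((hF.sub (hin.1.const_mul η)).sub (hQ.const_mul (r₁ * η))).add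
    (hZ.mul_const k)) h1.1 (fun y => by
      have hP := isProbabilityMeasure_chPost ν hV hκ hr0 y
      have hZy := (chZ_pos ν hV hκ hr0 y).le
      have hVi : Integrable V (chPost ν V r y) := integrable_of_norm_eq hV hκ
      have hi1 : Integrable (fun ω => Real.log (chZ ν V r₁ (y - η • V ω))) (chPost ν V r y) := by
        refine Integrable.of_bound ((measurable_log_chZ ν hV r₁).comp
          (measurable_const.sub (hV.const_smul η))).aestronglyMeasurable
          (B * (‖y‖ + η * κ) + r₁ ^ 2 * κ ^ 2 / 2) (ae_of_all _ fun ω => ?_)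
        refine (abs_log_chZ_le ν hV hκ hr₁ _).trans ?_
        have h2 : ‖y - η • V ω‖ ≤ ‖y‖ + η * κ := by
          refine (norm_sub_le _ _).trans ?_
          rw [norm_smul, hκ, Real.norm_of_nonneg (by linarith)]
        have := mul_le_mul_of_nonneg_left h2 hB0
        change B * _ + _ ≤ _
        linarith
      have hpt := integral_mono (((integrable_const (μ := chPost ν V r y)
        (Real.log (chZ ν V r y) - η * ⟪y, chMean ν V r y⟫ + k))).sub
          ((hVi.const_inner (chMean ν V r y)).const_mul (r₁ * η))) hi1 (fun ω => by
          have := log_chZ_shift_ge ν hV hκ hr₁ hr0 y (η • V ω)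
          rw [real_inner_smul_left, real_inner_comm (chMean ν V r y) (V ω)] at this
          simp only [Pi.sub_apply]
          linarith)
      simp only [Pi.sub_apply] at hpt
      rw [integral_sub (integrable_const _) ((hVi.const_inner _).const_mul _),
        integral_const_mul, ← inner_chMean ν hV hκ hr0, real_inner_self_eq_norm_sq] at hpt
      simp only [integral_const, probReal_univ, one_smul] at hpt
      have := mul_le_mul_of_nonneg_left hpt hZy
      simp only [Pi.add_apply, Pi.sub_apply]
      linarith)
  simp only [Pi.add_apply, Pi.sub_apply] at hm
  rw [h3, integral_add (by exact ((hF.sub (hin.1.const_mul η)).sub (hQ.const_mul (r₁ * η))))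
    (hZ.mul_const k), integral_sub (by exact (hF.sub (hin.1.const_mul η))) (hQ.const_mul _),
    integral_sub hF (hin.1.const_mul η), integral_const_mul, integral_const_mul,
    integral_mul_const, hin.2, integral_chZ ν hV hκ hr0] at hm
  change chF ν V r - _ - r₁ * η * chQ ν V r + _ ≤ _ at hm
  have : (r ^ 2 - r₁ ^ 2) * κ ^ 2 / 2 = η * (r * κ ^ 2) - η ^ 2 * κ ^ 2 / 2 := by
    rw [hη]; ring
  rw [hk, this] at hm
  linarith

/-- Overlap variance bound for a fixed prior observed at signal-to-noise ratio `r₁ ^ 2`. -/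
lemma overlap_variance_le_of_prior (ν : Measure Ω) [IsProbabilityMeasure ν]
    (hV : Measurable V) (hκ : ∀ ω, ‖V ω‖ = κ) (hr₁ : 0 ≤ r₁) (hr₂ : 0 < r₂) (hr : 0 < r)
    (h : r ^ 2 = r₁ ^ 2 + r₂ ^ 2) (c₁ c : ℝ) :
    ∫ y, chZ ν V r₁ y * ∫ ω', ∫ ω, (⟪V ω', V ω⟫ - 2 / r₂ ^ 2 * (c - c₁)) ^ 2
        ∂(chPost ν V r₁ y) ∂(chPost ν V r₁ y) ∂(ProbabilityTheory.stdGaussian E)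
      ≤ 6 * κ ^ 2 / r₂ ^ 2 + 12 * κ ^ 2 * (chQ ν V r - chQ ν V r₁)
        + 6 * κ ^ 4 * (r₂ ^ 2 / r ^ 2) + 48 / r₂ ^ 4 * (chW ν V r c + chW ν V r₁ c₁) := by
  have hrr : r₁ ≤ r := by nlinarith
  obtain ⟨G, hG, hGle, hGint⟩ := average_chW_chPost ν hV hκ hr₁ hr₂.le hr h c₁ c
  have hQ := average_chQ_chPost ν hV hκ hr₁ hr₂.le hr h
  have hF := average_chF_chPost ν hV hκ hr₁ hr₂.le hr h
  have hZ := integrable_chZ ν hV hκ hr₁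
  have hq := integrable_chZ_mul_norm_sq ν hV hκ hr₁
  have hm := integral_mono_of_nonneg (μ := ProbabilityTheory.stdGaussian E)
    (f := fun y => chZ ν V r₁ y * ∫ ω', ∫ ω, (⟪V ω', V ω⟫ - 2 / r₂ ^ 2 * (c - c₁)) ^ 2
        ∂(chPost ν V r₁ y) ∂(chPost ν V r₁ y))
    (g := fun y => ((chZ ν V r₁ y * (6 * κ ^ 2 / r₂ ^ 2)
      + 6 * κ ^ 2 * (chZ ν V r₁ y * chQ (chPost ν V r₁ y) V r₂))
      + (12 * κ ^ 2 / r₂ ^ 2) * (chZ ν V r₁ y * chF (chPost ν V r₁ y) V r₂))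
      - (12 * κ ^ 2) * (chZ ν V r₁ y * ‖chMean ν V r₁ y‖ ^ 2) + 24 / r₂ ^ 4 * G y)
    (ae_of_all _ fun y => mul_nonneg (chZ_pos ν hV hκ hr₁ y).le
      (integral_nonneg fun _ => integral_nonneg fun _ => sq_nonneg _))
    (((((hZ.mul_const _).add (hQ.1.const_mul _)).add (hF.1.const_mul _)).sub
      (hq.const_mul _)).add (hG.const_mul _))
    (ae_of_all _ fun y => by
      have hP := isProbabilityMeasure_chPost ν hV hκ hr₁ y
      have h1 := mul_le_mul_of_nonneg_left
        (overlap_variance_le_single (chPost ν V r₁ y) hV hκ hr₂ (c - c₁))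
        (chZ_pos ν hV hκ hr₁ y).le
      have h2 := mul_le_mul_of_nonneg_left (hGle y) (by positivity : 0 ≤ 24 / r₂ ^ 4)
      beta_reduce
      refine h1.trans ?_
      change chZ ν V r₁ y * (6 * κ ^ 2 * (1 / r₂ ^ 2 +
        (chQ (chPost ν V r₁ y) V r₂ - ‖chMean ν V r₁ y‖ ^ 2)) + 6 * κ ^ 2 *
        (2 / r₂ ^ 2 * chF (chPost ν V r₁ y) V r₂ - ‖chMean ν V r₁ y‖ ^ 2) + _) ≤ _
      have e : ∀ x, 12 * κ ^ 2 / r₂ ^ 2 * x = 6 * κ ^ 2 * (2 / r₂ ^ 2 * x) := fun x => by ring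
      rw [e, show 6 * κ ^ 2 / r₂ ^ 2 = 6 * κ ^ 2 * (1 / r₂ ^ 2) by ring]
      linarith)
  rw [integral_sub_add (by exact (((hZ.mul_const _).add (hQ.1.const_mul _)).add
    (hF.1.const_mul _))) (hq.const_mul _) (hG.const_mul _),
    integral_add (by exact ((hZ.mul_const _).add (hQ.1.const_mul _))) (hF.1.const_mul _),
    integral_add (hZ.mul_const _) (hQ.1.const_mul _), integral_mul_const, integral_const_mul,
    integral_const_mul, integral_const_mul, integral_const_mul, hGint, hQ.2, hF.2,
    integral_chZ ν hV hκ hr₁] at hm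
  change _ ≤ 1 * _ + _ + _ - 12 * κ ^ 2 * chQ ν V r₁ + _ at hm
  have hC := chF_sub_le ν hV hκ hr₁ hrr
  have hQ0 := chQ_nonneg ν hV hκ hr.le
  have hκ2 : 0 ≤ κ ^ 2 := sq_nonneg _
  have hfac : r₂ ^ 2 = (r - r₁) * (r + r₁) := by nlinarith
  have hd1 : 2 * (r₁ * (r - r₁)) ≤ r₂ ^ 2 := by nlinarith [sq_nonneg (r - r₁)]
  have hd2 : (r - r₁) ^ 2 / r₂ ^ 2 ≤ r₂ ^ 2 / r ^ 2 := by
    rw [div_le_div_iff₀ (by positivity) (by positivity)]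
    have : (r - r₁) * r ≤ r₂ ^ 2 := by rw [hfac]; gcongr; linarith
    calc _ = ((r - r₁) * r) ^ 2 := by ring
      _ ≤ (r₂ ^ 2) ^ 2 := pow_le_pow_left₀ (mul_nonneg (by linarith) hr.le) this 2
      _ = _ := by ring
  have hD : 12 * κ ^ 2 / r₂ ^ 2 * (chF ν V r - chF ν V r₁)
      ≤ 6 * κ ^ 4 * (r₂ ^ 2 / r ^ 2) + 6 * κ ^ 2 * chQ ν V r := by
    calc _ ≤ 12 * κ ^ 2 / r₂ ^ 2 * ((r - r₁) ^ 2 * κ ^ 2 / 2 + r₁ * (r - r₁) * chQ ν V r) := by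
          gcongr
      _ = 6 * κ ^ 4 * ((r - r₁) ^ 2 / r₂ ^ 2)
          + 6 * κ ^ 2 * chQ ν V r * (2 * (r₁ * (r - r₁)) / r₂ ^ 2) := by ring
      _ ≤ 6 * κ ^ 4 * (r₂ ^ 2 / r ^ 2) + 6 * κ ^ 2 * chQ ν V r * 1 := by
          gcongr
          rw [div_le_one (by positivity)]
          exact hd1
      _ = _ := by ring
  have : 24 / r₂ ^ 4 * (2 * chW ν V r c + 2 * chW ν V r₁ c₁)
      = 48 / r₂ ^ 4 * (chW ν V r c + chW ν V r₁ c₁) := by ring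
  rw [this] at hm
  linarith

end FixedPrior

section PairChannel
open scoped RealInnerProductSpace ENNReal
variable {Ω D E : Type*} [MeasurableSpace Ω]
  [NormedAddCommGroup D] [InnerProductSpace ℝ D] [FiniteDimensional ℝ D]
  [MeasurableSpace D] [BorelSpace D]
  [NormedAddCommGroup E] [InnerProductSpace ℝ E] [FiniteDimensional ℝ E]
  [MeasurableSpace E] [BorelSpace E]
variable {W : Ω → D} {V : Ω → E} {κ₁ κ r₁ r₂ r : ℝ}

/-- Posterior given a unit-strength observation `s` of `W` and an observation `y` of `V`. -/
def pairPost (μ : Measure Ω) (W : Ω → D) (V : Ω → E) (r : ℝ) (s : D) (y : E) : Measure Ω :=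
  chPost (chPost μ W 1 s) V r y

/-- Evidence of a pair of observations. -/
def pairZ (μ : Measure Ω) (W : Ω → D) (V : Ω → E) (r : ℝ) (s : D) (y : E) : ℝ :=
  chZ μ W 1 s * chZ (chPost μ W 1 s) V r y

/-- Sum over the auxiliary channel of the mean squared posterior mean of `V`. -/
def pairQ (μ : Measure Ω) (W : Ω → D) (V : Ω → E) (r : ℝ) : ℝ :=
  ∫ s, chZ μ W 1 s * chQ (chPost μ W 1 s) V r ∂(ProbabilityTheory.stdGaussian D)

/-- Mean square deviation of the joint log-evidence from `c`. -/
def pairW (μ : Measure Ω) (W : Ω → D) (V : Ω → E) (r c : ℝ) : ℝ :=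
  ∫ s, chZ μ W 1 s * chW (chPost μ W 1 s) V r (c - Real.log (chZ μ W 1 s))
    ∂(ProbabilityTheory.stdGaussian D)

/-- Joint law of the signal and the noises. -/
def pairLaw (μ : Measure Ω) (D E : Type*) [NormedAddCommGroup D] [InnerProductSpace ℝ D]
    [FiniteDimensional ℝ D] [MeasurableSpace D] [BorelSpace D]
    [NormedAddCommGroup E] [InnerProductSpace ℝ E] [FiniteDimensional ℝ E]
    [MeasurableSpace E] [BorelSpace E] : Measure (Ω × D × E) :=
  μ.prod ((ProbabilityTheory.stdGaussian D).prod (ProbabilityTheory.stdGaussian E))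

instance (μ : Measure Ω) [IsProbabilityMeasure μ] : IsProbabilityMeasure (pairLaw μ D E) := by
  unfold pairLaw; infer_instance

/-- Joint likelihood. -/
def pairLog (W : Ω → D) (V : Ω → E) (r : ℝ) (s : D) (y : E) (ω : Ω) : ℝ :=
  chLog W 1 s ω + chLog V r y ω

lemma measurable_pairLog (hW : Measurable W) (hV : Measurable V) (r : ℝ) :
    Measurable (fun p : (D × E) × Ω => pairLog W V r p.1.1 p.1.2 p.2) := by
  have h1 := (measurable_chLog_uncurry hW 1).comp
    (measurable_snd.prodMk (measurable_fst.comp measurable_fst) :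
      Measurable (fun p : (D × E) × Ω => (p.2, p.1.1)))
  have h2 := (measurable_chLog_uncurry hV r).comp
    (measurable_snd.prodMk (measurable_snd.comp measurable_fst) :
      Measurable (fun p : (D × E) × Ω => (p.2, p.1.2)))
  exact h1.add h2

lemma isProbabilityMeasure_pairPost (μ : Measure Ω) [IsProbabilityMeasure μ]
    (hW : Measurable W) (hκ₁ : ∀ ω, ‖W ω‖ = κ₁) (hV : Measurable V) (hκ : ∀ ω, ‖V ω‖ = κ)
    (hr : 0 ≤ r) (s : D) (y : E) : IsProbabilityMeasure (pairPost μ W V r s y) := by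
  have := isProbabilityMeasure_chPost μ hW hκ₁ zero_le_one s
  exact isProbabilityMeasure_chPost _ hV hκ hr y

lemma pairZ_mul_integral_pairPost (μ : Measure Ω) [IsProbabilityMeasure μ]
    (hW : Measurable W) (hκ₁ : ∀ ω, ‖W ω‖ = κ₁) (hV : Measurable V) (hκ : ∀ ω, ‖V ω‖ = κ)
    (hr : 0 ≤ r) (s : D) (y : E) (g : Ω → ℝ) :
    pairZ μ W V r s y * ∫ ω, g ω ∂(pairPost μ W V r s y)
      = ∫ ω, Real.exp (pairLog W V r s y ω) * g ω ∂μ := by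
  have := isProbabilityMeasure_chPost μ hW hκ₁ zero_le_one s
  rw [pairZ, pairPost, mul_assoc, chZ_mul_integral_chPost _ hV hκ hr,
    chZ_mul_integral_chPost _ hW hκ₁ zero_le_one]
  congr 1 with ω
  rw [pairLog, Real.exp_add, mul_assoc]

lemma pairZ_pos (μ : Measure Ω) [IsProbabilityMeasure μ]
    (hW : Measurable W) (hκ₁ : ∀ ω, ‖W ω‖ = κ₁) (hV : Measurable V) (hκ : ∀ ω, ‖V ω‖ = κ)
    (hr : 0 ≤ r) (s : D) (y : E) : 0 < pairZ μ W V r s y := by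
  have := isProbabilityMeasure_chPost μ hW hκ₁ zero_le_one s
  exact mul_pos (chZ_pos μ hW hκ₁ zero_le_one s) (chZ_pos _ hV hκ hr y)

lemma pairZ_eq (μ : Measure Ω) [IsProbabilityMeasure μ]
    (hW : Measurable W) (hκ₁ : ∀ ω, ‖W ω‖ = κ₁) (hV : Measurable V) (hκ : ∀ ω, ‖V ω‖ = κ)
    (hr : 0 ≤ r) (s : D) (y : E) :
    pairZ μ W V r s y = ∫ ω, Real.exp (pairLog W V r s y ω) ∂μ := by
  have := isProbabilityMeasure_pairPost μ hW hκ₁ hV hκ hr s y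
  have h := pairZ_mul_integral_pairPost μ hW hκ₁ hV hκ hr s y (fun _ => 1)
  simpa using h

lemma integral_pairPost_eq_div (μ : Measure Ω) [IsProbabilityMeasure μ]
    (hW : Measurable W) (hκ₁ : ∀ ω, ‖W ω‖ = κ₁) (hV : Measurable V) (hκ : ∀ ω, ‖V ω‖ = κ)
    (hr : 0 ≤ r) (s : D) (y : E) (g : Ω → ℝ) :
    ∫ ω, g ω ∂(pairPost μ W V r s y)
      = (∫ ω, Real.exp (pairLog W V r s y ω) * g ω ∂μ)
        / ∫ ω, Real.exp (pairLog W V r s y ω) ∂μ := by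
  rw [← pairZ_mul_integral_pairPost μ hW hκ₁ hV hκ hr, ← pairZ_eq μ hW hκ₁ hV hκ hr,
    mul_div_cancel_left₀ _ (pairZ_pos μ hW hκ₁ hV hκ hr s y).ne']

lemma measurable_pairZ (μ : Measure Ω) [IsProbabilityMeasure μ]
    (hW : Measurable W) (hκ₁ : ∀ ω, ‖W ω‖ = κ₁) (hV : Measurable V) (hκ : ∀ ω, ‖V ω‖ = κ)
    (hr : 0 ≤ r) : Measurable (fun p : D × E => pairZ μ W V r p.1 p.2) := by
  simp_rw [pairZ_eq μ hW hκ₁ hV hκ hr]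
  exact ((measurable_pairLog hW hV r).exp.stronglyMeasurable.integral_prod_right'
    (ν := μ)).measurable

lemma measurable_integral_pairPost (μ : Measure Ω) [IsProbabilityMeasure μ]
    (hW : Measurable W) (hκ₁ : ∀ ω, ‖W ω‖ = κ₁) (hV : Measurable V) (hκ : ∀ ω, ‖V ω‖ = κ)
    (hr : 0 ≤ r) {P : Type*} [MeasurableSpace P] {g : P → Ω → ℝ}
    (hg : Measurable (Function.uncurry g)) :
    Measurable (fun p : P × D × E => ∫ ω, g p.1 ω ∂(pairPost μ W V r p.2.1 p.2.2)) := by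
  simp_rw [integral_pairPost_eq_div μ hW hκ₁ hV hκ hr]
  have hL : Measurable (fun q : (P × D × E) × Ω =>
      Real.exp (pairLog W V r q.1.2.1 q.1.2.2 q.2)) :=
    ((measurable_pairLog hW hV r).comp ((measurable_snd.comp measurable_fst).prodMk
      measurable_snd)).exp
  have hg' : Measurable (fun q : (P × D × E) × Ω => g q.1.1 q.2) :=
    hg.comp ((measurable_fst.comp measurable_fst).prodMk measurable_snd)
  exact ((hL.mul hg').stronglyMeasurable.integral_prod_right' (ν := μ)).measurable.div
    (hL.stronglyMeasurable.integral_prod_right' (ν := μ)).measurable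

lemma norm_add_sq_le_two_mul {G : Type*} [SeminormedAddCommGroup G] (x v : G) (k : ℝ)
    (hk : ‖v‖ ≤ k) : ‖x + v‖ ^ 2 ≤ 2 * k ^ 2 + 2 * ‖x‖ ^ 2 := by
  have h1 := pow_le_pow_left₀ (norm_nonneg _) (norm_add_le x v) 2
  have h2 := pow_le_pow_left₀ (norm_nonneg _) hk 2
  nlinarith [sq_nonneg (‖x‖ - ‖v‖)]

lemma pair_channel_average (μ : Measure Ω) [IsProbabilityMeasure μ]
    (hW : Measurable W) (hκ₁ : ∀ ω, ‖W ω‖ = κ₁) (hV : Measurable V) (hκ : ∀ ω, ‖V ω‖ = κ)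
    (hr : 0 ≤ r) {F : Ω → D → E → ℝ}
    (hF : Measurable (fun p : Ω × D × E => F p.1 p.2.1 p.2.2)) {A B : ℝ} (hB : 0 ≤ B)
    (hFb : ∀ ω s y, |F ω s y| ≤ A + B * (‖s‖ ^ 2 + ‖y‖ ^ 2)) :
    Integrable (fun s => chZ μ W 1 s * ∫ y, chZ (chPost μ W 1 s) V r y *
        ∫ ω, F ω s y ∂(pairPost μ W V r s y) ∂(ProbabilityTheory.stdGaussian E))
        (ProbabilityTheory.stdGaussian D) ∧
    Integrable (fun p : Ω × D × E => F p.1 (p.2.1 + W p.1) (p.2.2 + r • V p.1))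
        (pairLaw μ D E) ∧
    ∫ s, chZ μ W 1 s * ∫ y, chZ (chPost μ W 1 s) V r y *
        ∫ ω, F ω s y ∂(pairPost μ W V r s y) ∂(ProbabilityTheory.stdGaussian E)
        ∂(ProbabilityTheory.stdGaussian D)
      = ∫ p, F p.1 (p.2.1 + W p.1) (p.2.2 + r • V p.1) ∂(pairLaw μ D E) := by
  have hκ0 := kappa_nonneg μ hκ
  have hκ10 := kappa_nonneg μ hκ₁
  set γD := ProbabilityTheory.stdGaussian D
  set γE := ProbabilityTheory.stdGaussian E
  have hy2 : Integrable (fun y : E => ‖y‖ ^ 2) γE := integrable_norm_pow_stdGaussian 2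
  have hs2 : Integrable (fun s : D => ‖s‖ ^ 2) γD := integrable_norm_pow_stdGaussian 2
  have hsh : Measurable (fun p : Ω × D × E => (p.1, p.2.1 + W p.1, p.2.2 + r • V p.1)) := by
    fun_prop
  have hrV : ∀ ω, ‖r • V ω‖ ≤ r * κ := fun ω => by
    rw [norm_smul, hκ, Real.norm_of_nonneg hr]
  have hint : Integrable (fun p : Ω × D × E => F p.1 (p.2.1 + W p.1) (p.2.2 + r • V p.1))
      (pairLaw μ D E) := by
    have hdom : Integrable (fun p : Ω × D × E =>
        (A + B * (2 * κ₁ ^ 2 + 2 * (r * κ) ^ 2)) + 2 * B * (‖p.2.1‖ ^ 2 + ‖p.2.2‖ ^ 2))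
        (pairLaw μ D E) := by
      refine (integrable_const _).add (Integrable.const_mul ?_ _)
      exact ((hs2.comp_fst γE).add (hy2.comp_snd γD)).comp_snd μ
    refine hdom.mono' (hF.comp hsh).aestronglyMeasurable (ae_of_all _ fun p => ?_)
    refine (hFb _ _ _).trans ?_
    have h1 := norm_add_sq_le_two_mul p.2.1 (W p.1) κ₁ (hκ₁ _).le
    have h2 := norm_add_sq_le_two_mul p.2.2 (r • V p.1) (r * κ) (hrV _)
    have := mul_le_mul_of_nonneg_left (add_le_add h1 h2) hB
    linarith
  set F' : Ω → D → ℝ := fun ω s => ∫ y, F ω s (y + r • V ω) ∂γE with hF'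
  set m := ∫ y, ‖y‖ ^ 2 ∂γE
  have hF'm : Measurable (Function.uncurry F') := by
    have : Measurable (fun q : (Ω × D) × E => F q.1.1 q.1.2 (q.2 + r • V q.1.1)) :=
      hF.comp (by fun_prop :
        Measurable (fun q : (Ω × D) × E => (q.1.1, q.1.2, q.2 + r • V q.1.1)))
    exact (this.stronglyMeasurable.integral_prod_right' (ν := γE)).measurable
  have hF'b : ∀ ω s, |F' ω s| ≤ (A + B * (2 * (r * κ) ^ 2) + 2 * B * m) + B * ‖s‖ ^ 2 := by
    intro ω s
    have hd : Integrable (fun y : E =>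
        (A + B * (2 * (r * κ) ^ 2) + B * ‖s‖ ^ 2) + 2 * B * ‖y‖ ^ 2) γE :=
      (integrable_const _).add (hy2.const_mul _)
    have h := norm_integral_le_of_norm_le (f := fun y => F ω s (y + r • V ω)) hd
      (ae_of_all _ fun y => by
        refine (hFb _ _ _).trans ?_
        have h2 := norm_add_sq_le_two_mul y (r • V ω) (r * κ) (hrV _)
        have := mul_le_mul_of_nonneg_left h2 hB
        linarith)
    rw [integral_add (integrable_const _) (hy2.const_mul _), integral_const_mul] at h
    simp only [integral_const, probReal_univ, one_smul] at h
    change |F' ω s| ≤ _ at h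
    linarith
  have key := channel_average μ hW hκ₁ zero_le_one hF'm hF'b
  have hinner : ∀ s, ∫ y, chZ (chPost μ W 1 s) V r y *
        ∫ ω, F ω s y ∂(pairPost μ W V r s y) ∂γE = ∫ ω, F' ω s ∂(chPost μ W 1 s) := by
    intro s
    have := isProbabilityMeasure_chPost μ hW hκ₁ zero_le_one s
    exact (channel_average (chPost μ W 1 s) hV hκ hr (F := fun ω y => F ω s y)
      (A := A + B * ‖s‖ ^ 2) (B := B)
      (hF.comp (by fun_prop : Measurable (fun q : Ω × E => (q.1, s, q.2))))
      (fun ω y => (hFb ω s y).trans (by linarith))).2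
  simp_rw [hinner]
  refine ⟨key.1, hint, key.2.trans ?_⟩
  rw [pairLaw, integral_prod _ hint]
  refine integral_congr_ae ?_
  filter_upwards [(integrable_prod_iff hint.1).1 hint |>.1] with ω hω
  rw [integral_prod _ hω]
  simp only [hF', one_smul]
  rfl

lemma pairQ_eq (μ : Measure Ω) [IsProbabilityMeasure μ]
    (hW : Measurable W) (hκ₁ : ∀ ω, ‖W ω‖ = κ₁) (hV : Measurable V) (hκ : ∀ ω, ‖V ω‖ = κ)
    (hr : 0 ≤ r) :
    Integrable (fun s => chZ μ W 1 s * chQ (chPost μ W 1 s) V r)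
        (ProbabilityTheory.stdGaussian D) ∧
    Integrable (fun p : Ω × D × E => ∫ ω, ⟪V p.1, V ω⟫
        ∂(pairPost μ W V r (p.2.1 + W p.1) (p.2.2 + r • V p.1))) (pairLaw μ D E) ∧
    ∫ p, ∫ ω, ⟪V p.1, V ω⟫ ∂(pairPost μ W V r (p.2.1 + W p.1) (p.2.2 + r • V p.1))
        ∂(pairLaw μ D E) = pairQ μ W V r := by
  have hκ0 := kappa_nonneg μ hκ
  have hm : Measurable (Function.uncurry fun ω' ω => ⟪V ω', V ω⟫) := by
    unfold Function.uncurry; fun_prop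
  have h := pair_channel_average μ hW hκ₁ hV hκ hr
    (F := fun ω' s y => ∫ ω, ⟪V ω', V ω⟫ ∂(pairPost μ W V r s y))
    (measurable_integral_pairPost μ hW hκ₁ hV hκ hr hm) (A := κ ^ 2) (B := 0) le_rfl
    (fun ω' s y => by
      have := isProbabilityMeasure_pairPost μ hW hκ₁ hV hκ hr s y
      rw [zero_mul, add_zero, ← Real.norm_eq_abs]
      refine (norm_integral_le_of_norm_le_const (C := κ ^ 2) (ae_of_all _ fun ω => ?_)).trans
        (by rw [probReal_univ, mul_one])
      have := abs_real_inner_le_norm (V ω') (V ω)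
      rwa [hκ, hκ, ← sq] at this)
  have e : ∀ s, ∫ y, chZ (chPost μ W 1 s) V r y * ∫ ω', ∫ ω, ⟪V ω', V ω⟫
      ∂(pairPost μ W V r s y) ∂(pairPost μ W V r s y) ∂(ProbabilityTheory.stdGaussian E)
      = chQ (chPost μ W 1 s) V r := by
    intro s
    have := isProbabilityMeasure_chPost μ hW hκ₁ zero_le_one s
    rw [chQ]
    congr 1 with y
    congr 1
    rw [← real_inner_self_eq_norm_sq, inner_chMean _ hV hκ hr]
    refine integral_congr_ae (ae_of_all _ fun ω' => ?_)
    beta_reduce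
    rw [real_inner_comm, inner_chMean _ hV hκ hr]
    rfl
  simp_rw [e] at h
  exact ⟨h.1, h.2.1, h.2.2.symm⟩

lemma pairQ_mono (μ : Measure Ω) [IsProbabilityMeasure μ]
    (hW : Measurable W) (hκ₁ : ∀ ω, ‖W ω‖ = κ₁) (hV : Measurable V) (hκ : ∀ ω, ‖V ω‖ = κ)
    (hr₁ : 0 ≤ r₁) (h : r₁ ≤ r) : pairQ μ W V r₁ ≤ pairQ μ W V r := by
  refine integral_mono (pairQ_eq μ hW hκ₁ hV hκ hr₁).1
    (pairQ_eq μ hW hκ₁ hV hκ (hr₁.trans h)).1 fun s => ?_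
  have := isProbabilityMeasure_chPost μ hW hκ₁ zero_le_one s
  exact mul_le_mul_of_nonneg_left (chQ_mono _ hV hκ hr₁ h)
    (chZ_pos μ hW hκ₁ zero_le_one s).le

lemma pairQ_nonneg (μ : Measure Ω) [IsProbabilityMeasure μ]
    (hW : Measurable W) (hκ₁ : ∀ ω, ‖W ω‖ = κ₁) (hV : Measurable V) (hκ : ∀ ω, ‖V ω‖ = κ)
    (hr : 0 ≤ r) : 0 ≤ pairQ μ W V r := by
  refine integral_nonneg fun s => ?_
  have := isProbabilityMeasure_chPost μ hW hκ₁ zero_le_one s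
  exact mul_nonneg (chZ_pos μ hW hκ₁ zero_le_one s).le (chQ_nonneg _ hV hκ hr)

lemma pairQ_le (μ : Measure Ω) [IsProbabilityMeasure μ]
    (hW : Measurable W) (hκ₁ : ∀ ω, ‖W ω‖ = κ₁) (hV : Measurable V) (hκ : ∀ ω, ‖V ω‖ = κ)
    (hr : 0 ≤ r) : pairQ μ W V r ≤ κ ^ 2 := by
  have hZ := integrable_chZ μ hW hκ₁ zero_le_one
  calc pairQ μ W V r ≤ ∫ s, chZ μ W 1 s * κ ^ 2 ∂(ProbabilityTheory.stdGaussian D) := by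
        refine integral_mono (pairQ_eq μ hW hκ₁ hV hκ hr).1 (hZ.mul_const _) fun s => ?_
        have := isProbabilityMeasure_chPost μ hW hκ₁ zero_le_one s
        exact mul_le_mul_of_nonneg_left (chQ_le _ hV hκ hr)
          (chZ_pos μ hW hκ₁ zero_le_one s).le
    _ = κ ^ 2 := by
        rw [integral_mul_const, integral_chZ μ hW hκ₁ zero_le_one, one_mul]

lemma abs_log_pairZ_le (μ : Measure Ω) [IsProbabilityMeasure μ]
    (hW : Measurable W) (hκ₁ : ∀ ω, ‖W ω‖ = κ₁) (hV : Measurable V) (hκ : ∀ ω, ‖V ω‖ = κ)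
    (hr : 0 ≤ r) (s : D) (y : E) : |Real.log (pairZ μ W V r s y)|
      ≤ (κ₁ * ‖s‖ + κ₁ ^ 2 / 2) + (r * κ * ‖y‖ + r ^ 2 * κ ^ 2 / 2) := by
  have := isProbabilityMeasure_chPost μ hW hκ₁ zero_le_one s
  rw [pairZ, Real.log_mul (chZ_pos μ hW hκ₁ zero_le_one s).ne' (chZ_pos _ hV hκ hr y).ne']
  have h1 := abs_log_chZ_le μ hW hκ₁ zero_le_one s
  have h2 := abs_log_chZ_le (chPost μ W 1 s) hV hκ hr y
  refine (abs_add_le _ _).trans ?_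
  linarith

lemma log_pairZ_sub_sq_le (μ : Measure Ω) [IsProbabilityMeasure μ]
    (hW : Measurable W) (hκ₁ : ∀ ω, ‖W ω‖ = κ₁) (hV : Measurable V) (hκ : ∀ ω, ‖V ω‖ = κ)
    (hr : 0 ≤ r) (c : ℝ) (s : D) (y : E) : |(Real.log (pairZ μ W V r s y) - c) ^ 2|
      ≤ 3 * (|c| + κ₁ ^ 2 / 2 + r ^ 2 * κ ^ 2 / 2) ^ 2
        + 3 * (κ₁ ^ 2 + (r * κ) ^ 2) * (‖s‖ ^ 2 + ‖y‖ ^ 2) := by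
  have h := abs_log_pairZ_le μ hW hκ₁ hV hκ hr s y
  rw [abs_of_nonneg (sq_nonneg _)]
  have h1 : |Real.log (pairZ μ W V r s y) - c|
      ≤ (|c| + κ₁ ^ 2 / 2 + r ^ 2 * κ ^ 2 / 2) + κ₁ * ‖s‖ + (r * κ) * ‖y‖ := by
    refine (abs_sub _ _).trans ?_
    linarith
  have h2 := pow_le_pow_left₀ (abs_nonneg _) h1 2
  rw [sq_abs] at h2
  refine h2.trans ?_
  set a := |c| + κ₁ ^ 2 / 2 + r ^ 2 * κ ^ 2 / 2
  nlinarith [sq_nonneg (a - κ₁ * ‖s‖), sq_nonneg (a - (r * κ) * ‖y‖),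
    sq_nonneg (κ₁ * ‖s‖ - (r * κ) * ‖y‖), sq_nonneg (κ₁ * ‖y‖), sq_nonneg (r * κ * ‖s‖)]

lemma pairW_eq (μ : Measure Ω) [IsProbabilityMeasure μ]
    (hW : Measurable W) (hκ₁ : ∀ ω, ‖W ω‖ = κ₁) (hV : Measurable V) (hκ : ∀ ω, ‖V ω‖ = κ)
    (hr : 0 ≤ r) (c : ℝ) :
    Integrable (fun s => chZ μ W 1 s *
        chW (chPost μ W 1 s) V r (c - Real.log (chZ μ W 1 s)))
        (ProbabilityTheory.stdGaussian D) ∧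
    Integrable (fun p : Ω × D × E =>
        (Real.log (pairZ μ W V r (p.2.1 + W p.1) (p.2.2 + r • V p.1)) - c) ^ 2)
        (pairLaw μ D E) ∧
    ∫ p : Ω × D × E, (Real.log (pairZ μ W V r (p.2.1 + W p.1) (p.2.2 + r • V p.1)) - c) ^ 2
        ∂(pairLaw μ D E) = pairW μ W V r c := by
  have h := pair_channel_average μ hW hκ₁ hV hκ hr
    (F := fun _ s y => (Real.log (pairZ μ W V r s y) - c) ^ 2)
    ((((measurable_pairZ μ hW hκ₁ hV hκ hr).comp measurable_snd).log.sub_const c).pow_const 2)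
    (A := 3 * (|c| + κ₁ ^ 2 / 2 + r ^ 2 * κ ^ 2 / 2) ^ 2)
    (B := 3 * (κ₁ ^ 2 + (r * κ) ^ 2)) (by positivity)
    (fun _ s y => log_pairZ_sub_sq_le μ hW hκ₁ hV hκ hr c s y)
  have e : ∀ s, ∫ y, chZ (chPost μ W 1 s) V r y * ∫ _, (Real.log (pairZ μ W V r s y) - c) ^ 2
      ∂(pairPost μ W V r s y) ∂(ProbabilityTheory.stdGaussian E)
      = chW (chPost μ W 1 s) V r (c - Real.log (chZ μ W 1 s)) := by
    intro s
    have := isProbabilityMeasure_chPost μ hW hκ₁ zero_le_one s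
    rw [chW]
    congr 1 with y
    have := isProbabilityMeasure_pairPost μ hW hκ₁ hV hκ hr s y
    simp only [integral_const, probReal_univ, one_smul]
    rw [pairZ, Real.log_mul (chZ_pos μ hW hκ₁ zero_le_one s).ne' (chZ_pos _ hV hκ hr y).ne']
    ring
  simp_rw [e] at h
  exact ⟨h.1, h.2.1, h.2.2.symm⟩

/-- Mean square deviation from `m` of the overlap between the signal and a posterior sample. -/
def pairVar (μ : Measure Ω) (W : Ω → D) (V : Ω → E) (r m : ℝ) : ℝ :=
  ∫ p : Ω × D × E, ∫ ω, (⟪V p.1, V ω⟫ - m) ^ 2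
    ∂(pairPost μ W V r (p.2.1 + W p.1) (p.2.2 + r • V p.1)) ∂(pairLaw μ D E)

lemma pairVar_eq (μ : Measure Ω) [IsProbabilityMeasure μ]
    (hW : Measurable W) (hκ₁ : ∀ ω, ‖W ω‖ = κ₁) (hV : Measurable V) (hκ : ∀ ω, ‖V ω‖ = κ)
    (hr : 0 ≤ r) (m : ℝ) :
    Integrable (fun p : Ω × D × E => ∫ ω, (⟪V p.1, V ω⟫ - m) ^ 2
        ∂(pairPost μ W V r (p.2.1 + W p.1) (p.2.2 + r • V p.1))) (pairLaw μ D E) ∧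
    pairVar μ W V r m = ∫ s, chZ μ W 1 s * ∫ y, chZ (chPost μ W 1 s) V r y *
        ∫ ω', ∫ ω, (⟪V ω', V ω⟫ - m) ^ 2 ∂(pairPost μ W V r s y) ∂(pairPost μ W V r s y)
        ∂(ProbabilityTheory.stdGaussian E) ∂(ProbabilityTheory.stdGaussian D) := by
  have hm : Measurable (Function.uncurry fun ω' ω => (⟪V ω', V ω⟫ - m) ^ 2) := by
    unfold Function.uncurry; fun_prop
  have h := pair_channel_average μ hW hκ₁ hV hκ hr
    (F := fun ω' s y => ∫ ω, (⟪V ω', V ω⟫ - m) ^ 2 ∂(pairPost μ W V r s y))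
    (measurable_integral_pairPost μ hW hκ₁ hV hκ hr hm) (A := (κ ^ 2 + |m|) ^ 2) (B := 0) le_rfl
    (fun ω' s y => by
      have := isProbabilityMeasure_pairPost μ hW hκ₁ hV hκ hr s y
      rw [zero_mul, add_zero, ← Real.norm_eq_abs]
      refine (norm_integral_le_of_norm_le_const (C := (κ ^ 2 + |m|) ^ 2)
        (ae_of_all _ fun ω => ?_)).trans
        (by rw [probReal_univ, mul_one])
      have := abs_real_inner_le_norm (V ω') (V ω)
      rw [hκ, hκ, ← sq] at this
      rw [norm_pow]
      refine pow_le_pow_left₀ (norm_nonneg _) ((abs_sub _ _).trans ?_) 2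
      linarith)
  exact ⟨h.2.1, h.2.2.symm⟩

/-- The mean square deviation is minimal at the mean. -/
lemma pairVar_pairQ_le (μ : Measure Ω) [IsProbabilityMeasure μ]
    (hW : Measurable W) (hκ₁ : ∀ ω, ‖W ω‖ = κ₁) (hV : Measurable V) (hκ : ∀ ω, ‖V ω‖ = κ)
    (hr : 0 ≤ r) (d : ℝ) : pairVar μ W V r (pairQ μ W V r) ≤ pairVar μ W V r d := by
  set q := pairQ μ W V r with hq
  have h1 := pairVar_eq μ hW hκ₁ hV hκ hr q
  have h2 := pairQ_eq μ hW hκ₁ hV hκ hr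
  have e : pairVar μ W V r d = ∫ p : Ω × D × E, ((∫ ω, (⟪V p.1, V ω⟫ - q) ^ 2
      ∂(pairPost μ W V r (p.2.1 + W p.1) (p.2.2 + r • V p.1)))
      - 2 * (d - q) * ((∫ ω, ⟪V p.1, V ω⟫
        ∂(pairPost μ W V r (p.2.1 + W p.1) (p.2.2 + r • V p.1))) - q) + (d - q) ^ 2)
      ∂(pairLaw μ D E) := by
    rw [pairVar]
    congr 1 with p
    set P := pairPost μ W V r (p.2.1 + W p.1) (p.2.2 + r • V p.1)
    have : IsProbabilityMeasure P := isProbabilityMeasure_pairPost μ hW hκ₁ hV hκ hr _ _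
    have hVi : Integrable V P := integrable_of_norm_eq hV hκ
    have hX : Integrable (fun ω => ⟪V p.1, V ω⟫ - q) P :=
      (hVi.const_inner _).sub (integrable_const _)
    have hX2 : Integrable (fun ω => (⟪V p.1, V ω⟫ - q) ^ 2) P := by
      refine Integrable.of_bound (C := (κ ^ 2 + |q|) ^ 2)
        (by fun_prop) (ae_of_all _ fun ω => ?_)
      have := abs_real_inner_le_norm (V p.1) (V ω)
      rw [hκ, hκ, ← sq] at this
      rw [norm_pow]
      refine pow_le_pow_left₀ (norm_nonneg _) ((abs_sub _ _).trans ?_) 2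
      linarith
    have := integral_sub_const_sq hX hX2 (d - q)
    rw [integral_sub (hVi.const_inner _) (integrable_const _)] at this
    simp only [sub_sub_sub_cancel_right, integral_const, probReal_univ, one_smul] at this
    exact this
  rw [e, integral_sub_add h1.1 (by exact ((h2.2.1.sub (integrable_const _)).const_mul _))
    (integrable_const _), integral_const_mul,
    integral_sub h2.2.1 (integrable_const _), h2.2.2, ← hq]
  simp only [integral_const, probReal_univ, one_smul, sub_self, mul_zero, sub_zero]
  change pairVar μ W V r q ≤ pairVar μ W V r q + _
  nlinarith [sq_nonneg (d - q)]

/-- Overlap variance bound in terms of the increment of the overlap and the fluctuations of the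
log-evidence. -/
lemma pairVar_le (μ : Measure Ω) [IsProbabilityMeasure μ]
    (hW : Measurable W) (hκ₁ : ∀ ω, ‖W ω‖ = κ₁) (hV : Measurable V) (hκ : ∀ ω, ‖V ω‖ = κ)
    (hr₁ : 0 ≤ r₁) (hr₂ : 0 < r₂) (hr : 0 < r) (h : r ^ 2 = r₁ ^ 2 + r₂ ^ 2) (c₁ c : ℝ) :
    pairVar μ W V r₁ (pairQ μ W V r₁)
      ≤ 6 * κ ^ 2 / r₂ ^ 2 + 12 * κ ^ 2 * (pairQ μ W V r - pairQ μ W V r₁)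
        + 6 * κ ^ 4 * (r₂ ^ 2 / r ^ 2)
        + 48 / r₂ ^ 4 * (pairW μ W V r c + pairW μ W V r₁ c₁) := by
  refine (pairVar_pairQ_le μ hW hκ₁ hV hκ hr₁ (2 / r₂ ^ 2 * (c - c₁))).trans ?_
  rw [(pairVar_eq μ hW hκ₁ hV hκ hr₁ _).2]
  have hZ := integrable_chZ μ hW hκ₁ zero_le_one
  have hQ := pairQ_eq μ hW hκ₁ hV hκ hr.le
  have hQ₁ := pairQ_eq μ hW hκ₁ hV hκ hr₁
  have hF := pairW_eq μ hW hκ₁ hV hκ hr.le c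
  have hF₁ := pairW_eq μ hW hκ₁ hV hκ hr₁ c₁
  have hm := integral_mono_of_nonneg (μ := ProbabilityTheory.stdGaussian D)
    (f := fun s => chZ μ W 1 s * ∫ y, chZ (chPost μ W 1 s) V r₁ y *
        ∫ ω', ∫ ω, (⟪V ω', V ω⟫ - 2 / r₂ ^ 2 * (c - c₁)) ^ 2 ∂(pairPost μ W V r₁ s y)
        ∂(pairPost μ W V r₁ s y) ∂(ProbabilityTheory.stdGaussian E))
    (g := fun s => (chZ μ W 1 s * (6 * κ ^ 2 / r₂ ^ 2 + 6 * κ ^ 4 * (r₂ ^ 2 / r ^ 2)))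
      + (12 * κ ^ 2) * (chZ μ W 1 s * chQ (chPost μ W 1 s) V r)
      - (12 * κ ^ 2) * (chZ μ W 1 s * chQ (chPost μ W 1 s) V r₁)
      + (48 / r₂ ^ 4) *
        (chZ μ W 1 s * chW (chPost μ W 1 s) V r (c - Real.log (chZ μ W 1 s))
        + chZ μ W 1 s * chW (chPost μ W 1 s) V r₁ (c₁ - Real.log (chZ μ W 1 s))))
    (ae_of_all _ fun s => by
      have := isProbabilityMeasure_chPost μ hW hκ₁ zero_le_one s
      exact mul_nonneg (chZ_pos μ hW hκ₁ zero_le_one s).le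
        (integral_nonneg fun y => mul_nonneg (chZ_pos _ hV hκ hr₁ y).le
        (integral_nonneg fun _ => integral_nonneg fun _ => sq_nonneg _)))
    ((((hZ.mul_const _).add (hQ.1.const_mul _)).sub (hQ₁.1.const_mul _)).add
      ((hF.1.add hF₁.1).const_mul _))
    (ae_of_all _ fun s => by
      have := isProbabilityMeasure_chPost μ hW hκ₁ zero_le_one s
      have h1 := mul_le_mul_of_nonneg_left
        (overlap_variance_le_of_prior (chPost μ W 1 s) hV hκ hr₁ hr₂ hr h
          (c₁ - Real.log (chZ μ W 1 s)) (c - Real.log (chZ μ W 1 s)))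
        (chZ_pos μ hW hκ₁ zero_le_one s).le
      simp only [sub_sub_sub_cancel_right] at h1
      refine h1.trans (le_of_eq ?_)
      ring)
  rw [integral_sub_add (by exact ((hZ.mul_const _).add (hQ.1.const_mul _))) (hQ₁.1.const_mul _)
    (by exact ((hF.1.add hF₁.1).const_mul _)),
    integral_add (hZ.mul_const _) (hQ.1.const_mul _), integral_mul_const, integral_const_mul,
    integral_const_mul, integral_const_mul, integral_add hF.1 hF₁.1,
    integral_chZ μ hW hκ₁ zero_le_one] at hm
  change _ ≤ 1 * _ + 12 * κ ^ 2 * pairQ μ W V r - 12 * κ ^ 2 * pairQ μ W V r₁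
    + 48 / r₂ ^ 4 * (pairW μ W V r c + pairW μ W V r₁ c₁) at hm
  linarith

end PairChannel

section GaussianPoincare
open scoped RealInnerProductSpace ENNReal
variable {F : Type*} [NormedAddCommGroup F] [NormedSpace ℝ F] [SecondCountableTopology F]
  [CompleteSpace F] [MeasurableSpace F] [BorelSpace F]
  {γ : Measure F} {L : F → ℝ} {B : F → F → ℝ} {k K : ℝ}

lemma sq_le_add_sq_of_le_of_le {a x b : ℝ} (h₁ : a ≤ x) (h₂ : x ≤ b) : x ^ 2 ≤ a ^ 2 + b ^ 2 := by
  rcases le_total 0 x with h | h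
  · nlinarith [sq_nonneg a]
  · nlinarith [sq_nonneg b]

lemma one_sub_cos_sq_le (h : ℝ) : (1 - Real.cos h) ^ 2 ≤ h ^ 4 / 4 := by
  have h1 := Real.one_sub_sq_div_two_le_cos (x := h)
  have h2 := Real.cos_le_one h
  have := pow_le_pow_left₀ (by linarith : 0 ≤ 1 - Real.cos h) (by linarith : _ ≤ h ^ 2 / 2) 2
  linarith

lemma sin_sq_le_sq (h : ℝ) : Real.sin h ^ 2 ≤ h ^ 2 := by
  have := Real.abs_sin_le_abs (x := h)
  exact sq_le_sq.2 this

/-- A rotation of two independent copies of a centered Gaussian by a small angle changes a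
function with subgradient `B` by a small amount in mean square. -/
lemma integral_sub_sq_rotation_le [ProbabilityTheory.IsGaussian γ] (hγ : ∫ x, x ∂γ = 0)
    (hL : Measurable L) (hB : Measurable (Function.uncurry B))
    (hBlin : ∀ x y z (c d : ℝ), B x (c • y + d • z) = c * B x y + d * B x z)
    (hBn : ∀ x z, |B x z| ≤ k * ‖z‖) (hsub : ∀ x y, B x (y - x) ≤ L y - L x)
    (hK : ∀ x, ∫ z, B x z ^ 2 ∂γ ≤ K) (h : ℝ) :
    Integrable (fun p : F × F => (L (Real.cos h • p.1 + Real.sin h • p.2) - L p.1) ^ 2)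
        (γ.prod γ) ∧
      ∫ p : F × F, (L (Real.cos h • p.1 + Real.sin h • p.2) - L p.1) ^ 2 ∂(γ.prod γ)
        ≤ h ^ 4 * (k ^ 2 * ∫ x, ‖x‖ ^ 2 ∂γ) + 4 * h ^ 2 * K := by
  have hn2 : Integrable (fun x : F => ‖x‖ ^ 2) γ :=
    (ProbabilityTheory.IsGaussian.memLp_two_id (μ := γ)).norm.integrable_sq
  set m := ∫ x, ‖x‖ ^ 2 ∂γ with hm
  have hBsq : ∀ x z, B x z ^ 2 ≤ k ^ 2 * ‖z‖ ^ 2 := fun x z => by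
    rw [← mul_pow, ← sq_abs]
    exact pow_le_pow_left₀ (abs_nonneg _) (hBn x z) 2
  have hBxx : Integrable (fun x => B x x ^ 2) γ :=
    (hn2.const_mul (k ^ 2)).mono' ((hB.comp (measurable_id.prodMk measurable_id)).pow_const
      2).aestronglyMeasurable (ae_of_all _ fun x => by
        rw [Real.norm_of_nonneg (sq_nonneg _)]; exact hBsq x x)
  have hBxz : Integrable (fun p : F × F => B p.1 p.2 ^ 2) (γ.prod γ) :=
    ((hn2.const_mul (k ^ 2)).comp_snd γ).mono' (hB.pow_const 2).aestronglyMeasurable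
      (ae_of_all _ fun p => by rw [Real.norm_of_nonneg (sq_nonneg _)]; exact hBsq p.1 p.2)
  have hIxx : ∫ x, B x x ^ 2 ∂γ ≤ k ^ 2 * m := by
    rw [hm, ← integral_const_mul]
    exact integral_mono hBxx (hn2.const_mul _) fun x => hBsq x x
  have hIxz : ∫ p : F × F, B p.1 p.2 ^ 2 ∂(γ.prod γ) ≤ K := by
    rw [integral_prod _ hBxz]
    calc _ ≤ ∫ _ : F, K ∂γ := integral_mono hBxz.integral_prod_left (integrable_const _) hK
      _ = K := by simp
  set R : F × F →L[ℝ] F × F := ContinuousLinearMap.rotation h with hR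
  have hRp : MeasurePreserving R (γ.prod γ) (γ.prod γ) :=
    ⟨(ContinuousLinearMap.rotation h : F × F →L[ℝ] F × F).continuous.measurable,
      ProbabilityTheory.IsGaussian.map_rotation_eq_self (by simpa using hγ) h⟩
  set A : F × F → ℝ := fun p =>
    2 * (1 - Real.cos h) ^ 2 * B p.1 p.1 ^ 2 + 2 * Real.sin h ^ 2 * B p.1 p.2 ^ 2 with hA
  have hAi : Integrable A (γ.prod γ) :=
    ((hBxx.comp_fst γ).const_mul _).add (hBxz.const_mul _)
  have hAR : Integrable (A ∘ R) (γ.prod γ) := hRp.integrable_comp_of_integrable hAi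
  have hAint : ∫ p, A p ∂(γ.prod γ) ≤ h ^ 4 / 2 * (k ^ 2 * m) + 2 * h ^ 2 * K := by
    have hm0 : 0 ≤ k ^ 2 * m := mul_nonneg (sq_nonneg _) (integral_nonneg fun _ => sq_nonneg _)
    have hK0 : 0 ≤ K := (integral_nonneg fun _ => sq_nonneg _).trans (hK 0)
    rw [hA, integral_add ((hBxx.comp_fst γ).const_mul _) (hBxz.const_mul _), integral_const_mul,
      integral_const_mul]
    have e : ∫ p : F × F, B p.1 p.1 ^ 2 ∂(γ.prod γ) = ∫ x, B x x ^ 2 ∂γ := by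
      rw [integral_fun_fst (fun x => B x x ^ 2)]; simp
    rw [e]
    have h1 := one_sub_cos_sq_le h
    have h2 := sin_sq_le_sq h
    calc _ ≤ 2 * (h ^ 4 / 4) * (k ^ 2 * m) + 2 * h ^ 2 * K := by gcongr
      _ = _ := by ring
  have hARint : ∫ p, (A ∘ R) p ∂(γ.prod γ) = ∫ p, A p ∂(γ.prod γ) := by
    conv_rhs => rw [← hRp.map_eq]
    rw [integral_map hRp.measurable.aemeasurable (by rw [hRp.map_eq]; exact hAi.1)]
    rfl
  have hpt : ∀ p : F × F, (L (Real.cos h • p.1 + Real.sin h • p.2) - L p.1) ^ 2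
      ≤ A p + (A ∘ R) p := by
    intro p
    have hR1 : (R p).1 = Real.cos h • p.1 + Real.sin h • p.2 := by
      simp [hR, ContinuousLinearMap.rotation_apply]
    have hR2 : (R p).2 = -Real.sin h • p.1 + Real.cos h • p.2 := by
      simp [hR, ContinuousLinearMap.rotation_apply]
    rw [← hR1]
    have h1 := hsub p.1 (R p).1
    have h2 := hsub (R p).1 p.1
    have e1 : (R p).1 - p.1 = (Real.cos h - 1) • p.1 + Real.sin h • p.2 := by
      rw [hR1]; module
    have e2 : p.1 - (R p).1 = (Real.cos h - 1) • (R p).1 + (-Real.sin h) • (R p).2 := by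
      rw [hR2, hR1, smul_add, smul_add, smul_smul, smul_smul, smul_smul, smul_smul]
      have hc : (Real.cos h - 1) * Real.cos h + -Real.sin h * -Real.sin h
          = 1 - Real.cos h := by
        have := Real.sin_sq_add_cos_sq h; nlinarith
      have hs : (Real.cos h - 1) * Real.sin h + -Real.sin h * Real.cos h = -Real.sin h := by ring
      calc p.1 - (Real.cos h • p.1 + Real.sin h • p.2)
          = (1 - Real.cos h) • p.1 + (-Real.sin h) • p.2 := by module
        _ = _ := by rw [← hc, ← hs]; module
    rw [e1, hBlin] at h1
    rw [e2, hBlin] at h2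
    refine (sq_le_add_sq_of_le_of_le h1 (by linarith :
      _ ≤ -((Real.cos h - 1) * B (R p).1 (R p).1 + -Real.sin h * B (R p).1 (R p).2))).trans ?_
    have key : ∀ c s x y : ℝ, ((c - 1) * x + s * y) ^ 2
        ≤ 2 * (1 - c) ^ 2 * x ^ 2 + 2 * s ^ 2 * y ^ 2 := fun c s x y => by
      nlinarith [sq_nonneg ((c - 1) * x - s * y)]
    have k1 := key (Real.cos h) (Real.sin h) (B p.1 p.1) (B p.1 p.2)
    have k2 := key (Real.cos h) (-Real.sin h) (B (R p).1 (R p).1) (B (R p).1 (R p).2)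
    rw [neg_sq (Real.sin h)] at k2
    rw [neg_sq]
    exact add_le_add k1 k2
  have hmeas : Measurable (fun p : F × F =>
      (L (Real.cos h • p.1 + Real.sin h • p.2) - L p.1) ^ 2) := by fun_prop
  have hint := (hAi.add hAR).mono' hmeas.aestronglyMeasurable (ae_of_all _ fun p => by
    rw [Real.norm_of_nonneg (sq_nonneg _)]; exact hpt p)
  refine ⟨hint, (integral_mono hint (hAi.add hAR) hpt).trans ?_⟩
  simp only [Pi.add_apply]
  rw [integral_add hAi hAR, hARint]
  linarith

/-- Gaussian Poincaré inequality for a function with subgradient `B`. -/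
lemma integral_sub_integral_sq_le [ProbabilityTheory.IsGaussian γ] (hγ : ∫ x, x ∂γ = 0)
    (hL : Measurable L) (hB : Measurable (Function.uncurry B))
    (hBlin : ∀ x y z (c d : ℝ), B x (c • y + d • z) = c * B x y + d * B x z)
    (hBn : ∀ x z, |B x z| ≤ k * ‖z‖) (hsub : ∀ x y, B x (y - x) ≤ L y - L x)
    (hK : ∀ x, ∫ z, B x z ^ 2 ∂γ ≤ K) :
    ∫ x, (L x - ∫ x', L x' ∂γ) ^ 2 ∂γ ≤ π ^ 2 * K := by
  set m := k ^ 2 * ∫ x, ‖x‖ ^ 2 ∂γ with hm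
  have hrot : ∀ θ : ℝ, MeasurePreserving (ContinuousLinearMap.rotation θ : F × F →L[ℝ] F × F)
      (γ.prod γ) (γ.prod γ) := fun θ =>
    ⟨(ContinuousLinearMap.rotation θ : F × F →L[ℝ] F × F).continuous.measurable,
      ProbabilityTheory.IsGaussian.map_rotation_eq_self (by simpa using hγ) θ⟩
  have hstep := integral_sub_sq_rotation_le hγ hL hB hBlin hBn hsub hK
  have hbound : ∀ N : ℕ, 0 < N → Integrable (fun p : F × F => (L p.2 - L p.1) ^ 2) (γ.prod γ) ∧
      ∫ p : F × F, (L p.2 - L p.1) ^ 2 ∂(γ.prod γ) ≤ π ^ 4 / 16 * m / N ^ 2 + π ^ 2 * K := by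
    intro N hN
    have hN' : (0 : ℝ) < N := by exact_mod_cast hN
    set h := π / 2 / N with hh
    set S : F × F → ℝ := fun p => (L (Real.cos h • p.1 + Real.sin h • p.2) - L p.1) ^ 2 with hS
    set T : ℕ → F × F → F := fun j p => Real.cos (j * h) • p.1 + Real.sin (j * h) • p.2 with hT
    have hTS : ∀ j, (fun p => (L (T (j + 1) p) - L (T j p)) ^ 2)
        = S ∘ (ContinuousLinearMap.rotation (j * h) : F × F →L[ℝ] F × F) := by
      intro j
      ext p
      simp only [hS, hT, Function.comp, ContinuousLinearMap.rotation_apply]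
      congr 3
      push_cast
      rw [add_mul, one_mul, Real.cos_add, Real.sin_add]
      module
    have hSi := hstep h
    have hi : ∀ j, Integrable (fun p => (L (T (j + 1) p) - L (T j p)) ^ 2) (γ.prod γ) := by
      intro j
      rw [hTS]
      exact (hrot _).integrable_comp_of_integrable hSi.1
    have hI : ∀ j, ∫ p, (L (T (j + 1) p) - L (T j p)) ^ 2 ∂(γ.prod γ)
        = ∫ p, S p ∂(γ.prod γ) := by
      intro j
      rw [hTS]
      conv_rhs => rw [← (hrot (j * h)).map_eq]
      rw [integral_map (hrot _).measurable.aemeasurable (by rw [(hrot _).map_eq]; exact hSi.1.1)]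
      rfl
    have hsum : Integrable (fun p => (N : ℝ) * ∑ j ∈ Finset.range N,
        (L (T (j + 1) p) - L (T j p)) ^ 2) (γ.prod γ) :=
      (integrable_finsetSum _ fun j _ => hi j).const_mul _
    have hpt : ∀ p : F × F, (L p.2 - L p.1) ^ 2
        ≤ (N : ℝ) * ∑ j ∈ Finset.range N, (L (T (j + 1) p) - L (T j p)) ^ 2 := by
      intro p
      have e : L p.2 - L p.1 = ∑ j ∈ Finset.range N, (L (T (j + 1) p) - L (T j p)) := by
        rw [Finset.sum_range_sub (fun j => L (T j p))]
        have hNh : (N : ℝ) * h = π / 2 := by rw [hh]; field_simp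
        simp only [hT, hNh, Nat.cast_zero, zero_mul]
        simp
      rw [e]
      have := sq_sum_le_card_mul_sum_sq (s := Finset.range N)
        (f := fun j => L (T (j + 1) p) - L (T j p))
      rwa [Finset.card_range] at this
    have hmeas : Measurable (fun p : F × F => (L p.2 - L p.1) ^ 2) := by fun_prop
    have hint := hsum.mono' hmeas.aestronglyMeasurable (ae_of_all _ fun p => by
      rw [Real.norm_of_nonneg (sq_nonneg _)]; exact hpt p)
    refine ⟨hint, (integral_mono hint hsum hpt).trans ?_⟩
    rw [integral_const_mul, integral_finsetSum _ fun j _ => hi j]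
    simp_rw [hI]
    rw [Finset.sum_const, Finset.card_range, nsmul_eq_mul]
    calc (N : ℝ) * (N * ∫ p, S p ∂(γ.prod γ))
        ≤ N * (N * (h ^ 4 * m + 4 * h ^ 2 * K)) := by gcongr; exact hSi.2
      _ = _ := by rw [hh]; field_simp; ring
  have hD := (hbound 1 one_pos).1
  have hlim : ∫ p : F × F, (L p.2 - L p.1) ^ 2 ∂(γ.prod γ) ≤ π ^ 2 * K := by
    have ht : Tendsto (fun N : ℕ => π ^ 4 / 16 * m / (N : ℝ) ^ 2 + π ^ 2 * K) atTop
        (nhds (0 + π ^ 2 * K)) := by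
      refine Tendsto.add_const _ (tendsto_const_nhds.div_atTop ?_)
      exact (tendsto_pow_atTop two_ne_zero).comp tendsto_natCast_atTop_atTop
    rw [zero_add] at ht
    exact ge_of_tendsto ht (eventually_atTop.2 ⟨1, fun N hN => (hbound N hN).2⟩)
  have hLi : Integrable L γ := by
    have hn : Integrable (fun x : F => ‖x‖) γ :=
      ((ProbabilityTheory.IsGaussian.memLp_two_id (μ := γ)).norm.integrable (by norm_num))
    refine ((integrable_const |L 0|).add (hn.const_mul k)).mono' hL.aestronglyMeasurable
      (ae_of_all _ fun x => ?_)
    have h1 := hsub 0 x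
    have h2 := hsub x 0
    have h3 := hBn 0 (x - 0)
    have h4 := hBn x (0 - x)
    rw [sub_zero] at h1 h3
    rw [zero_sub, norm_neg] at h4
    rw [zero_sub] at h2
    simp only [Pi.add_apply, Real.norm_eq_abs]
    rw [abs_le] at h3 h4 ⊢
    have := neg_abs_le (L 0)
    have := le_abs_self (L 0)
    constructor <;> linarith
  have hmean := integral_prod _ hD
  refine le_trans ?_ hlim
  rw [hmean]
  refine integral_mono_of_nonneg (ae_of_all _ fun _ => sq_nonneg _) hD.integral_prod_left ?_
  filter_upwards [hD.prod_right_ae] with x hx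
  have e : L x - ∫ x', L x' ∂γ = -∫ x', (L x' - L x) ∂γ := by
    rw [integral_sub hLi (integrable_const _)]; simp
  rw [e, neg_sq]
  have := integral_sub_const_sq (P := γ) (X := fun x' => L x' - L x)
    (hLi.sub (integrable_const _)) hx (∫ x', (L x' - L x) ∂γ)
  have h0 : 0 ≤ ∫ ω, ((L ω - L x) - ∫ x', (L x' - L x) ∂γ) ^ 2 ∂γ :=
    integral_nonneg fun _ => sq_nonneg _
  nlinarith

end GaussianPoincare

section EvidenceFluctuations
open scoped RealInnerProductSpace ENNReal
variable {Ω D E : Type*} [MeasurableSpace Ω]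
  [NormedAddCommGroup D] [InnerProductSpace ℝ D] [FiniteDimensional ℝ D]
  [MeasurableSpace D] [BorelSpace D]
  [NormedAddCommGroup E] [InnerProductSpace ℝ E] [FiniteDimensional ℝ E]
  [MeasurableSpace E] [BorelSpace E]
variable {W : Ω → D} {V : Ω → E} {κ₁ κ r : ℝ}

/-- The gradient of the joint log-evidence is the posterior mean of the signal. -/
lemma inner_mean_le_log_pairZ_sub (μ : Measure Ω) [IsProbabilityMeasure μ]
    (hW : Measurable W) (hκ₁ : ∀ ω, ‖W ω‖ = κ₁) (hV : Measurable V) (hκ : ∀ ω, ‖V ω‖ = κ)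
    (hr : 0 ≤ r) (s s' : D) (y y' : E) :
    ∫ ω, (⟪s' - s, W ω⟫ + r * ⟪y' - y, V ω⟫) ∂(pairPost μ W V r s y)
      ≤ Real.log (pairZ μ W V r s' y') - Real.log (pairZ μ W V r s y) := by
  set P := pairPost μ W V r s y with hP
  have hPp : IsProbabilityMeasure P := isProbabilityMeasure_pairPost μ hW hκ₁ hV hκ hr s y
  set g : Ω → ℝ := fun ω => ⟪s' - s, W ω⟫ + r * ⟪y' - y, V ω⟫ with hg
  have hgl : ∀ ω, pairLog W V r s' y' ω = pairLog W V r s y ω + g ω := by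
    intro ω
    simp only [pairLog, chLog, hg, one_smul, real_inner_smul_left, inner_sub_left]
    rw [real_inner_comm s', real_inner_comm s, real_inner_comm y', real_inner_comm y]
    ring
  have hgm : Measurable g := by fun_prop
  have hgb : ∀ ω, |g ω| ≤ ‖s' - s‖ * κ₁ + r * (‖y' - y‖ * κ) := by
    intro ω
    refine (abs_add_le _ _).trans ?_
    rw [abs_mul, abs_of_nonneg hr]
    have h1 := abs_real_inner_le_norm (s' - s) (W ω)
    have h2 := abs_real_inner_le_norm (y' - y) (V ω)
    rw [hκ₁] at h1
    rw [hκ] at h2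
    gcongr
  have hgi : Integrable g P := Integrable.of_bound hgm.aestronglyMeasurable _ (ae_of_all _ hgb)
  have hge : Integrable (fun ω => Real.exp (g ω)) P :=
    Integrable.of_bound hgm.exp.aestronglyMeasurable
      (Real.exp (‖s' - s‖ * κ₁ + r * (‖y' - y‖ * κ))) (ae_of_all _ fun ω => by
        rw [Real.norm_of_nonneg (Real.exp_pos _).le]
        exact Real.exp_le_exp.2 ((le_abs_self _).trans (hgb ω)))
  have hfac : pairZ μ W V r s' y' = pairZ μ W V r s y * ∫ ω, Real.exp (g ω) ∂P := by
    rw [hP, pairZ_mul_integral_pairPost μ hW hκ₁ hV hκ hr, pairZ_eq μ hW hκ₁ hV hκ hr]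
    congr 1 with ω
    rw [hgl, Real.exp_add]
  have hZ := pairZ_pos μ hW hκ₁ hV hκ hr s y
  have hpos : 0 < ∫ ω, Real.exp (g ω) ∂P := by
    have := pairZ_pos μ hW hκ₁ hV hκ hr s' y'
    rw [hfac] at this
    exact (mul_pos_iff_of_pos_left hZ).1 this
  rw [hfac, Real.log_mul hZ.ne' hpos.ne', add_sub_cancel_left]
  exact integral_le_log_integral_exp hgi hge

lemma integral_log_pairZ_sub_sq_le (μ : Measure Ω) [IsProbabilityMeasure μ]
    (hW : Measurable W) (hκ₁ : ∀ ω, ‖W ω‖ = κ₁) (hV : Measurable V) (hκ : ∀ ω, ‖V ω‖ = κ)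
    (hr : 0 ≤ r) (s₀ : D) (y₀ : E) {f : ℝ}
    (hf : ∫ x : D × E, Real.log (pairZ μ W V r (x.1 + s₀) (x.2 + y₀))
      ∂((ProbabilityTheory.stdGaussian D).prod (ProbabilityTheory.stdGaussian E)) = f) :
    ∫ x : D × E, (Real.log (pairZ μ W V r (x.1 + s₀) (x.2 + y₀)) - f) ^ 2
      ∂((ProbabilityTheory.stdGaussian D).prod (ProbabilityTheory.stdGaussian E))
      ≤ π ^ 2 * (2 * (κ₁ ^ 2 + r ^ 2 * κ ^ 2)) := by
  have hκ0 := kappa_nonneg μ hκ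
  have hκ10 := kappa_nonneg μ hκ₁
  set γ := (ProbabilityTheory.stdGaussian D).prod (ProbabilityTheory.stdGaussian E) with hγ
  set P : D × E → Measure Ω := fun x => pairPost μ W V r (x.1 + s₀) (x.2 + y₀) with hP
  have hPp : ∀ x, IsProbabilityMeasure (P x) := fun x =>
    isProbabilityMeasure_pairPost μ hW hκ₁ hV hκ hr _ _
  have hWi : ∀ x, Integrable W (P x) := fun x => integrable_of_norm_eq hW hκ₁
  have hVi : ∀ x, Integrable V (P x) := fun x => integrable_of_norm_eq hV hκ
  set B : D × E → D × E → ℝ := fun x z =>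
    ⟪z.1, ∫ ω, W ω ∂(P x)⟫ + r * ⟪z.2, ∫ ω, V ω ∂(P x)⟫ with hBdef
  have hBint : ∀ x z, B x z = ∫ ω, (⟪z.1, W ω⟫ + r * ⟪z.2, V ω⟫) ∂(P x) := by
    intro x z
    rw [integral_add ((hWi x).const_inner _) (((hVi x).const_inner _).const_mul _),
      integral_const_mul, integral_inner (hWi x), integral_inner (hVi x)]
  have hid : ∫ x, x ∂γ = 0 := by
    have h1 : Integrable (fun x : D × E => x) γ :=
      ProbabilityTheory.IsGaussian.integrable_id
    refine Prod.ext ?_ ?_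
    · rw [fst_integral h1, hγ, integral_fun_fst (fun x : D => x)]
      simp [ProbabilityTheory.integral_id_stdGaussian]
    · rw [snd_integral h1, hγ, integral_fun_snd (fun x : E => x)]
      simp [ProbabilityTheory.integral_id_stdGaussian]
  have hBm : Measurable (Function.uncurry B) := by
    have := (measurable_integral_pairPost μ hW hκ₁ hV hκ hr
      (g := fun (z : D × E) ω => ⟪z.1, W ω⟫ + r * ⟪z.2, V ω⟫)
      (by unfold Function.uncurry; fun_prop)).comp
      (by fun_prop : Measurable (fun p : (D × E) × (D × E) =>
        (p.2, p.1.1 + s₀, p.1.2 + y₀)))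
    convert this using 1
    ext p
    exact hBint p.1 p.2
  have hW1 : ∀ x, ‖∫ ω, W ω ∂(P x)‖ ≤ κ₁ := fun x => norm_mean_le hκ₁
  have hV1 : ∀ x, ‖∫ ω, V ω ∂(P x)‖ ≤ κ := fun x => norm_mean_le hκ
  have hres := integral_sub_integral_sq_le (γ := γ) hid
    (L := fun x => Real.log (pairZ μ W V r (x.1 + s₀) (x.2 + y₀))) (B := B)
    (k := κ₁ + r * κ) (K := 2 * (κ₁ ^ 2 + r ^ 2 * κ ^ 2))
    (((measurable_pairZ μ hW hκ₁ hV hκ hr).comp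
      (by fun_prop : Measurable (fun x : D × E => (x.1 + s₀, x.2 + y₀)))).log) hBm
    (fun x y z c d => by
      simp only [hBdef, Prod.fst_add, Prod.snd_add, Prod.smul_fst, Prod.smul_snd,
        inner_add_left, real_inner_smul_left]
      ring)
    (fun x z => by
      refine (abs_add_le _ _).trans ?_
      rw [abs_mul, abs_of_nonneg hr]
      have h1 := abs_real_inner_le_norm z.1 (∫ ω, W ω ∂(P x))
      have h2 := abs_real_inner_le_norm z.2 (∫ ω, V ω ∂(P x))
      have h3 := mul_le_mul (norm_fst_le z) (hW1 x) (norm_nonneg _) (norm_nonneg _)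
      have h4 := mul_le_mul (norm_snd_le z) (hV1 x) (norm_nonneg _) (norm_nonneg _)
      have h5 := mul_le_mul_of_nonneg_left (h2.trans h4) hr
      linarith)
    (fun x y => by
      rw [hBint]
      have := inner_mean_le_log_pairZ_sub μ hW hκ₁ hV hκ hr (x.1 + s₀) (y.1 + s₀)
        (x.2 + y₀) (y.2 + y₀)
      simp only [add_sub_add_right_eq_sub] at this
      exact this)
    (fun x => by
      have i1 : Integrable (fun z : D × E => 2 * ⟪∫ ω, W ω ∂(P x), z.1⟫ ^ 2) γ :=
        ((integrable_inner_sq_stdGaussian _).comp_fst _).const_mul _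
      have i2 : Integrable (fun z : D × E => 2 * r ^ 2 * ⟪∫ ω, V ω ∂(P x), z.2⟫ ^ 2) γ :=
        ((integrable_inner_sq_stdGaussian _).comp_snd _).const_mul _
      refine (integral_mono_of_nonneg (ae_of_all _ fun _ => sq_nonneg _) (i1.add i2)
        (ae_of_all _ fun z => ?_)).trans ?_
      · simp only [hBdef, Pi.add_apply]
        rw [real_inner_comm (∫ ω, W ω ∂(P x)) z.1, real_inner_comm (∫ ω, V ω ∂(P x)) z.2]
        nlinarith [sq_nonneg (⟪∫ ω, W ω ∂(P x), z.1⟫ - r * ⟪∫ ω, V ω ∂(P x), z.2⟫)]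
      · simp only [Pi.add_apply]
        rw [integral_add i1 i2, integral_const_mul, integral_const_mul, hγ,
          integral_fun_fst (fun z => ⟪∫ ω, W ω ∂(P x), z⟫ ^ 2),
          integral_fun_snd (fun z => ⟪∫ ω, V ω ∂(P x), z⟫ ^ 2),
          integral_inner_sq_stdGaussian, integral_inner_sq_stdGaussian]
        simp only [probReal_univ, one_smul]
        have h1 := pow_le_pow_left₀ (norm_nonneg _) (hW1 x) 2
        have h2 := pow_le_pow_left₀ (norm_nonneg _) (hV1 x) 2
        have h3 := mul_le_mul_of_nonneg_left h2 (sq_nonneg r)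
        linarith)
  rw [hf] at hres
  exact hres

/-- If the mean log-evidence does not depend on the signal, its fluctuations are bounded by the
signal strength. -/
lemma pairW_le (μ : Measure Ω) [IsProbabilityMeasure μ]
    (hW : Measurable W) (hκ₁ : ∀ ω, ‖W ω‖ = κ₁) (hV : Measurable V) (hκ : ∀ ω, ‖V ω‖ = κ)
    (hr : 0 ≤ r) {f : ℝ}
    (hf : ∀ ω, ∫ x : D × E, Real.log (pairZ μ W V r (x.1 + W ω) (x.2 + r • V ω))
      ∂((ProbabilityTheory.stdGaussian D).prod (ProbabilityTheory.stdGaussian E)) = f) :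
    pairW μ W V r f ≤ π ^ 2 * (2 * (κ₁ ^ 2 + r ^ 2 * κ ^ 2)) := by
  have h := pairW_eq μ hW hκ₁ hV hκ hr f
  have hi := h.2.1
  rw [← h.2.2]
  rw [pairLaw] at hi ⊢
  rw [integral_prod _ hi]
  calc _ ≤ ∫ _ : Ω, π ^ 2 * (2 * (κ₁ ^ 2 + r ^ 2 * κ ^ 2)) ∂μ :=
        integral_mono hi.integral_prod_left (integrable_const _) fun ω =>
          integral_log_pairZ_sub_sq_le μ hW hκ₁ hV hκ hr (W ω) (r • V ω) (hf ω)
    _ = _ := by simp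

/-- The mean log-evidence is invariant under symmetries of the prior acting isometrically. -/
lemma integral_log_pairZ_eq_of_isometry (μ : Measure Ω) [IsProbabilityMeasure μ]
    (hW : Measurable W) (hκ₁ : ∀ ω, ‖W ω‖ = κ₁) (hV : Measurable V) (hκ : ∀ ω, ‖V ω‖ = κ)
    (hr : 0 ≤ r) {τ : Ω → Ω} (hτ : MeasurePreserving τ μ μ) (S : D ≃ₗᵢ[ℝ] D) (T : E ≃ₗᵢ[ℝ] E)
    (hS : ∀ ω, W (τ ω) = S (W ω)) (hT : ∀ ω, V (τ ω) = T (V ω)) (ω : Ω) :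
    ∫ x : D × E, Real.log (pairZ μ W V r (x.1 + W (τ ω)) (x.2 + r • V (τ ω)))
        ∂((ProbabilityTheory.stdGaussian D).prod (ProbabilityTheory.stdGaussian E))
      = ∫ x : D × E, Real.log (pairZ μ W V r (x.1 + W ω) (x.2 + r • V ω))
        ∂((ProbabilityTheory.stdGaussian D).prod (ProbabilityTheory.stdGaussian E)) := by
  have hZ : ∀ s y, pairZ μ W V r (S s) (T y) = pairZ μ W V r s y := by
    intro s y
    rw [pairZ_eq μ hW hκ₁ hV hκ hr, pairZ_eq μ hW hκ₁ hV hκ hr]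
    have hm : Measurable (fun ω => Real.exp (pairLog W V r (S s) (T y) ω)) :=
      ((measurable_pairLog hW hV r).comp (measurable_prodMk_left (x := (S s, T y)))).exp
    conv_lhs => rw [← hτ.map_eq]
    rw [integral_map hτ.measurable.aemeasurable hm.aestronglyMeasurable]
    congr 1 with ω
    simp only [pairLog, chLog, hS, hT, ← map_smul, LinearIsometryEquiv.inner_map_map,
      LinearIsometryEquiv.norm_map]
  have hST : MeasurePreserving (fun x : D × E => (S x.1, T x.2))
      ((ProbabilityTheory.stdGaussian D).prod (ProbabilityTheory.stdGaussian E))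
      ((ProbabilityTheory.stdGaussian D).prod (ProbabilityTheory.stdGaussian E)) :=
    MeasurePreserving.prod
      ⟨S.continuous.measurable, ProbabilityTheory.stdGaussian_map S⟩
      ⟨T.continuous.measurable, ProbabilityTheory.stdGaussian_map T⟩
  have hm : Measurable (fun x : D × E =>
      Real.log (pairZ μ W V r (x.1 + W (τ ω)) (x.2 + r • V (τ ω)))) :=
    ((measurable_pairZ μ hW hκ₁ hV hκ hr).comp
      (by fun_prop : Measurable (fun x : D × E => (x.1 + W (τ ω), x.2 + r • V (τ ω))))).log
  conv_lhs => rw [← hST.map_eq]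
  rw [integral_map hST.measurable.aemeasurable hm.aestronglyMeasurable]
  congr 1 with x
  rw [hS, hT, ← map_smul, ← map_add, ← map_add, hZ]

end EvidenceFluctuations

section OrthogonalMatrices
open Matrix
variable {ι κ : Type*} [Fintype ι] [DecidableEq ι] [Fintype κ] [DecidableEq κ]

lemma dotProduct_orthogonal_mulVec {O : Matrix ι ι ℝ} (hO : O ∈ orthogonalGroup ι ℝ)
    (x y : ι → ℝ) : O *ᵥ x ⬝ᵥ O *ᵥ y = x ⬝ᵥ y := by
  have h : Oᵀ * O = 1 := (mem_orthogonalGroup_iff' ι ℝ).1 hO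
  rw [dotProduct_mulVec, vecMul_mulVec, ← dotProduct_mulVec, h, one_mulVec]

/-- Two vectors of the same length are exchanged by an orthogonal matrix. -/
lemma exists_orthogonal_mulVec_eq {u u' : ι → ℝ} (h : u ⬝ᵥ u = u' ⬝ᵥ u') :
    ∃ O ∈ orthogonalGroup ι ℝ, O *ᵥ u = u' := by
  by_cases hu : u = u'
  · exact ⟨1, one_mem _, by rw [one_mulVec, hu]⟩
  set w := u - u' with hw
  have hw0 : w ⬝ᵥ w ≠ 0 := fun h0 => hu (sub_eq_zero.1 (dotProduct_self_eq_zero.1 h0))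
  have hwu : 2 * (w ⬝ᵥ u) = w ⬝ᵥ w := by
    simp only [hw, sub_dotProduct, dotProduct_sub, dotProduct_comm u' u]
    linarith
  refine ⟨1 - (2 / (w ⬝ᵥ w)) • vecMulVec w w, ?_, ?_⟩
  · rw [mem_orthogonalGroup_iff]
    change _ * (1 - (2 / (w ⬝ᵥ w)) • vecMulVec w w)ᵀ = 1
    rw [transpose_sub, transpose_one, transpose_smul, transpose_vecMulVec, sub_mul, mul_sub,
      mul_sub, one_mul, one_mul, mul_one, smul_mul_smul_comm, vecMulVec_mul_vecMulVec,
      vecMulVec_smul, smul_smul]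
    have : 2 / (w ⬝ᵥ w) * (2 / (w ⬝ᵥ w)) * (w ⬝ᵥ w) = 2 * (2 / (w ⬝ᵥ w)) := by
      field_simp
    rw [this, two_mul, add_smul]
    abel
  · rw [sub_mulVec, one_mulVec, smul_mulVec, vecMulVec_mulVec]
    have : (2 / (w ⬝ᵥ w)) * (w ⬝ᵥ u) = 1 := by
      rw [div_mul_eq_mul_div, hwu, div_self hw0]
    ext i
    have h2 := congrArg (· * w i) this
    simp [hw] at h2 ⊢
    linarith

/-- Orthogonal matrices act isometrically on Euclidean space. -/
lemma exists_linearIsometryEquiv_of_orthogonal {O : Matrix ι ι ℝ}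
    (hO : O ∈ orthogonalGroup ι ℝ) :
    ∃ S : EuclideanSpace ℝ ι ≃ₗᵢ[ℝ] EuclideanSpace ℝ ι,
      ∀ x : ι → ℝ, S (WithLp.toLp 2 x) = WithLp.toLp 2 (O *ᵥ x) := by
  let L : EuclideanSpace ℝ ι →ₗᵢ[ℝ] EuclideanSpace ℝ ι :=
    ⟨Matrix.toEuclideanLin O, fun x => by
      rw [← sq_eq_sq₀ (norm_nonneg _) (norm_nonneg _), EuclideanSpace.real_norm_sq_eq,
        EuclideanSpace.real_norm_sq_eq]
      have := dotProduct_orthogonal_mulVec hO x.ofLp x.ofLp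
      simp only [dotProduct, ← pow_two] at this
      exact this⟩
  exact ⟨L.toLinearIsometryEquiv rfl, fun x => rfl⟩

lemma fromBlocks_kronecker_mem_orthogonalGroup {A : Matrix ι ι ℝ} {B : Matrix κ κ ℝ}
    (hA : A ∈ orthogonalGroup ι ℝ) (hB : B ∈ orthogonalGroup κ ℝ) :
    fromBlocks (kroneckerMap (· * ·) A B) 0 0 A ∈ orthogonalGroup ((ι × κ) ⊕ ι) ℝ := by
  have hAB : kroneckerMap (· * ·) A B ∈ orthogonalGroup (ι × κ) ℝ :=
    Matrix.kronecker_mem_unitary hA hB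
  rw [mem_orthogonalGroup_iff] at hA hAB ⊢
  rw [fromBlocks_transpose, fromBlocks_multiply]
  simp [hA, hAB]

end OrthogonalMatrices

section SphereModel
open Matrix
open scoped RealInnerProductSpace

/-- Vectors of squared length `c`. -/
abbrev SphereVec (n : ℕ) (c : ℝ) : Type := {x : Fin n → ℝ // x ⬝ᵥ x = c}

/-- A measure on `ℝⁿ`, seen on the sphere of squared radius `c`. -/
def sphereLaw (n : ℕ) (c : ℝ) (P : Measure (Fin n → ℝ)) : Measure (SphereVec n c) :=
  P.comap Subtype.val

lemma measurableEmbedding_sphereVec (n : ℕ) (c : ℝ) :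
    MeasurableEmbedding (Subtype.val : SphereVec n c → (Fin n → ℝ)) :=
  MeasurableEmbedding.subtype_coe
    (measurableSet_eq_fun (by unfold dotProduct; fun_prop) measurable_const)

lemma measurePreserving_sphereLaw {n : ℕ} {c : ℝ} (hc : 0 ≤ c) {P : Measure (Fin n → ℝ)}
    (hP : IsUniformSphere n (√c) P) : MeasurePreserving Subtype.val (sphereLaw n c P) P := by
  refine ⟨measurable_subtype_coe, ?_⟩
  rw [sphereLaw, (measurableEmbedding_sphereVec n c).map_comap, Subtype.range_coe_subtype]
  refine Measure.restrict_eq_self_of_ae_mem ?_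
  filter_upwards [hP.2.1] with x hx
  rw [Real.sq_sqrt hc] at hx
  simpa only [dotProduct, ← pow_two, mem_ofPred_eq] using hx

lemma isProbabilityMeasure_sphereLaw {n : ℕ} {c : ℝ} (hc : 0 ≤ c) {P : Measure (Fin n → ℝ)}
    (hP : IsUniformSphere n (√c) P) : IsProbabilityMeasure (sphereLaw n c P) := by
  have h := measurePreserving_sphereLaw hc hP
  have hp := hP.1
  refine ⟨?_⟩
  rw [← preimage_univ (f := Subtype.val), h.measure_preimage nullMeasurableSet_univ, measure_univ]

lemma integral_sphereLaw {n : ℕ} {c : ℝ} (hc : 0 ≤ c) {P : Measure (Fin n → ℝ)}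
    (hP : IsUniformSphere n (√c) P) (f : (Fin n → ℝ) → ℝ) :
    ∫ x, f x.1 ∂(sphereLaw n c P) = ∫ x, f x ∂P :=
  (measurePreserving_sphereLaw hc hP).integral_comp (measurableEmbedding_sphereVec n c) f

/-- The action of an orthogonal matrix on a sphere. -/
def sphereRot {n : ℕ} {c : ℝ} {O : Matrix (Fin n) (Fin n) ℝ}
    (hO : O ∈ orthogonalGroup (Fin n) ℝ) (x : SphereVec n c) : SphereVec n c :=
  ⟨O *ᵥ x.1, by rw [dotProduct_orthogonal_mulVec hO, x.2]⟩

lemma measurePreserving_sphereRot {n : ℕ} {c : ℝ} (hc : 0 ≤ c) {P : Measure (Fin n → ℝ)}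
    (hP : IsUniformSphere n (√c) P) {O : Matrix (Fin n) (Fin n) ℝ}
    (hO : O ∈ orthogonalGroup (Fin n) ℝ) :
    MeasurePreserving (sphereRot hO) (sphereLaw n c P) (sphereLaw n c P) := by
  have hv := measurePreserving_sphereLaw hc hP
  have hOm : Measurable (fun x : Fin n → ℝ => O *ᵥ x) := by
    unfold mulVec dotProduct
    fun_prop
  have hm : Measurable (sphereRot (c := c) hO) :=
    (hOm.comp measurable_subtype_coe).subtype_mk
  refine ⟨hm, ?_⟩
  have he := measurableEmbedding_sphereVec n c
  rw [← he.comap_map ((sphereLaw n c P).map (sphereRot hO)), Measure.map_map he.measurable hm]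
  have : (Subtype.val ∘ sphereRot (c := c) hO) = (fun x => O *ᵥ x) ∘ Subtype.val := rfl
  rw [this, ← Measure.map_map hOm he.measurable, hv.map_eq, hP.2.2 O hO]
  rfl

variable {p q : ℕ} {a b : ℝ}

/-- The signal of the joint observation of `u vᵀ` and `u`. -/
def matSignal (c₁ c₂ : ℝ) (ω : SphereVec p a × SphereVec q b) :
    EuclideanSpace ℝ ((Fin p × Fin q) ⊕ Fin p) :=
  WithLp.toLp 2 (Sum.elim (fun k => c₁ * (ω.1.1 k.1 * ω.2.1 k.2)) (fun i => c₂ * ω.1.1 i))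

/-- The signal `v`. -/
def vecSignal (ω : SphereVec p a × SphereVec q b) : EuclideanSpace ℝ (Fin q) :=
  WithLp.toLp 2 ω.2.1

lemma measurable_matSignal (c₁ c₂ : ℝ) :
    Measurable (matSignal c₁ c₂ : SphereVec p a × SphereVec q b → _) := by
  refine (WithLp.measurable_toLp 2 _).comp (measurable_pi_lambda _ fun k => ?_)
  have hu : ∀ i, Measurable (fun ω : SphereVec p a × SphereVec q b => ω.1.1 i) := fun i =>
    (measurable_pi_apply i).comp (measurable_subtype_coe.comp measurable_fst)
  have hv : ∀ i, Measurable (fun ω : SphereVec p a × SphereVec q b => ω.2.1 i) := fun i =>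
    (measurable_pi_apply i).comp (measurable_subtype_coe.comp measurable_snd)
  rcases k with k | k
  · exact ((hu k.1).mul (hv k.2)).const_mul c₁
  · exact (hu k).const_mul c₂

lemma measurable_vecSignal :
    Measurable (vecSignal : SphereVec p a × SphereVec q b → _) :=
  (WithLp.measurable_toLp 2 _).comp (by fun_prop)

lemma sum_sq_sphereVec {n : ℕ} {c : ℝ} (x : SphereVec n c) : ∑ i, x.1 i ^ 2 = c := by
  have := x.2
  simpa only [dotProduct, ← pow_two] using this

lemma norm_sq_matSignal (c₁ c₂ : ℝ) (ω : SphereVec p a × SphereVec q b) :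
    ‖matSignal c₁ c₂ ω‖ ^ 2 = c₁ ^ 2 * (a * b) + c₂ ^ 2 * a := by
  rw [EuclideanSpace.real_norm_sq_eq, Fintype.sum_sum_type, Fintype.sum_prod_type]
  simp only [matSignal, Sum.elim_inl, Sum.elim_inr, mul_pow, ← Finset.mul_sum, sum_sq_sphereVec,
    ← Finset.sum_mul]

lemma norm_matSignal (c₁ c₂ : ℝ) (ω : SphereVec p a × SphereVec q b) :
    ‖matSignal c₁ c₂ ω‖ = √(c₁ ^ 2 * (a * b) + c₂ ^ 2 * a) := by
  rw [← norm_sq_matSignal c₁ c₂ ω, Real.sqrt_sq (norm_nonneg _)]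

lemma norm_sq_vecSignal (ω : SphereVec p a × SphereVec q b) : ‖vecSignal ω‖ ^ 2 = b := by
  rw [EuclideanSpace.real_norm_sq_eq]
  exact sum_sq_sphereVec ω.2

lemma norm_vecSignal (ω : SphereVec p a × SphereVec q b) : ‖vecSignal ω‖ = √b := by
  rw [← Real.sqrt_sq (norm_nonneg (vecSignal ω)), norm_sq_vecSignal]

/-- The mean log-evidence of the joint model does not depend on the signal. -/
lemma integral_log_pairZ_sphere_eq (c₁ c₂ : ℝ) {r : ℝ} (hr : 0 ≤ r) (ha : 0 ≤ a) (hb : 0 ≤ b)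
    {Pu : Measure (Fin p → ℝ)} {Pv : Measure (Fin q → ℝ)}
    (hPu : IsUniformSphere p (√a) Pu) (hPv : IsUniformSphere q (√b) Pv)
    (ω ω' : SphereVec p a × SphereVec q b) :
    ∫ x, Real.log (pairZ ((sphereLaw p a Pu).prod (sphereLaw q b Pv)) (matSignal c₁ c₂)
        vecSignal r (x.1 + matSignal c₁ c₂ ω') (x.2 + r • vecSignal ω'))
        ∂((ProbabilityTheory.stdGaussian (EuclideanSpace ℝ ((Fin p × Fin q) ⊕ Fin p))).prod
          (ProbabilityTheory.stdGaussian (EuclideanSpace ℝ (Fin q))))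
      = ∫ x, Real.log (pairZ ((sphereLaw p a Pu).prod (sphereLaw q b Pv)) (matSignal c₁ c₂)
        vecSignal r (x.1 + matSignal c₁ c₂ ω) (x.2 + r • vecSignal ω))
        ∂((ProbabilityTheory.stdGaussian (EuclideanSpace ℝ ((Fin p × Fin q) ⊕ Fin p))).prod
          (ProbabilityTheory.stdGaussian (EuclideanSpace ℝ (Fin q)))) := by
  have hp1 := isProbabilityMeasure_sphereLaw ha hPu
  have hp2 := isProbabilityMeasure_sphereLaw hb hPv
  obtain ⟨A, hA, hAu⟩ := exists_orthogonal_mulVec_eq (ω.1.2.trans ω'.1.2.symm)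
  obtain ⟨B, hB, hBv⟩ := exists_orthogonal_mulVec_eq (ω.2.2.trans ω'.2.2.symm)
  obtain ⟨S, hS⟩ := exists_linearIsometryEquiv_of_orthogonal
    (fromBlocks_kronecker_mem_orthogonalGroup hA hB)
  obtain ⟨T, hT⟩ := exists_linearIsometryEquiv_of_orthogonal hB
  have hω : ω' = Prod.map (sphereRot hA) (sphereRot hB) ω :=
    Prod.ext (Subtype.ext hAu.symm) (Subtype.ext hBv.symm)
  rw [hω]
  refine integral_log_pairZ_eq_of_isometry _ (measurable_matSignal c₁ c₂) (norm_matSignal c₁ c₂)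
    measurable_vecSignal norm_vecSignal hr
    ((measurePreserving_sphereRot ha hPu hA).prod (measurePreserving_sphereRot hb hPv hB))
    S T (fun ω => ?_) (fun ω => ?_) ω
  · rw [matSignal, matSignal, hS, fromBlocks_mulVec]
    congr 1
    ext k
    rcases k with ⟨i, j⟩ | i
    · simp only [Sum.elim_inl, zero_mulVec, add_zero]
      simp only [mulVec, dotProduct, Fintype.sum_prod_type, Function.comp_def, Sum.elim_inl,
        kroneckerMap_apply, Prod.map, sphereRot]
      rw [Finset.sum_mul_sum, Finset.mul_sum]
      refine Finset.sum_congr rfl fun k _ => ?_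
      rw [Finset.mul_sum]
      refine Finset.sum_congr rfl fun l _ => ?_
      ring
    · simp only [Sum.elim_inr, zero_mulVec, zero_add]
      simp only [mulVec, dotProduct, Function.comp_def, Sum.elim_inr, Prod.map, sphereRot]
      rw [Finset.mul_sum]
      refine Finset.sum_congr rfl fun k _ => ?_
      ring
  · rw [vecSignal, vecSignal, hT]
    rfl

end SphereModel

section GibbsModel
open Matrix
open scoped RealInnerProductSpace
variable {p q : ℕ} {a b : ℝ}

/-- The two Gaussian noises of the joint observation, as one Euclidean vector. -/
def matNoise (z : (Fin p → Fin q → ℝ) × (Fin p → ℝ)) :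
    EuclideanSpace ℝ ((Fin p × Fin q) ⊕ Fin p) :=
  WithLp.toLp 2 (Sum.elim (fun k => z.1 k.1 k.2) z.2)

instance (n : ℕ) : IsProbabilityMeasure (stdGaussian n) := by
  unfold stdGaussian
  infer_instance

instance (p q : ℕ) : IsProbabilityMeasure (stdGaussianMat p q) := by
  unfold stdGaussianMat
  infer_instance

lemma measurePreserving_matNoise :
    MeasurePreserving (matNoise : (Fin p → Fin q → ℝ) × (Fin p → ℝ) → _)
      ((stdGaussianMat p q).prod (stdGaussian p))
      (ProbabilityTheory.stdGaussian (EuclideanSpace ℝ ((Fin p × Fin q) ⊕ Fin p))) := by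
  have hm : Measurable (fun z : (Fin p → Fin q → ℝ) × (Fin p → ℝ) =>
      (Sum.elim (fun k => z.1 k.1 k.2) z.2 : (Fin p × Fin q) ⊕ Fin p → ℝ)) := by
    refine measurable_pi_lambda _ fun k => ?_
    rcases k with k | k <;> simp only [Sum.elim_inl, Sum.elim_inr] <;> fun_prop
  have hpi : ((stdGaussianMat p q).prod (stdGaussian p)).map
      (fun z => (Sum.elim (fun k => z.1 k.1 k.2) z.2 : (Fin p × Fin q) ⊕ Fin p → ℝ))
      = Measure.pi fun _ => ProbabilityTheory.gaussianReal 0 1 := by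
    refine (Measure.pi_eq fun s hs => ?_).symm
    rw [Measure.map_apply hm (MeasurableSet.univ_pi hs)]
    have : (fun z : (Fin p → Fin q → ℝ) × (Fin p → ℝ) =>
        (Sum.elim (fun k => z.1 k.1 k.2) z.2 : (Fin p × Fin q) ⊕ Fin p → ℝ)) ⁻¹' univ.pi s
        = (univ.pi fun i => univ.pi fun j => s (Sum.inl (i, j))) ×ˢ
          (univ.pi fun i => s (Sum.inr i)) := by
      ext z
      simp [Set.mem_pi]
    rw [this, Measure.prod_prod, stdGaussianMat, Measure.pi_pi, stdGaussian, stdGaussian,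
      Measure.pi_pi, Fintype.prod_sum_type, Fintype.prod_prod_type]
    simp only [Measure.pi_pi]
  refine ⟨(WithLp.measurable_toLp 2 _).comp hm, ?_⟩
  rw [← ProbabilityTheory.map_pi_eq_stdGaussian, ← hpi,
    Measure.map_map (WithLp.measurable_toLp 2 _) hm]
  rfl

lemma measurePreserving_toLp_stdGaussian :
    MeasurePreserving (WithLp.toLp 2 : (Fin q → ℝ) → EuclideanSpace ℝ (Fin q))
      (stdGaussian q) (ProbabilityTheory.stdGaussian (EuclideanSpace ℝ (Fin q))) :=
  ⟨WithLp.measurable_toLp 2 _, ProbabilityTheory.map_pi_eq_stdGaussian⟩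

lemma integral_integral_sphereLaw (ha : 0 ≤ a) (hb : 0 ≤ b)
    {Pu : Measure (Fin p → ℝ)} {Pv : Measure (Fin q → ℝ)}
    (hPu : IsUniformSphere p (√a) Pu) (hPv : IsUniformSphere q (√b) Pv)
    (G : (Fin p → ℝ) → (Fin q → ℝ) → ℝ) :
    ∫ u, ∫ v, G u v ∂Pv ∂Pu
      = ∫ u, ∫ v, G u.1 v.1 ∂(sphereLaw q b Pv) ∂(sphereLaw p a Pu) := by
  rw [← integral_sphereLaw ha hPu]
  congr 1 with u
  rw [← integral_sphereLaw hb hPv]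

/-- The expectation over the signals and noises, as an integral over the pair-channel law. -/
lemma Efull_eq_integral_pairLaw (ha : 0 ≤ a) (hb : 0 ≤ b)
    {Pu : Measure (Fin p → ℝ)} {Pv : Measure (Fin q → ℝ)}
    (hPu : IsUniformSphere p (√a) Pu) (hPv : IsUniformSphere q (√b) Pv)
    {g : (Fin p → ℝ) → (Fin q → ℝ) → (Fin p → Fin q → ℝ) → (Fin p → ℝ) → (Fin q → ℝ) → ℝ}
    {F : (SphereVec p a × SphereVec q b) × EuclideanSpace ℝ ((Fin p × Fin q) ⊕ Fin p) ×
      EuclideanSpace ℝ (Fin q) → ℝ} (hF : Measurable F) {C : ℝ} (hC : ∀ x, |F x| ≤ C)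
    (hg : ∀ (ω : SphereVec p a × SphereVec q b) Z Zt Zb,
      g ω.1.1 ω.2.1 Z Zt Zb = F (ω, matNoise (Z, Zt), WithLp.toLp 2 Zb)) :
    Efull p q Pu Pv g = ∫ x, F x ∂(pairLaw ((sphereLaw p a Pu).prod (sphereLaw q b Pv))
      (EuclideanSpace ℝ ((Fin p × Fin q) ⊕ Fin p)) (EuclideanSpace ℝ (Fin q))) := by
  have hp1 := isProbabilityMeasure_sphereLaw ha hPu
  have hp2 := isProbabilityMeasure_sphereLaw hb hPv
  have hN := (measurePreserving_matNoise (p := p) (q := q)).prod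
    (measurePreserving_toLp_stdGaussian (q := q))
  have hint : ∀ {X : Type} [MeasurableSpace X] (ν : Measure X) [IsProbabilityMeasure ν]
      {f : X → ℝ}, Measurable f → (∀ x, |f x| ≤ C) → Integrable f ν :=
    fun ν _ f hf hfC => Integrable.of_bound hf.aestronglyMeasurable C (ae_of_all _ hfC)
  rw [pairLaw, integral_prod _ (hint _ hF hC), integral_prod _ (hint _ hF hC).integral_prod_left,
    Efull, integral_integral_sphereLaw ha hb hPu hPv]
  congr 1 with u
  congr 1 with v
  have hFω : Measurable (fun y => F ((u, v), y)) := hF.comp measurable_prodMk_left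
  rw [← hN.map_eq, integral_map hN.measurable.aemeasurable hFω.aestronglyMeasurable]
  have hFn : Measurable (fun z : ((Fin p → Fin q → ℝ) × (Fin p → ℝ)) × (Fin q → ℝ) =>
      F ((u, v), Prod.map matNoise (WithLp.toLp 2) z)) := hFω.comp hN.measurable
  rw [integral_prod _ (hint _ hFn fun _ => hC _),
    integral_prod _ (hint _ hFn fun _ => hC _).integral_prod_left]
  congr 1 with Z
  congr 1 with Zt
  congr 1 with Zb
  exact hg (u, v) Z Zt Zb

/-- The Hamiltonian is minus the log-likelihood of the joint observation. -/
lemma neg_interpH_eq_pairLog (n : ℕ) {au av t Ru Rv : ℝ} (ht : 0 ≤ (1 - t) / n)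
    (hv : 0 ≤ av * Rv) (hu : 0 ≤ au * Ru) (ω ω' : SphereVec p a × SphereVec q b)
    (Z : Fin p → Fin q → ℝ) (Zt : Fin p → ℝ) (Zb : Fin q → ℝ) :
    -(interpH n p q au av t Ru Rv ω.1.1 ω.2.1 Z Zt Zb ω'.1.1 ω'.2.1)
      = pairLog (matSignal (√((1 - t) / n)) (√(av * Rv))) vecSignal (√(au * Ru))
        (matNoise (Z, Zt) + matSignal (√((1 - t) / n)) (√(av * Rv)) ω)
        (WithLp.toLp 2 Zb + √(au * Ru) • vecSignal ω) ω' := by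
  have e1 : (1 - t) / (2 * n) = √((1 - t) / n) ^ 2 / 2 := by
    rw [Real.sq_sqrt ht, div_div, mul_comm (n : ℝ)]
  have e2 : av * Rv = √(av * Rv) ^ 2 := (Real.sq_sqrt hv).symm
  have e3 : au * Ru = √(au * Ru) ^ 2 := (Real.sq_sqrt hu).symm
  have e2' : av * Rv / 2 = √(av * Rv) ^ 2 / 2 := by rw [← e2]
  have e3' : au * Ru / 2 = √(au * Ru) ^ 2 / 2 := by rw [← e3]
  rw [interpH, e1, e2', e3']
  generalize √((1 - t) / n) = c₁
  generalize √(av * Rv) = c₂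
  generalize √(au * Ru) = r
  simp only [pairLog, chLog, one_smul, EuclideanSpace.real_norm_sq_eq, PiLp.inner_apply,
    Fintype.sum_sum_type, Fintype.sum_prod_type, matSignal, vecSignal, matNoise, PiLp.add_apply,
    PiLp.smul_apply, Sum.elim_inl, Sum.elim_inr, RCLike.inner_apply, conj_trivial, smul_eq_mul,
    neg_add, ← Finset.sum_neg_distrib]
  have h1 : ∑ i, ∑ j, -(c₁ ^ 2 / 2 * ω'.1.1 i ^ 2 * ω'.2.1 j ^ 2
        - c₁ * ω'.1.1 i * ω'.2.1 j * (c₁ * ω.1.1 i * ω.2.1 j + Z i j))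
      = ∑ i, ∑ j, (Z i j + c₁ * (ω.1.1 i * ω.2.1 j)) * (c₁ * (ω'.1.1 i * ω'.2.1 j))
        - (∑ i, ∑ j, (c₁ * (ω'.1.1 i * ω'.2.1 j)) ^ 2) / 2 := by
    simp only [Finset.sum_div, ← Finset.sum_sub_distrib]
    refine Finset.sum_congr rfl fun i _ => Finset.sum_congr rfl fun j _ => ?_
    ring
  have h2 : ∑ i, -(c₂ ^ 2 / 2 * ω'.1.1 i ^ 2 - c₂ * ω'.1.1 i * (c₂ * ω.1.1 i + Zt i))
      = ∑ i, (Zt i + c₂ * ω.1.1 i) * (c₂ * ω'.1.1 i) - (∑ i, (c₂ * ω'.1.1 i) ^ 2) / 2 := by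
    simp only [Finset.sum_div, ← Finset.sum_sub_distrib]
    refine Finset.sum_congr rfl fun i _ => ?_
    ring
  have h3 : ∑ j, -(r ^ 2 / 2 * ω'.2.1 j ^ 2 - r * ω'.2.1 j * (r * ω.2.1 j + Zb j))
      = ∑ j, (Zb j + r * ω.2.1 j) * (r * ω'.2.1 j) - (∑ j, (r * ω'.2.1 j) ^ 2) / 2 := by
    simp only [Finset.sum_div, ← Finset.sum_sub_distrib]
    refine Finset.sum_congr rfl fun i _ => ?_
    ring
  rw [h1, h2, h3]
  ring

/-- The Gibbs bracket is the posterior mean of the joint observation. -/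
lemma gibbs_eq_integral_pairPost (n : ℕ) {au av t Ru Rv : ℝ} (ht : 0 ≤ (1 - t) / n)
    (hv : 0 ≤ av * Rv) (hu : 0 ≤ au * Ru) (ha : 0 ≤ a) (hb : 0 ≤ b)
    {Pu : Measure (Fin p → ℝ)} {Pv : Measure (Fin q → ℝ)}
    (hPu : IsUniformSphere p (√a) Pu) (hPv : IsUniformSphere q (√b) Pv)
    {h : (Fin q → ℝ) → ℝ} (hm : Measurable h) {C : ℝ} (hC : ∀ v : SphereVec q b, |h v.1| ≤ C)
    (ω : SphereVec p a × SphereVec q b)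
    (Z : Fin p → Fin q → ℝ) (Zt : Fin p → ℝ) (Zb : Fin q → ℝ) :
    gibbs n p q au av t Ru Rv Pu Pv ω.1.1 ω.2.1 Z Zt Zb (fun _ v => h v)
      = ∫ ω', h ω'.2.1 ∂(pairPost ((sphereLaw p a Pu).prod (sphereLaw q b Pv))
        (matSignal (√((1 - t) / n)) (√(av * Rv))) vecSignal (√(au * Ru))
        (matNoise (Z, Zt) + matSignal (√((1 - t) / n)) (√(av * Rv)) ω)
        (WithLp.toLp 2 Zb + √(au * Ru) • vecSignal ω)) := by
  have hp1 := isProbabilityMeasure_sphereLaw ha hPu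
  have hp2 := isProbabilityMeasure_sphereLaw hb hPv
  set W : SphereVec p a × SphereVec q b → _ := matSignal (√((1 - t) / n)) (√(av * Rv))
  set r := √(au * Ru)
  have hW : Measurable W := measurable_matSignal _ _
  have hV : Measurable (vecSignal : SphereVec p a × SphereVec q b → _) := measurable_vecSignal
  have hexp : ∀ s y, Integrable (fun ω' => Real.exp (pairLog W vecSignal r s y ω'))
      ((sphereLaw p a Pu).prod (sphereLaw q b Pv)) := fun s y =>
    Integrable.of_bound
      ((measurable_pairLog hW hV r).comp (measurable_prodMk_left (x := (s, y)))).exp.aestronglyMeasurable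
      (Real.exp ((1 * √_ * ‖s‖ + 1 ^ 2 * √_ ^ 2 / 2) + (r * √b * ‖y‖ + r ^ 2 * √b ^ 2 / 2)))
      (ae_of_all _ fun ω' => by
        rw [Real.norm_of_nonneg (Real.exp_pos _).le]
        exact Real.exp_le_exp.2 (add_le_add
          ((le_abs_self _).trans (abs_chLog_le (norm_matSignal _ _) zero_le_one s ω'))
          ((le_abs_self _).trans (abs_chLog_le norm_vecSignal (Real.sqrt_nonneg _) y ω'))))
  rw [integral_pairPost_eq_div _ hW (norm_matSignal _ _) hV norm_vecSignal (Real.sqrt_nonneg _),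
    gibbs, partFun, integral_integral_sphereLaw ha hb hPu hPv,
    integral_integral_sphereLaw ha hb hPu hPv, integral_prod _ (hexp _ _), integral_prod]
  · congr 1
    · congr 1 with u
      congr 1 with v
      rw [mul_comm, neg_interpH_eq_pairLog n ht hv hu ω (u, v)]
    · congr 1 with u
      congr 1 with v
      rw [neg_interpH_eq_pairLog n ht hv hu ω (u, v)]
  · exact (hexp _ _).mul_bdd (c := C) (hm.comp (measurable_subtype_coe.comp measurable_snd)).aestronglyMeasurable
      (ae_of_all _ fun ω' => hC ω'.2)

end GibbsModel

section PairPosteriorIntegrals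
open scoped RealInnerProductSpace
variable {Ω D E : Type*} [MeasurableSpace Ω]
  [NormedAddCommGroup D] [InnerProductSpace ℝ D] [FiniteDimensional ℝ D]
  [MeasurableSpace D] [BorelSpace D]
  [NormedAddCommGroup E] [InnerProductSpace ℝ E] [FiniteDimensional ℝ E]
  [MeasurableSpace E] [BorelSpace E]
variable {W : Ω → D} {V : Ω → E} {κ₁ κ r : ℝ}

lemma measurable_integral_pairPost_shift (μ : Measure Ω) [IsProbabilityMeasure μ]
    (hW : Measurable W) (hκ₁ : ∀ ω, ‖W ω‖ = κ₁) (hV : Measurable V) (hκ : ∀ ω, ‖V ω‖ = κ)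
    (hr : 0 ≤ r) {φ : ℝ → ℝ} (hφ : Measurable φ) :
    Measurable (fun x : Ω × D × E => ∫ ω, φ ⟪V x.1, V ω⟫
      ∂(pairPost μ W V r (x.2.1 + W x.1) (x.2.2 + r • V x.1))) := by
  have hg : Measurable (Function.uncurry fun ω ω' => φ ⟪V ω, V ω'⟫) :=
    hφ.comp ((hV.comp measurable_fst).inner (hV.comp measurable_snd))
  have hs : Measurable (fun x : Ω × D × E => (x.1, x.2.1 + W x.1, x.2.2 + r • V x.1)) := by
    fun_prop
  have h := (measurable_integral_pairPost μ hW hκ₁ hV hκ hr hg).comp hs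
  simpa only [Function.comp_def] using h

lemma abs_integral_pairPost_le (μ : Measure Ω) [IsProbabilityMeasure μ]
    (hW : Measurable W) (hκ₁ : ∀ ω, ‖W ω‖ = κ₁) (hV : Measurable V) (hκ : ∀ ω, ‖V ω‖ = κ)
    (hr : 0 ≤ r) (s : D) (y : E) {f : Ω → ℝ} {C : ℝ} (hf : ∀ ω, |f ω| ≤ C) :
    |∫ ω, f ω ∂(pairPost μ W V r s y)| ≤ C := by
  have := isProbabilityMeasure_pairPost μ hW hκ₁ hV hκ hr s y
  have h := norm_integral_le_of_norm_le_const (μ := pairPost μ W V r s y) (f := f) (C := C)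
    (ae_of_all _ hf)
  rwa [probReal_univ, mul_one] at h

end PairPosteriorIntegrals

section OverlapBounds
open Matrix
open scoped RealInnerProductSpace
variable {p q : ℕ} {a b : ℝ}

lemma overlapV_eq_inner (ω ω' : SphereVec p a × SphereVec q b) :
    overlapV q ω'.2.1 ω.2.1 = 1 / (q : ℝ) * ⟪vecSignal ω, vecSignal ω'⟫ := by
  simp only [overlapV, vecSignal, PiLp.inner_apply, RCLike.inner_apply, conj_trivial]

lemma abs_overlapV_le (ω : SphereVec p a × SphereVec q b) (v : SphereVec q b) :
    |overlapV q v.1 ω.2.1| ≤ 1 / (q : ℝ) * b := by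
  have hb : 0 ≤ b := by rw [← norm_sq_vecSignal ω]; positivity
  have h := abs_real_inner_le_norm (vecSignal ω) (vecSignal (ω.1, v))
  rw [norm_vecSignal, norm_vecSignal, Real.mul_self_sqrt hb] at h
  rw [overlapV_eq_inner ω (ω.1, v), abs_mul, abs_of_nonneg (by positivity)]
  gcongr

/-- The expected Gibbs bracket of a function of the overlap. -/
lemma Efull_gibbs_overlapV (n : ℕ) {au av t Ru Rv : ℝ} (ht : 0 ≤ (1 - t) / n)
    (hv : 0 ≤ av * Rv) (hu : 0 ≤ au * Ru) (ha : 0 ≤ a) (hb : 0 ≤ b)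
    {Pu : Measure (Fin p → ℝ)} {Pv : Measure (Fin q → ℝ)}
    (hPu : IsUniformSphere p (√a) Pu) (hPv : IsUniformSphere q (√b) Pv)
    {φ : ℝ → ℝ} (hφ : Measurable φ) {C : ℝ} (hC : ∀ x, |x| ≤ 1 / (q : ℝ) * b → |φ x| ≤ C) :
    Efull p q Pu Pv (fun U V Z Zt Zb =>
        gibbs n p q au av t Ru Rv Pu Pv U V Z Zt Zb (fun _ v => φ (overlapV q v V)))
      = ∫ x, ∫ ω', φ (1 / (q : ℝ) * ⟪vecSignal x.1, vecSignal ω'⟫)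
          ∂(pairPost ((sphereLaw p a Pu).prod (sphereLaw q b Pv))
            (matSignal (√((1 - t) / n)) (√(av * Rv))) vecSignal (√(au * Ru))
            (x.2.1 + matSignal (√((1 - t) / n)) (√(av * Rv)) x.1)
            (x.2.2 + √(au * Ru) • vecSignal x.1))
          ∂(pairLaw ((sphereLaw p a Pu).prod (sphereLaw q b Pv))
            (EuclideanSpace ℝ ((Fin p × Fin q) ⊕ Fin p)) (EuclideanSpace ℝ (Fin q))) := by
  have hp1 := isProbabilityMeasure_sphereLaw ha hPu
  have hp2 := isProbabilityMeasure_sphereLaw hb hPv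
  have hW := measurable_matSignal (p := p) (q := q) (a := a) (b := b)
    (√((1 - t) / n)) (√(av * Rv))
  have hV := measurable_vecSignal (p := p) (q := q) (a := a) (b := b)
  have hφC : ∀ ω ω' : SphereVec p a × SphereVec q b,
      |φ (1 / (q : ℝ) * ⟪vecSignal ω, vecSignal ω'⟫)| ≤ C := fun ω ω' => by
    rw [← overlapV_eq_inner]
    exact hC _ (abs_overlapV_le ω ω'.2)
  refine Efull_eq_integral_pairLaw ha hb hPu hPv (C := C)
    (measurable_integral_pairPost_shift _ hW (norm_matSignal _ _) hV norm_vecSignal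
      (Real.sqrt_nonneg _) (hφ.comp (measurable_const_mul (1 / (q : ℝ)))))
    (fun x => abs_integral_pairPost_le _ hW (norm_matSignal _ _) hV norm_vecSignal
      (Real.sqrt_nonneg _) _ _ fun ω' => hφC x.1 ω')
    (fun ω Z Zt Zb => ?_)
  rw [gibbs_eq_integral_pairPost n ht hv hu ha hb hPu hPv (C := C)
      (h := fun v => φ (overlapV q v ω.2.1))
      (hφ.comp (by unfold overlapV; fun_prop)) (fun v => hC _ (abs_overlapV_le ω v))]
  congr 1

lemma eQv_eq_pairQ (n : ℕ) {au av t Ru Rv : ℝ} (ht : 0 ≤ (1 - t) / n)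
    (hv : 0 ≤ av * Rv) (hu : 0 ≤ au * Ru) (ha : 0 ≤ a) (hb : 0 ≤ b)
    {Pu : Measure (Fin p → ℝ)} {Pv : Measure (Fin q → ℝ)}
    (hPu : IsUniformSphere p (√a) Pu) (hPv : IsUniformSphere q (√b) Pv) :
    eQv n p q au av t Ru Rv Pu Pv
      = 1 / (q : ℝ) * pairQ ((sphereLaw p a Pu).prod (sphereLaw q b Pv))
        (matSignal (√((1 - t) / n)) (√(av * Rv))) vecSignal (√(au * Ru)) := by
  have hp1 := isProbabilityMeasure_sphereLaw ha hPu
  have hp2 := isProbabilityMeasure_sphereLaw hb hPv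
  rw [eQv, Efull_gibbs_overlapV n ht hv hu ha hb hPu hPv (φ := fun x => x) measurable_id
    (fun _ h => h), ← (pairQ_eq ((sphereLaw p a Pu).prod (sphereLaw q b Pv))
      (measurable_matSignal _ _) (norm_matSignal _ _) measurable_vecSignal norm_vecSignal
      (Real.sqrt_nonneg (au * Ru))).2.2, ← integral_const_mul]
  congr 1 with x
  rw [integral_const_mul]

lemma overlapVarV_eq_pairVar (n : ℕ) {au av t Ru Rv : ℝ} (ht : 0 ≤ (1 - t) / n)
    (hv : 0 ≤ av * Rv) (hu : 0 ≤ au * Ru) (ha : 0 ≤ a) (hb : 0 ≤ b)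
    {Pu : Measure (Fin p → ℝ)} {Pv : Measure (Fin q → ℝ)}
    (hPu : IsUniformSphere p (√a) Pu) (hPv : IsUniformSphere q (√b) Pv) :
    overlapVarV n p q au av t Ru Rv Pu Pv
      = (1 / (q : ℝ)) ^ 2 * pairVar ((sphereLaw p a Pu).prod (sphereLaw q b Pv))
        (matSignal (√((1 - t) / n)) (√(av * Rv))) vecSignal (√(au * Ru))
        (pairQ ((sphereLaw p a Pu).prod (sphereLaw q b Pv))
        (matSignal (√((1 - t) / n)) (√(av * Rv))) vecSignal (√(au * Ru))) := by
  rw [overlapVarV, eQv_eq_pairQ n ht hv hu ha hb hPu hPv]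
  set m := pairQ ((sphereLaw p a Pu).prod (sphereLaw q b Pv))
        (matSignal (√((1 - t) / n)) (√(av * Rv))) vecSignal (√(au * Ru))
  rw [Efull_gibbs_overlapV n ht hv hu ha hb hPu hPv (φ := fun x => (x - 1 / (q : ℝ) * m) ^ 2)
    (C := (1 / (q : ℝ) * b + |1 / (q : ℝ) * m|) ^ 2) (by fun_prop) (fun x hx => by
      rw [abs_of_nonneg (sq_nonneg _), ← sq_abs]
      have := abs_sub x (1 / (q : ℝ) * m)
      gcongr
      linarith), pairVar, ← integral_const_mul]
  congr 1 with x
  rw [← integral_const_mul]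
  congr 1 with ω'
  ring

/-- The fluctuations of the log-evidence in the sphere model. -/
lemma exists_pairW_sphere_le (c₁ c₂ : ℝ) {r : ℝ} (hr : 0 ≤ r) (ha : 0 ≤ a) (hb : 0 ≤ b)
    {Pu : Measure (Fin p → ℝ)} {Pv : Measure (Fin q → ℝ)}
    (hPu : IsUniformSphere p (√a) Pu) (hPv : IsUniformSphere q (√b) Pv) :
    ∃ c, pairW ((sphereLaw p a Pu).prod (sphereLaw q b Pv)) (matSignal c₁ c₂) vecSignal r c
      ≤ π ^ 2 * (2 * (c₁ ^ 2 * (a * b) + c₂ ^ 2 * a + r ^ 2 * b)) := by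
  have hp1 := isProbabilityMeasure_sphereLaw ha hPu
  have hp2 := isProbabilityMeasure_sphereLaw hb hPv
  obtain ⟨ω⟩ := nonempty_of_isProbabilityMeasure ((sphereLaw p a Pu).prod (sphereLaw q b Pv))
  have h := pairW_le ((sphereLaw p a Pu).prod (sphereLaw q b Pv)) (measurable_matSignal c₁ c₂)
    (norm_matSignal _ _) measurable_vecSignal norm_vecSignal hr
    (integral_log_pairZ_sphere_eq c₁ c₂ hr ha hb hPu hPv ω)
  rw [Real.sq_sqrt hb, Real.sq_sqrt (by positivity)] at h
  exact ⟨_, h⟩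

/-- Pointwise bound of the overlap variance by the increment of the mean overlap. -/
lemma overlapVarV_le (n : ℕ) {au av t R δ Rv : ℝ} (ht : 0 ≤ (1 - t) / n)
    (hv : 0 ≤ av * Rv) (hau : 0 < au) (hR : 0 ≤ R) (hδ : 0 < δ) (ha : 0 ≤ a) (hb : 0 ≤ b)
    {Pu : Measure (Fin p → ℝ)} {Pv : Measure (Fin q → ℝ)}
    (hPu : IsUniformSphere p (√a) Pu) (hPv : IsUniformSphere q (√b) Pv) :
    overlapVarV n p q au av t R Rv Pu Pv
      ≤ (1 / (q : ℝ)) ^ 2 * (6 * b / (au * δ)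
        + 12 * b * (pairQ ((sphereLaw p a Pu).prod (sphereLaw q b Pv))
            (matSignal (√((1 - t) / n)) (√(av * Rv))) vecSignal (√(au * (R + δ)))
          - pairQ ((sphereLaw p a Pu).prod (sphereLaw q b Pv))
            (matSignal (√((1 - t) / n)) (√(av * Rv))) vecSignal (√(au * R)))
        + 6 * b ^ 2 * (δ / (R + δ))
        + 96 * π ^ 2 / (au * δ) ^ 2 * (2 * ((1 - t) / n * (a * b) + av * Rv * a)
          + au * (2 * R + δ) * b)) := by
  have hp1 := isProbabilityMeasure_sphereLaw ha hPu
  have hp2 := isProbabilityMeasure_sphereLaw hb hPv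
  have hau0 := hau.le
  have hRδ : 0 < R + δ := by linarith
  rw [overlapVarV_eq_pairVar n ht hv (by positivity) ha hb hPu hPv]
  refine mul_le_mul_of_nonneg_left ?_ (sq_nonneg _)
  obtain ⟨c₁, hc₁⟩ := exists_pairW_sphere_le (√((1 - t) / n)) (√(av * Rv))
    (Real.sqrt_nonneg (au * R)) ha hb hPu hPv
  obtain ⟨c, hc⟩ := exists_pairW_sphere_le (√((1 - t) / n)) (√(av * Rv))
    (Real.sqrt_nonneg (au * (R + δ))) ha hb hPu hPv
  have h := pairVar_le ((sphereLaw p a Pu).prod (sphereLaw q b Pv))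
    (measurable_matSignal (√((1 - t) / n)) (√(av * Rv))) (norm_matSignal _ _)
    measurable_vecSignal norm_vecSignal (Real.sqrt_nonneg (au * R))
    (Real.sqrt_pos.2 (mul_pos hau hδ)) (Real.sqrt_pos.2 (mul_pos hau hRδ))
    (by rw [Real.sq_sqrt (by positivity), Real.sq_sqrt (by positivity),
          Real.sq_sqrt (by positivity)]; ring) c₁ c
  have h4 : ∀ {x : ℝ}, 0 ≤ x → √x ^ 4 = x ^ 2 := fun {x} hx => by
    rw [show 4 = 2 * 2 from rfl, pow_mul, Real.sq_sqrt hx]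
  rw [h4 hb, h4 (mul_pos hau hδ).le, Real.sq_sqrt hb, Real.sq_sqrt (mul_pos hau hδ).le,
    Real.sq_sqrt (mul_pos hau hRδ).le, mul_div_mul_left _ _ hau.ne'] at h
  rw [Real.sq_sqrt ht, Real.sq_sqrt hv, Real.sq_sqrt (by positivity)] at hc₁ hc
  refine h.trans (add_le_add le_rfl ?_)
  refine (mul_le_mul_of_nonneg_left (add_le_add hc hc₁) (by positivity)).trans_eq ?_
  ring

lemma integral_le_of_le_increment {f Q : ℝ → ℝ} {a b δ c k L : ℝ} (hab : a ≤ b) (hδ : 0 ≤ δ)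
    (hQ : Monotone Q) (hQ0 : ∀ x, 0 ≤ Q x) (hQL : ∀ x, Q x ≤ L) (hc : 0 ≤ c) (hk : 0 ≤ k)
    (hf : ∀ x ∈ Icc a b, f x ≤ c + k * (Q (x + δ) - Q x)) :
    ∫ x in a..b, f x ≤ (b - a) * c + k * (L * δ) := by
  have hL : 0 ≤ L := (hQ0 0).trans (hQL 0)
  have hba : 0 ≤ b - a := sub_nonneg.2 hab
  by_cases hi : IntervalIntegrable f volume a b
  swap
  · rw [intervalIntegral.integral_undef hi]
    positivity
  have hQi : ∀ x y, IntervalIntegrable Q volume x y := fun x y => hQ.intervalIntegrable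
  have hQδ : IntervalIntegrable (fun x => Q (x + δ)) volume a b :=
    Monotone.intervalIntegrable fun x y h => hQ (by linarith)
  have hinc : ∫ x in a..b, (Q (x + δ) - Q x) ≤ L * δ := by
    rw [intervalIntegral.integral_sub hQδ (hQi _ _), intervalIntegral.integral_comp_add_right,
      intervalIntegral.integral_interval_sub_interval_comm (hQi _ _) (hQi _ _) (hQi _ _)]
    have h1 : 0 ≤ ∫ x in a..a + δ, Q x :=
      intervalIntegral.integral_nonneg (by linarith) fun x _ => hQ0 x
    have h2 : ∫ x in b..b + δ, Q x ≤ ∫ _ in b..b + δ, L :=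
      intervalIntegral.integral_mono_on (by linarith) (hQi _ _) intervalIntegrable_const
        fun x _ => hQL x
    rw [intervalIntegral.integral_const, smul_eq_mul] at h2
    rw [intervalIntegral.integral_symm a (a + δ), intervalIntegral.integral_symm b (b + δ)]
    linarith
  have hi2 : IntervalIntegrable (fun x => k * (Q (x + δ) - Q x)) volume a b :=
    (hQδ.sub (hQi _ _)).const_mul k
  have h := intervalIntegral.integral_mono_on hab hi (intervalIntegrable_const.add hi2) hf
  rw [intervalIntegral.integral_add intervalIntegrable_const hi2,
    intervalIntegral.integral_const, intervalIntegral.integral_const_mul, smul_eq_mul] at h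
  have := mul_le_mul_of_nonneg_left hinc hk
  linarith

end OverlapBounds

/-- Elementary collection of the error terms, for dimensions `p`, `q` of order `n`. -/
lemma overlap_error_le {au av ru rv Mu Mv n p q a δ t R Rv : ℝ} (hau : 0 < au) (hav : 0 < av)
    (hru : 0 < ru) (hrv : 0 < rv) (hn : 0 < n) (hp : 0 ≤ p) (hpn : p ≤ 2 * au * n)
    (hqn : av / 2 * n ≤ q) (hqn' : q ≤ 2 * av * n) (hMv : 0 < Mv) (hδ : 0 < δ) (hδa : δ < a)
    (ha1 : a < 1) (haR : a ≤ R) (hR : R ≤ Mu) (hRv : 0 ≤ Rv) (hRvM : Rv ≤ Mv)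
    (ht : 0 ≤ t) (ht1 : t ≤ 1) (Δ : ℝ) :
    (1 / q) ^ 2 * (6 * (rv * q) / (au * δ) + 12 * (rv * q) * Δ
        + 6 * (rv * q) ^ 2 * (δ / (R + δ))
        + 96 * π ^ 2 / (au * δ) ^ 2 * (2 * ((1 - t) / n * (ru * p * (rv * q)) + av * Rv * (ru * p))
          + au * (2 * R + δ) * (rv * q)))
      ≤ ((12 * rv / (au * av) + 4 / av ^ 2 * (96 * π ^ 2 / au ^ 2 *
          (2 * (4 * ru * rv * au * av + 2 * av * Mv * ru * au) + 6 * au * Mu * rv * av)))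
          * (1 / (δ ^ 2 * n)) + 6 * rv ^ 2 * (δ / (a - δ))) + 12 * rv / q * Δ := by
  have hq : 0 < q := lt_of_lt_of_le (by positivity) hqn
  have hδ1 : δ < 1 := hδa.trans ha1
  have hR0 : 0 < R := by linarith
  have hMu : 0 < Mu := by linarith
  have had : 0 < a - δ := by linarith
  have hqi : 1 / q ≤ 2 / (av * n) := by
    rw [div_le_div_iff₀ hq (by positivity)]
    linarith
  have t1 : (1 / q) ^ 2 * (6 * (rv * q) / (au * δ)) ≤ 12 * rv / (au * av) * (1 / (δ ^ 2 * n)) := by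
    calc (1 / q) ^ 2 * (6 * (rv * q) / (au * δ)) = 6 * rv / (au * δ) * (1 / q) := by
          field_simp
      _ ≤ 6 * rv / (au * δ) * (2 / (av * n)) := by gcongr
      _ = 12 * rv / (au * av) * (1 / (δ * n)) := by field_simp; ring
      _ ≤ 12 * rv / (au * av) * (1 / (δ ^ 2 * n)) := by
          have : δ ^ 2 ≤ δ := by nlinarith
          gcongr
  have t2 : (1 / q) ^ 2 * (12 * (rv * q) * Δ) = 12 * rv / q * Δ := by field_simp
  have t3 : (1 / q) ^ 2 * (6 * (rv * q) ^ 2 * (δ / (R + δ))) ≤ 6 * rv ^ 2 * (δ / (a - δ)) := by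
    calc (1 / q) ^ 2 * (6 * (rv * q) ^ 2 * (δ / (R + δ))) = 6 * rv ^ 2 * (δ / (R + δ)) := by
          field_simp
      _ ≤ _ := by
          have : a - δ ≤ R + δ := by linarith
          gcongr
  have k1 : (1 - t) / n * (ru * p * (rv * q)) ≤ 4 * ru * rv * au * av * n := by
    calc (1 - t) / n * (ru * p * (rv * q))
        ≤ 1 / n * (ru * (2 * au * n) * (rv * (2 * av * n))) := by
          have : 1 - t ≤ 1 := by linarith
          gcongr
      _ = _ := by field_simp; ring
  have k2 : av * Rv * (ru * p) ≤ 2 * av * Mv * ru * au * n := by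
    calc av * Rv * (ru * p) ≤ av * Mv * (ru * (2 * au * n)) := by gcongr
      _ = _ := by ring
  have k3 : au * (2 * R + δ) * (rv * q) ≤ 6 * au * Mu * rv * av * n := by
    calc au * (2 * R + δ) * (rv * q) ≤ au * (3 * Mu) * (rv * (2 * av * n)) := by
          have : 2 * R + δ ≤ 3 * Mu := by linarith
          gcongr
      _ = _ := by ring
  have t4 : (1 / q) ^ 2 * (96 * π ^ 2 / (au * δ) ^ 2 *
        (2 * ((1 - t) / n * (ru * p * (rv * q)) + av * Rv * (ru * p))
          + au * (2 * R + δ) * (rv * q)))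
      ≤ 4 / av ^ 2 * (96 * π ^ 2 / au ^ 2 *
          (2 * (4 * ru * rv * au * av + 2 * av * Mv * ru * au) + 6 * au * Mu * rv * av))
          * (1 / (δ ^ 2 * n)) := by
    calc _ ≤ (2 / (av * n)) ^ 2 * (96 * π ^ 2 / (au * δ) ^ 2 *
          ((2 * (4 * ru * rv * au * av + 2 * av * Mv * ru * au) + 6 * au * Mu * rv * av) * n)) := by
          have h1t : 0 ≤ 1 - t := by linarith
          have hsum : 2 * ((1 - t) / n * (ru * p * (rv * q)) + av * Rv * (ru * p))
              + au * (2 * R + δ) * (rv * q) ≤ (2 * (4 * ru * rv * au * av + 2 * av * Mv * ru * au)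
                + 6 * au * Mu * rv * av) * n := by linarith
          gcongr
      _ = _ := by
          field_simp
          norm_num
  rw [mul_add, mul_add, mul_add, t2]
  linarith

/-- **Proposition: concentration of the overlap `Q_v`.** Let
`M_u, M_v > 0`. For `n` large enough, there exists a constant `M` such that for all
`(a,b) ∈ (0,M_u)²` with `a < min{1,b}`, all `δ ∈ (0,a)`, all `R_v ∈ [0,M_v]` and all
`t ∈ [0,1]`:
`∫_a^b E⟨(Q_v − E⟨Q_v⟩)²⟩ dR_u ≤ M(1/(δ²n) − ln(a)/n + δ/(a−δ))`. -/
theorem overlap_concentration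
    (au av ru rv : ℝ) (hau : 0 < au) (hav : 0 < av) (hru : 0 < ru) (hrv : 0 < rv)
    (nuf nvf : ℕ → ℕ)
    (hnuf : Tendsto (fun n => (nuf n : ℝ) / n) atTop (nhds au))
    (hnvf : Tendsto (fun n => (nvf n : ℝ) / n) atTop (nhds av))
    (Pu : (n : ℕ) → Measure (Fin (nuf n) → ℝ))
    (Pv : (n : ℕ) → Measure (Fin (nvf n) → ℝ))
    (hPu : ∀ n, IsUniformSphere (nuf n) (Real.sqrt (ru * nuf n)) (Pu n))
    (hPv : ∀ n, IsUniformSphere (nvf n) (Real.sqrt (rv * nvf n)) (Pv n))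
    (Mu Mv : ℝ) (hMu : 0 < Mu) (hMv : 0 < Mv) :
    ∃ (N : ℕ) (M : ℝ), ∀ n : ℕ, N ≤ n →
      ∀ a b : ℝ, a ∈ Ioo (0:ℝ) Mu → b ∈ Ioo (0:ℝ) Mu → a < min 1 b →
        ∀ δ : ℝ, δ ∈ Ioo (0:ℝ) a → ∀ Rv ∈ Icc (0:ℝ) Mv, ∀ t ∈ Icc (0:ℝ) 1,
          (∫ Ru in a..b, overlapVarV n (nuf n) (nvf n) au av t Ru Rv (Pu n) (Pv n))
            ≤ M * (1 / (δ ^ 2 * n) - Real.log a / n + δ / (a - δ)) := by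
  have hpos : ∀ᶠ n : ℕ in atTop, 0 < n := eventually_gt_atTop 0
  have hpu : ∀ᶠ n : ℕ in atTop, (nuf n : ℝ) / n < 2 * au :=
    hnuf.eventually_lt_const (by linarith)
  have hqv : ∀ᶠ n : ℕ in atTop, (nvf n : ℝ) / n < 2 * av :=
    hnvf.eventually_lt_const (by linarith)
  have hqv' : ∀ᶠ n : ℕ in atTop, av / 2 < (nvf n : ℝ) / n :=
    hnvf.eventually_const_lt (by linarith)
  obtain ⟨N, hN⟩ := eventually_atTop.1 (hpos.and (hpu.and (hqv.and hqv')))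
  set K := 12 * rv / (au * av) + 4 / av ^ 2 * (96 * π ^ 2 / au ^ 2 *
          (2 * (4 * ru * rv * au * av + 2 * av * Mv * ru * au) + 6 * au * Mu * rv * av)) with hK
  have hK0 : 0 ≤ K := by positivity
  refine ⟨N, Mu * K + 18 * Mu * rv ^ 2, fun n hn a b ha hb hab δ hδ Rv hRv t ht => ?_⟩
  obtain ⟨hn0, hp, hq', hq⟩ := hN n hn
  have hn0' : (0 : ℝ) < n := Nat.cast_pos.2 hn0
  rw [div_lt_iff₀ hn0'] at hp hq'
  rw [lt_div_iff₀ hn0'] at hq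
  have hq0 : (0 : ℝ) < nvf n := lt_trans (by positivity) hq
  obtain ⟨ha1, hab⟩ := lt_min_iff.1 hab
  have hca : 0 ≤ ru * nuf n := by positivity
  have hcb : 0 ≤ rv * nvf n := by positivity
  have h1t : 0 ≤ (1 - t) / n := div_nonneg (sub_nonneg.2 ht.2) hn0'.le
  have hvR : 0 ≤ av * Rv := mul_nonneg hav.le hRv.1
  have hp1 := isProbabilityMeasure_sphereLaw hca (hPu n)
  have hp2 := isProbabilityMeasure_sphereLaw hcb (hPv n)
  set Q : ℝ → ℝ := fun R =>
    pairQ ((sphereLaw (nuf n) (ru * nuf n) (Pu n)).prod (sphereLaw (nvf n) (rv * nvf n) (Pv n)))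
      (matSignal (√((1 - t) / n)) (√(av * Rv))) vecSignal (√(au * R)) with hQ
  have hQm : Monotone Q := fun x y hxy =>
    pairQ_mono _ (measurable_matSignal _ _) (norm_matSignal _ _) measurable_vecSignal
      norm_vecSignal (Real.sqrt_nonneg _)
      (Real.sqrt_le_sqrt (mul_le_mul_of_nonneg_left hxy hau.le))
  have hQ0 : ∀ x, 0 ≤ Q x := fun x =>
    pairQ_nonneg _ (measurable_matSignal _ _) (norm_matSignal _ _) measurable_vecSignal
      norm_vecSignal (Real.sqrt_nonneg _)
  have hQL : ∀ x, Q x ≤ rv * nvf n := fun x => by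
    have h := pairQ_le ((sphereLaw (nuf n) (ru * nuf n) (Pu n)).prod
      (sphereLaw (nvf n) (rv * nvf n) (Pv n)))
      (measurable_matSignal (√((1 - t) / n)) (√(av * Rv))) (norm_matSignal _ _)
      measurable_vecSignal norm_vecSignal (Real.sqrt_nonneg (au * x))
    rwa [Real.sq_sqrt hcb] at h
  have had : 0 < a - δ := sub_pos.2 hδ.2
  have hδ0 : 0 < δ := hδ.1
  have hfrac : 0 < δ / (a - δ) := by positivity
  have hδn : 0 < 1 / (δ ^ 2 * n) := by positivity
  have hint := integral_le_of_le_increment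
    (f := fun R => overlapVarV n (nuf n) (nvf n) au av t R Rv (Pu n) (Pv n))
    (c := K * (1 / (δ ^ 2 * n)) + 6 * rv ^ 2 * (δ / (a - δ))) (k := 12 * rv / nvf n)
    hab.le hδ0.le hQm hQ0 hQL (by positivity) (by positivity) fun R hR =>
    (overlapVarV_le n h1t hvR hau (ha.1.le.trans hR.1) hδ0 hca hcb (hPu n) (hPv n)).trans
      (overlap_error_le hau hav hru hrv hn0' (Nat.cast_nonneg _) hp.le hq.le hq'.le hMv hδ0 hδ.2
        ha1 hR.1 (hR.2.trans hb.2.le) hRv.1 hRv.2 ht.1 ht.2 (Q (R + δ) - Q R))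
  have hkL : 12 * rv / nvf n * (rv * nvf n * δ) = 12 * rv ^ 2 * δ := by
    field_simp
  have hδM : δ ≤ Mu * (δ / (a - δ)) := by
    rw [← mul_div_assoc, le_div_iff₀ had, mul_comm]
    exact mul_le_mul_of_nonneg_right (by linarith [ha.2]) hδ0.le
  have hbM : (b - a) * (K * (1 / (δ ^ 2 * n)) + 6 * rv ^ 2 * (δ / (a - δ)))
      ≤ Mu * (K * (1 / (δ ^ 2 * n)) + 6 * rv ^ 2 * (δ / (a - δ))) :=
    mul_le_mul_of_nonneg_right (by linarith [hb.2, ha.1]) (by positivity)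
  have hlog : 0 ≤ -(Real.log a / n) :=
    neg_nonneg.2 (div_nonpos_of_nonpos_of_nonneg (Real.log_nonpos ha.1.le ha1.le) hn0'.le)
  have hMK : 0 ≤ Mu * K := by positivity
  have hMr : 0 ≤ 18 * Mu * rv ^ 2 := by positivity
  have hrδ := mul_le_mul_of_nonneg_left hδM (by positivity : 0 ≤ 12 * rv ^ 2)
  calc _ ≤ _ := hint
    _ ≤ Mu * K * (1 / (δ ^ 2 * n)) + 18 * Mu * rv ^ 2 * (δ / (a - δ)) := by
        rw [hkL]
        linarith
    _ ≤ (Mu * K + 18 * Mu * rv ^ 2) * (1 / (δ ^ 2 * n) + δ / (a - δ)) := by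
        have := mul_nonneg hMK hfrac.le
        have := mul_nonneg hMr hδn.le
        linarith
    _ ≤ (Mu * K + 18 * Mu * rv ^ 2) * (1 / (δ ^ 2 * n) - Real.log a / n + δ / (a - δ)) := by
        refine mul_le_mul_of_nonneg_left ?_ (by positivity)
        linarith

end
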